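/- arXiv:1508.01565 — 4 statements merged into one kernel-verified Lean document; each statement's English description precedes it below -/
import Mathlib

section
/- Let f ∈ ℬ with upper and lower semicontinuous envelopes f* and f_*. Then with probability one the following holds simultaneously for all x0 ∈ (0,∞)^d and all twice continuously differentiable φ : ℝ^d → ℝ with ∂φ/∂x_i(x0) > 0 for every i: writing A_ε(x0) = {x ∈ B(x0, √ε) : x ≤ x0 and φ(x) ≥ φ(x0) − ε}, one has limsup_{ε→0⁺} limsup_{n→∞} ε^{-1} n^{-1/d} ℓ(𝒫_{nf} ∩ A_ε(x0)) ≤ (c_d/d) · (f*(x0) / (∂φ/∂x_1(x0) ⋯ ∂φ/∂x_d(x0)))^{1/d}, and liminf_{ε→0⁺} liminf_{n→∞} ε^{-1} n^{-1/d} ℓ(𝒫_{nf} ∩ A_ε(x0)) ≥ (c_d/d) · (f_*(x0) / (∂φ/∂x_1(x0) ⋯ ∂φ/∂x_d(x0)))^{1/d}. -/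
open MeasureTheory Filter Set Topology

noncomputable section

/-- `ℓ(A)`: the maximal cardinality of a chain (finite subset totally ordered by the
coordinatewise partial order `≤`) contained in `A ⊆ ℝ^d`. -/
def chainLength (d : ℕ) (A : Set (Fin d → ℝ)) : ℕ :=
  sSup {n : ℕ | ∃ C : Finset (Fin d → ℝ),
    ↑C ⊆ A ∧ IsChain (· ≤ ·) (C : Set (Fin d → ℝ)) ∧ C.card = n}

/-- The class `ℬ` of nonnegative, locally bounded, Lebesgue-measurable functions. -/
def MemB (d : ℕ) (f : (Fin d → ℝ) → ℝ) : Prop :=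
  Measurable f ∧ (∀ x, 0 ≤ f x) ∧ ∀ x : Fin d → ℝ, ∃ U ∈ 𝓝 x, BddAbove (f '' U)

/-- The Euclidean norm on `ℝ^d` (modelled as `Fin d → ℝ`). -/
def euclNorm (d : ℕ) (x : Fin d → ℝ) : ℝ := Real.sqrt (∑ i, (x i) ^ 2)

/-- The expectation `E[ℓ_n]` of the length of a longest chain among `n` i.i.d. points
uniformly distributed in the unit cube `[0,1]^d`. -/
def BWexpect (d n : ℕ) : ℝ :=
  ∫ X : Fin n → Fin d → ℝ, (chainLength d (Set.range X) : ℝ)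
    ∂(Measure.pi fun _ => volume.restrict (Set.Icc (0 : Fin d → ℝ) 1))

/-- `c` is the Bollobás–Winkler constant `c_d`: `c > 0` and `n^{-1/d} E[ℓ_n] → c`. -/
def IsBWConstant (d : ℕ) (c : ℝ) : Prop :=
  0 < c ∧ Tendsto (fun n : ℕ => (n : ℝ) ^ (-(1 : ℝ) / d) * BWexpect d n) atTop (nhds c)

/-- A Poisson point process on `ℝ^d` with intensity function `g`, on a probability space
`(Ω, P)`: a random at-most-countable subset of `ℝ^d` such that for every bounded Borel set `A`
the count `#(pts ω ∩ A)` is measurable with Poisson distribution of mean `∫_A g`, and counts of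
pairwise disjoint Borel sets are independent. -/
structure PoissonPP (d : ℕ) {Ω : Type*} [MeasurableSpace Ω] (P : Measure Ω)
    (g : (Fin d → ℝ) → ℝ) where
  pts : Ω → Set (Fin d → ℝ)
  countable : ∀ ω, (pts ω).Countable
  measur : ∀ A : Set (Fin d → ℝ), MeasurableSet A → Bornology.IsBounded A →
    ∀ k : ℕ, MeasurableSet {ω | (pts ω ∩ A).encard = k}
  poisson : ∀ A : Set (Fin d → ℝ), MeasurableSet A → Bornology.IsBounded A →
    ∀ k : ℕ, P {ω | (pts ω ∩ A).encard = k}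
      = ENNReal.ofReal (Real.exp (-(∫ x in A, g x)) * (∫ x in A, g x) ^ k / k.factorial)
  indep : ∀ (n : ℕ) (A : Fin n → Set (Fin d → ℝ)),
    (∀ i, MeasurableSet (A i)) → (∀ i, Bornology.IsBounded (A i)) →
    (Pairwise fun i j => Disjoint (A i) (A j)) →
    ∀ k : Fin n → ℕ,
      P (⋂ i, {ω | (pts ω ∩ A i).encard = k i})
        = ∏ i, P {ω | (pts ω ∩ A i).encard = k i}

/-- Upper semicontinuous envelope `f*`. -/
def upperEnv (d : ℕ) (f : (Fin d → ℝ) → ℝ) (x : Fin d → ℝ) : ℝ := limsup f (𝓝 x)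

/-- Lower semicontinuous envelope `f_*`. -/
def lowerEnv (d : ℕ) (f : (Fin d → ℝ) → ℝ) (x : Fin d → ℝ) : ℝ := liminf f (𝓝 x)

/-- The simplex `S_{x,v} = {z : z ≤ x, ⟨x-z,v⟩ ≤ 1}`. -/
def simplexS (d : ℕ) (x v : Fin d → ℝ) : Set (Fin d → ℝ) :=
  {z | z ≤ x ∧ ∑ i, (x i - z i) * v i ≤ 1}

/-- `u` is a nondecreasing viscosity solution of the problem (P):
`u_{x_1} ⋯ u_{x_d} = (c_d/d)^d f` in `(0,∞)^d`, `u = 0` on `∂ℝ^d_+`. -/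
def IsNDViscSol (d : ℕ) (c : ℝ) (f u : (Fin d → ℝ) → ℝ) : Prop :=
  ContinuousOn u (Set.Ici 0) ∧
  (∀ x y : Fin d → ℝ, 0 ≤ x → x ≤ y → u x ≤ u y) ∧
  (∀ x : Fin d → ℝ, 0 ≤ x → (∃ i, x i = 0) → u x = 0) ∧
  (∀ x₀ : Fin d → ℝ, (∀ i, 0 < x₀ i) →
    ∀ φ : (Fin d → ℝ) → ℝ, ContDiff ℝ ((⊤ : ℕ∞) : WithTop ℕ∞) φ →
      IsLocalMaxOn (fun y => u y - φ y) (Set.Ici 0) x₀ →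
      ∏ i, fderiv ℝ φ x₀ (Pi.single i 1) ≤ (c / d) ^ d * upperEnv d f x₀) ∧
  (∀ x₀ : Fin d → ℝ, (∀ i, 0 < x₀ i) →
    ∀ φ : (Fin d → ℝ) → ℝ, ContDiff ℝ ((⊤ : ℕ∞) : WithTop ℕ∞) φ →
      IsLocalMinOn (fun y => u y - φ y) (Set.Ici 0) x₀ →
      (c / d) ^ d * lowerEnv d f x₀ ≤ ∏ i, fderiv ℝ φ x₀ (Pi.single i 1))


/-- Expanding the second moment around a constant. -/
lemma integral_sub_const_sq {E : Type*} [MeasurableSpace E] (μ : Measure E)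
    [IsProbabilityMeasure μ] {w : E → ℝ} (h1 : Integrable w μ) (h2 : Integrable (fun x => w x ^ 2) μ)
    (D : ℝ) : ∫ x, (w x - D) ^ 2 ∂μ = ∫ x, w x ^ 2 ∂μ - 2 * D * ∫ x, w x ∂μ + D ^ 2 := by
  have e : (fun x => (w x - D) ^ 2) = fun x => w x ^ 2 + ((-(2 * D)) * w x + D ^ 2) := by
    ext x; ring
  have h3 : Integrable (fun x => (-(2 * D)) * w x + D ^ 2) μ :=
    (h1.const_mul _).add (integrable_const _)
  rw [e, integral_add h2 h3, integral_add (h1.const_mul _) (integrable_const _),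
    integral_const_mul]
  simp; ring

lemma measurable_fin_cons {E : Type*} [MeasurableSpace E] {n : ℕ} :
    Measurable fun p : E × (Fin n → E) => (Fin.cons p.1 p.2 : Fin (n + 1) → E) := by
  refine measurable_pi_lambda _ fun i => ?_
  refine Fin.cases ?_ (fun j => ?_) i
  · simpa using measurable_fst
  · simp only [Fin.cons_succ]
    exact (measurable_pi_apply j).comp measurable_snd

/-- Integration over `E ^ (n + 1)` as an iterated integral, first coordinate outside. -/
lemma integral_pi_succ {E : Type*} [MeasurableSpace E] (μ : Measure E) [IsProbabilityMeasure μ]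
    {n : ℕ} {g : (Fin (n + 1) → E) → ℝ} (hg : Measurable g) {K : ℝ} (hK : ∀ x, |g x| ≤ K) :
    ∫ x, g x ∂(Measure.pi fun _ => μ)
      = ∫ y, ∫ z, g (Fin.cons y z) ∂(Measure.pi fun _ : Fin n => μ) ∂μ := by
  have hmp := (measurePreserving_piFinSuccAbove (fun _ : Fin (n + 1) => μ) 0).symm
  have hcons := measurable_fin_cons (E := E) (n := n)
  rw [← hmp.integral_comp']
  have e : ∀ p : E × (Fin n → E), (MeasurableEquiv.piFinSuccAbove (fun _ => E) 0).symm p =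
      Fin.cons p.1 p.2 := fun p => by
    simp [MeasurableEquiv.piFinSuccAbove]
    rfl
  simp_rw [e]
  refine integral_prod (fun p : E × (Fin n → E) => g (Fin.cons p.1 p.2)) ?_
  refine Integrable.of_bound (hg.comp hcons).aestronglyMeasurable K ?_
  exact ae_of_all _ fun p => hK _

/-- The Efron–Stein inequality for bounded functions of independent variables. -/
lemma efron_stein {E : Type*} [MeasurableSpace E] (μ : Measure E) [IsProbabilityMeasure μ]
    {n : ℕ} {g : (Fin n → E) → ℝ} {h : Fin n → (Fin n → E) → ℝ} {K : ℝ}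
    (hg : Measurable g) (hgK : ∀ x, |g x| ≤ K)
    (hh : ∀ i, Measurable (h i)) (hhK : ∀ i x, |h i x| ≤ K)
    (hdep : ∀ i x y, h i (Function.update x i y) = h i x) :
    ∫ x, g x ^ 2 ∂(Measure.pi fun _ => μ) - (∫ x, g x ∂(Measure.pi fun _ => μ)) ^ 2
      ≤ ∑ i, ∫ x, (g x - h i x) ^ 2 ∂(Measure.pi fun _ => μ) := by
  induction n with
  | zero =>
    have hc : ∀ φ : (Fin 0 → E) → ℝ, φ = fun _ => φ (fun i => i.elim0) := fun φ => by
      ext x; congr 1; exact Subsingleton.elim _ _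
    rw [hc g]; simp
  | succ n ih =>
    have hcons := measurable_fin_cons (E := E) (n := n)
    have hcons1 : ∀ y, Measurable fun z : Fin n → E => (Fin.cons y z : Fin (n + 1) → E) :=
      fun y => hcons.comp (measurable_const.prodMk measurable_id)
    have sqb : ∀ a b : ℝ, |a| ≤ b → |a ^ 2| ≤ b ^ 2 := fun a b hab => by
      rw [abs_pow]; exact pow_le_pow_left₀ (abs_nonneg _) hab 2
    have hdiffK : ∀ i x, |g x - h i x| ≤ 2 * K := fun i x =>
      (abs_sub _ _).trans (by linarith [hgK x, hhK i x])
    set ν := Measure.pi fun _ : Fin n => μ with hν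
    have int1 : ∀ {φ : (Fin (n + 1) → E) → ℝ} {L : ℝ}, Measurable φ → (∀ x, |φ x| ≤ L) →
        ∀ y, Integrable (fun z => φ (Fin.cons y z)) ν := fun hφ hL y =>
      Integrable.of_bound (hφ.comp (hcons1 y)).aestronglyMeasurable _ (ae_of_all _ fun z => hL _)
    have meas2 : ∀ {φ : (Fin (n + 1) → E) → ℝ}, Measurable φ →
        StronglyMeasurable (fun y => ∫ z, φ (Fin.cons y z) ∂ν) := fun hφ =>
      StronglyMeasurable.integral_prod_right (hφ.comp hcons).stronglyMeasurable
    have bd2 : ∀ {φ : (Fin (n + 1) → E) → ℝ} {L : ℝ}, (∀ x, |φ x| ≤ L) →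
        ∀ y, ‖∫ z, φ (Fin.cons y z) ∂ν‖ ≤ L := fun {φ L} hL y => by
      refine (norm_integral_le_of_norm_le_const (ae_of_all _ fun z => hL _)).trans ?_
      simp
    have int2 : ∀ {φ : (Fin (n + 1) → E) → ℝ} {L : ℝ}, Measurable φ → (∀ x, |φ x| ≤ L) →
        Integrable (fun y => ∫ z, φ (Fin.cons y z) ∂ν) μ := fun hφ hL =>
      Integrable.of_bound (meas2 hφ).aestronglyMeasurable _ (ae_of_all _ fun y => bd2 hL y)
    have hg2 : ∀ x, |g x ^ 2| ≤ K ^ 2 := fun x => sqb _ _ (hgK x)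
    have hd2 : ∀ i x, |(g x - h i x) ^ 2| ≤ (2 * K) ^ 2 := fun i x => sqb _ _ (hdiffK i x)
    have md2 : ∀ i, Measurable fun x => (g x - h i x) ^ 2 := fun i => (hg.sub (hh i)).pow_const 2
    rw [integral_pi_succ μ (hg.pow_const 2) hg2, integral_pi_succ μ hg hgK, Fin.sum_univ_succ]
    simp_rw [fun i => integral_pi_succ μ (md2 i) (hd2 i)]
    set m : E → ℝ := fun y => ∫ z, g (Fin.cons y z) ∂ν with hm
    have msq : Integrable (fun y => m y ^ 2) μ :=
      Integrable.of_bound ((meas2 hg).pow 2).aestronglyMeasurable (K ^ 2)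
        (ae_of_all _ fun y => sqb _ _ (bd2 hgK y))
    have mint : Integrable m μ := int2 hg hgK
    have key1 : ∀ y, ∫ z, g (Fin.cons y z) ^ 2 ∂ν ≤
        m y ^ 2 + ∑ i : Fin n, ∫ z, (g (Fin.cons y z) - h i.succ (Fin.cons y z)) ^ 2 ∂ν := fun y => by
      have := ih (g := fun z => g (Fin.cons y z)) (h := fun i z => h i.succ (Fin.cons y z))
        (hg.comp (hcons1 y)) (fun z => hgK _) (fun i => (hh _).comp (hcons1 y))
        (fun i z => hhK _ _) (fun i x w => by
          rw [Fin.cons_update]; exact hdep _ _ _)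
      linarith
    have key1' : ∫ y, ∫ z, g (Fin.cons y z) ^ 2 ∂ν ∂μ ≤ ∫ y, m y ^ 2 ∂μ +
        ∑ i : Fin n, ∫ y, ∫ z, (g (Fin.cons y z) - h i.succ (Fin.cons y z)) ^ 2 ∂ν ∂μ := by
      rw [← integral_finsetSum _ (fun i _ => int2 (md2 _) (hd2 _)),
        ← integral_add msq (integrable_finsetSum _ fun i _ => int2 (md2 _) (hd2 _))]
      exact integral_mono (int2 (hg.pow_const 2) hg2)
        (msq.add (integrable_finsetSum _ fun i _ => int2 (md2 _) (hd2 _))) key1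
    have key2 : ∫ y, m y ^ 2 ∂μ - (∫ y, m y ∂μ) ^ 2 ≤
        ∫ y, ∫ z, (g (Fin.cons y z) - h 0 (Fin.cons y z)) ^ 2 ∂ν ∂μ := by
      by_cases hE : Nonempty E
      swap
      · rw [not_nonempty_iff] at hE
        have : μ = 0 := Measure.eq_zero_of_isEmpty μ
        simp [this]
      obtain ⟨y₀⟩ := hE
      set H : ℝ := ∫ z, h 0 (Fin.cons y₀ z) ∂ν with hH
      have hdep0 : ∀ y z, h 0 (Fin.cons y z) = h 0 (Fin.cons y₀ z) := fun y z => by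
        rw [← hdep 0 (Fin.cons y₀ z : Fin (n + 1) → E) y, Fin.update_cons_zero]
      have step : ∀ y, (m y - H) ^ 2 ≤ ∫ z, (g (Fin.cons y z) - h 0 (Fin.cons y z)) ^ 2 ∂ν :=
          fun y => by
        have e : m y - H = ∫ z, (g (Fin.cons y z) - h 0 (Fin.cons y z)) ∂ν := by
          rw [integral_sub (int1 hg hgK y) (int1 (hh 0) (hhK 0) y)]
          simp only [hdep0 y]; rfl
        rw [e]
        set D : ℝ := ∫ z, (g (Fin.cons y z) - h 0 (Fin.cons y z)) ∂ν
        have i1 := int1 (hg.sub (hh 0)) (hdiffK 0) y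
        have i2 := int1 (md2 0) (hd2 0) y
        have : 0 ≤ ∫ z, ((g (Fin.cons y z) - h 0 (Fin.cons y z)) - D) ^ 2 ∂ν :=
          integral_nonneg fun z => sq_nonneg _
        have e2 := integral_sub_const_sq ν i1 i2 D
        simp only [Pi.sub_apply] at e2
        change _ = _ - 2 * D * D + _ at e2
        linarith
      have e3 := integral_sub_const_sq μ mint msq H
      have : ∫ y, (m y - H) ^ 2 ∂μ ≤
          ∫ y, ∫ z, (g (Fin.cons y z) - h 0 (Fin.cons y z)) ^ 2 ∂ν ∂μ := by
        refine integral_mono_of_nonneg (ae_of_all _ fun y => sq_nonneg _)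
          (int2 (md2 0) (hd2 0)) (ae_of_all _ step)
      nlinarith [sq_nonneg (H - ∫ y, m y ∂μ)]
    linarith

/-- Halving step for the exponential moment of a function with bounded total discrete gradient. -/
lemma integral_exp_le_sq {E : Type*} [MeasurableSpace E] (μ : Measure E) [IsProbabilityMeasure μ]
    {n : ℕ} {Z : (Fin n → E) → ℝ} {W : Fin n → (Fin n → E) → ℝ} {M : ℝ}
    (hZ : Measurable Z) (hW : ∀ i, Measurable (W i))
    (hdep : ∀ i x y, W i (Function.update x i y) = W i x)
    (h0 : ∀ x, 0 ≤ Z x) (h0W : ∀ i x, 0 ≤ W i x) (hle : ∀ i x, W i x ≤ Z x)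
    (hle1 : ∀ i x, Z x ≤ W i x + 1) (hZM : ∀ x, Z x ≤ M) (hsum : ∀ x, ∑ i, (Z x - W i x) ≤ M)
    {l : ℝ} (hl : |l| ≤ 1) (hlM : l ^ 2 * M ≤ 1 / 2) :
    ∫ x, Real.exp (l * Z x) ∂(Measure.pi fun _ => μ) ≤
      (∫ x, Real.exp (l / 2 * Z x) ∂(Measure.pi fun _ => μ)) ^ 2 * Real.exp (2 * (l ^ 2 * M)) := by
  set ν := Measure.pi fun _ : Fin n => μ with hν
  have bexp : ∀ a w : ℝ, |a| ≤ 1 → 0 ≤ w → w ≤ M → |Real.exp (a * w)| ≤ Real.exp M := by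
    intro a w ha hw hwM
    rw [abs_of_pos (Real.exp_pos _)]
    apply Real.exp_le_exp.2
    nlinarith [le_abs_self a]
  have hl2 : |l / 2| ≤ 1 := by rw [abs_div, abs_two]; linarith
  have hes := efron_stein μ (g := fun x => Real.exp (l / 2 * Z x))
    (h := fun i x => Real.exp (l / 2 * W i x)) (K := Real.exp M)
    (Real.measurable_exp.comp (hZ.const_mul _)) (fun x => bexp _ _ hl2 (h0 x) (hZM x))
    (fun i => Real.measurable_exp.comp ((hW i).const_mul _))
    (fun i x => bexp _ _ hl2 (h0W i x) ((hle i x).trans (hZM x)))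
    (fun i x y => by simp only [hdep])
  have hsq : ∀ x, Real.exp (l / 2 * Z x) ^ 2 = Real.exp (l * Z x) := fun x => by
    rw [← Real.exp_nat_mul]; congr 1; push_cast; ring
  simp only [hsq] at hes
  have hpt : ∀ i x, (Real.exp (l / 2 * Z x) - Real.exp (l / 2 * W i x)) ^ 2 ≤
      l ^ 2 * (Z x - W i x) * Real.exp (l * Z x) := by
    intro i x
    set D := Z x - W i x with hD
    have hD0 : 0 ≤ D := sub_nonneg.2 (hle i x)
    have hD1 : D ≤ 1 := by have := hle1 i x; linarith
    have e1 : Real.exp (l / 2 * Z x) - Real.exp (l / 2 * W i x) =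
        Real.exp (l / 2 * Z x) * (1 - Real.exp (-(l / 2 * D))) := by
      rw [mul_sub, ← Real.exp_add, mul_one]; congr 2; rw [hD]; ring
    have hu : |l / 2 * D| ≤ 1 := by
      rw [abs_mul, abs_of_nonneg hD0, abs_div, abs_two]; nlinarith [abs_nonneg l]
    have e2 : |1 - Real.exp (-(l / 2 * D))| ≤ 2 * |l / 2 * D| := by
      rw [abs_sub_comm]
      simpa using Real.abs_exp_sub_one_le (x := -(l / 2 * D)) (by simpa using hu)
    have e3 : (1 - Real.exp (-(l / 2 * D))) ^ 2 ≤ l ^ 2 * D := by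
      rw [← sq_abs]
      calc |1 - Real.exp (-(l / 2 * D))| ^ 2 ≤ (2 * |l / 2 * D|) ^ 2 :=
            pow_le_pow_left₀ (abs_nonneg _) e2 2
        _ = l ^ 2 * D ^ 2 := by rw [mul_pow, sq_abs]; ring
        _ ≤ l ^ 2 * D := by gcongr; nlinarith
    rw [e1, mul_pow, hsq, mul_comm]
    exact mul_le_mul_of_nonneg_right e3 (Real.exp_pos _).le
  have hintexp : Integrable (fun x => Real.exp (l * Z x)) ν :=
    Integrable.of_bound (Real.measurable_exp.comp (hZ.const_mul _)).aestronglyMeasurable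
      (Real.exp M) (ae_of_all _ fun x => bexp _ _ hl (h0 x) (hZM x))
  have hintdiff : ∀ i, Integrable
      (fun x => (Real.exp (l / 2 * Z x) - Real.exp (l / 2 * W i x)) ^ 2) ν := fun i => by
    refine Integrable.of_bound (((Real.measurable_exp.comp (hZ.const_mul _)).sub
      (Real.measurable_exp.comp ((hW i).const_mul _))).pow_const 2).aestronglyMeasurable
      ((2 * Real.exp M) ^ 2) (ae_of_all _ fun x => ?_)
    rw [Real.norm_eq_abs, abs_pow]
    refine pow_le_pow_left₀ (abs_nonneg _) ((abs_sub _ _).trans ?_) 2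
    linarith [bexp _ _ hl2 (h0 x) (hZM x), bexp _ _ hl2 (h0W i x) ((hle i x).trans (hZM x))]
  have hsumle : ∑ i, ∫ x, (Real.exp (l / 2 * Z x) - Real.exp (l / 2 * W i x)) ^ 2 ∂ν ≤
      l ^ 2 * M * ∫ x, Real.exp (l * Z x) ∂ν := by
    rw [← integral_finsetSum _ (fun i _ => hintdiff i), ← integral_const_mul]
    refine integral_mono (integrable_finsetSum _ fun i _ => hintdiff i) (hintexp.const_mul _) ?_
    intro x
    calc ∑ i, (Real.exp (l / 2 * Z x) - Real.exp (l / 2 * W i x)) ^ 2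
        ≤ ∑ i, l ^ 2 * (Z x - W i x) * Real.exp (l * Z x) := Finset.sum_le_sum fun i _ => hpt i x
      _ = l ^ 2 * (∑ i, (Z x - W i x)) * Real.exp (l * Z x) := by
          rw [Finset.mul_sum, Finset.sum_mul]
      _ ≤ l ^ 2 * M * Real.exp (l * Z x) := by gcongr; exact hsum x
  set A := ∫ x, Real.exp (l * Z x) ∂ν
  set B := ∫ x, Real.exp (l / 2 * Z x) ∂ν
  set u := l ^ 2 * M
  have hA0 : 0 ≤ A := integral_nonneg fun x => (Real.exp_pos _).le
  have h1 : A * (1 - u) ≤ B ^ 2 := by linarith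
  by_cases hu0 : 0 ≤ u
  · have h2 : 1 ≤ (1 - u) * Real.exp (2 * u) := by
      have := Real.add_one_le_exp (2 * u)
      nlinarith
    calc A ≤ A * ((1 - u) * Real.exp (2 * u)) := le_mul_of_one_le_right hA0 h2
      _ = A * (1 - u) * Real.exp (2 * u) := by ring
      _ ≤ _ := by gcongr
  · exfalso
    by_cases hne : Nonempty (Fin n → E)
    · obtain ⟨x⟩ := hne
      exact hu0 (mul_nonneg (sq_nonneg _) ((h0 x).trans (hZM x)))
    · rw [not_nonempty_iff] at hne
      have : ν = 0 := Measure.eq_zero_of_isEmpty ν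
      exact IsProbabilityMeasure.ne_zero ν this

/-- Sub-Gaussian bound on the exponential moment. -/
lemma integral_exp_le {E : Type*} [MeasurableSpace E] (μ : Measure E) [IsProbabilityMeasure μ]
    {n : ℕ} {Z : (Fin n → E) → ℝ} {W : Fin n → (Fin n → E) → ℝ} {M : ℝ} (hM : 1 ≤ M)
    (hZ : Measurable Z) (hW : ∀ i, Measurable (W i))
    (hdep : ∀ i x y, W i (Function.update x i y) = W i x)
    (h0 : ∀ x, 0 ≤ Z x) (h0W : ∀ i x, 0 ≤ W i x) (hle : ∀ i x, W i x ≤ Z x)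
    (hle1 : ∀ i x, Z x ≤ W i x + 1) (hZM : ∀ x, Z x ≤ M) (hsum : ∀ x, ∑ i, (Z x - W i x) ≤ M)
    {l : ℝ} (hl : |l| ≤ 1) (hlM : l ^ 2 * M ≤ 1 / 2) :
    ∫ x, Real.exp (l * Z x) ∂(Measure.pi fun _ => μ) ≤
      Real.exp (l * ∫ x, Z x ∂(Measure.pi fun _ => μ) + 5 * (l ^ 2 * M)) := by
  set ν := Measure.pi fun _ : Fin n => μ with hν
  have hiter : ∀ J : ℕ, ∫ x, Real.exp (l * Z x) ∂ν ≤
      (∫ x, Real.exp (l / 2 ^ J * Z x) ∂ν) ^ (2 ^ J) *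
        Real.exp (4 * (l ^ 2 * M) * (1 - (2 ^ J)⁻¹)) := by
    intro J
    induction J with
    | zero => simp
    | succ J ih =>
      have h2J : (1 : ℝ) ≤ 2 ^ J := one_le_pow₀ (by norm_num)
      have hl' : |l / 2 ^ J| ≤ 1 := by
        rw [abs_div, abs_of_pos (by positivity : (0 : ℝ) < 2 ^ J)]
        exact (div_le_self (abs_nonneg _) h2J).trans hl
      have hl2' : (l / 2 ^ J) ^ 2 * M ≤ 1 / 2 := by
        refine le_trans ?_ hlM
        rw [div_pow]
        refine mul_le_mul_of_nonneg_right ?_ (by linarith)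
        exact div_le_self (sq_nonneg _) (one_le_pow₀ h2J)
      have hs := integral_exp_le_sq μ hZ hW hdep h0 h0W hle hle1 hZM hsum hl' hl2'
      rw [← hν, div_div, ← pow_succ] at hs
      refine ih.trans ?_
      calc _ ≤ ((∫ x, Real.exp (l / 2 ^ (J + 1) * Z x) ∂ν) ^ 2 *
            Real.exp (2 * ((l / 2 ^ J) ^ 2 * M))) ^ (2 ^ J) *
            Real.exp (4 * (l ^ 2 * M) * (1 - (2 ^ J)⁻¹)) := by
            gcongr
        _ = _ := by
            rw [mul_pow, ← pow_mul, ← Real.exp_nat_mul, mul_assoc, ← Real.exp_add, ← pow_succ']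
            congr 2
            push_cast
            rw [pow_succ]
            field_simp
            ring
  obtain ⟨J, hJ⟩ : ∃ J : ℕ, M ≤ 2 ^ J := pow_unbounded_of_one_lt M (by norm_num) |>.imp
    fun _ h => h.le
  have h2J : (0 : ℝ) < 2 ^ J := by positivity
  set e := l / 2 ^ J with he
  have heM : ∀ x, |e * Z x| ≤ 1 := fun x => by
    rw [abs_mul, abs_of_nonneg (h0 x), he, abs_div, abs_of_pos h2J, div_mul_eq_mul_div,
      div_le_one h2J]
    nlinarith [hZM x, h0 x, abs_nonneg l]
  have hZint : Integrable Z ν := Integrable.of_bound hZ.aestronglyMeasurable M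
    (ae_of_all _ fun x => by rw [Real.norm_eq_abs, abs_of_nonneg (h0 x)]; exact hZM x)
  have hsmall : ∫ x, Real.exp (e * Z x) ∂ν ≤ Real.exp (e * ∫ x, Z x ∂ν + e ^ 2 * M ^ 2) := by
    calc ∫ x, Real.exp (e * Z x) ∂ν ≤ ∫ x, (1 + e * Z x + e ^ 2 * M ^ 2) ∂ν := by
          refine integral_mono_of_nonneg (ae_of_all _ fun x => (Real.exp_pos _).le) ?_
            (ae_of_all _ fun x => ?_)
          · exact ((integrable_const _).add (hZint.const_mul _)).add (integrable_const _)
          · have := (abs_le.1 (Real.abs_exp_sub_one_sub_id_le (heM x))).2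
            have h3 : (e * Z x) ^ 2 ≤ e ^ 2 * M ^ 2 := by
              rw [mul_pow]; gcongr
              · exact h0 x
              · exact hZM x
            simp only; linarith
      _ = e * ∫ x, Z x ∂ν + e ^ 2 * M ^ 2 + 1 := by
          have h4 : Integrable (fun x => 1 + e * Z x) ν :=
            (integrable_const _).add (hZint.const_mul _)
          rw [integral_add h4 (integrable_const _),
            integral_add (integrable_const _) (hZint.const_mul _), integral_const_mul]
          simp; ring
      _ ≤ _ := Real.add_one_le_exp _
  calc _ ≤ _ := hiter J
    _ ≤ (Real.exp (e * ∫ x, Z x ∂ν + e ^ 2 * M ^ 2)) ^ (2 ^ J) *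
        Real.exp (4 * (l ^ 2 * M) * (1 - (2 ^ J)⁻¹)) := by
      gcongr
    _ ≤ _ := by
      rw [← Real.exp_nat_mul, ← Real.exp_add]
      apply Real.exp_le_exp.2
      have h5 : (2 : ℝ) ^ J * (e * ∫ x, Z x ∂ν) = l * ∫ x, Z x ∂ν := by rw [he]; field_simp
      have h6 : (2 : ℝ) ^ J * (e ^ 2 * M ^ 2) ≤ l ^ 2 * M := by
        have : (2 : ℝ) ^ J * (e ^ 2 * M ^ 2) = (l ^ 2 * M) * (M / 2 ^ J) := by
          rw [he]; field_simp
        rw [this]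
        exact mul_le_of_le_one_right (by positivity) ((div_le_one h2J).2 hJ)
      have h7 : 0 ≤ l ^ 2 * M * (2 ^ J)⁻¹ := by positivity
      push_cast
      rw [mul_add]
      nlinarith

/-- Exponential concentration around the mean. -/
lemma concentration {E : Type*} [MeasurableSpace E] (μ : Measure E) [IsProbabilityMeasure μ]
    {n : ℕ} {Z : (Fin n → E) → ℝ} {W : Fin n → (Fin n → E) → ℝ} {M : ℝ} (hM : 1 ≤ M)
    (hZ : Measurable Z) (hW : ∀ i, Measurable (W i))
    (hdep : ∀ i x y, W i (Function.update x i y) = W i x)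
    (h0 : ∀ x, 0 ≤ Z x) (h0W : ∀ i x, 0 ≤ W i x) (hle : ∀ i x, W i x ≤ Z x)
    (hle1 : ∀ i x, Z x ≤ W i x + 1) (hZM : ∀ x, Z x ≤ M) (hsum : ∀ x, ∑ i, (Z x - W i x) ≤ M)
    (t : ℝ) :
    (Measure.pi fun _ => μ).real {x | ∫ x, Z x ∂(Measure.pi fun _ => μ) + t ≤ Z x} ≤
      4 * Real.exp (-(t / (2 * √M))) ∧
    (Measure.pi fun _ => μ).real {x | Z x ≤ ∫ x, Z x ∂(Measure.pi fun _ => μ) - t} ≤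
      4 * Real.exp (-(t / (2 * √M))) := by
  set ν := Measure.pi fun _ : Fin n => μ with hν
  have hsM : 1 ≤ √M := Real.one_le_sqrt.2 hM
  have hsq : √M ^ 2 = M := Real.sq_sqrt (by linarith)
  set l := 1 / (2 * √M) with hl
  have hl0 : 0 < l := by positivity
  have hl1 : |l| ≤ 1 := by
    rw [abs_of_pos hl0, hl, div_le_one (by positivity)]; linarith
  have hlM : l ^ 2 * M = 1 / 4 := by
    rw [hl, div_pow, mul_pow, hsq]; field_simp; norm_num
  have e4 : Real.exp (5 / 4) ≤ 4 := by
    have h1 : Real.exp (5 / 4) ^ 4 ≤ 4 ^ 4 := by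
      rw [← Real.exp_nat_mul]
      have : Real.exp 1 ^ 5 ≤ 256 := by
        calc Real.exp 1 ^ 5 ≤ 2.7182818286 ^ 5 := by gcongr; exact Real.exp_one_lt_d9.le
          _ ≤ 256 := by norm_num
      rw [← Real.exp_nat_mul] at this
      norm_num at this ⊢
      exact this
    exact le_of_pow_le_pow_left₀ (by norm_num) (by norm_num) h1
  have hgInt : ∀ a : ℝ, |a| ≤ 1 → Integrable (fun x => Real.exp (a * Z x)) ν := fun a ha => by
    refine Integrable.of_bound (Real.measurable_exp.comp (hZ.const_mul _)).aestronglyMeasurable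
      (Real.exp M) (ae_of_all _ fun x => ?_)
    rw [Real.norm_eq_abs, abs_of_pos (Real.exp_pos _)]
    apply Real.exp_le_exp.2
    nlinarith [le_abs_self a, h0 x, hZM x]
  have fin : ∀ a b : ℝ, a = -(l * t) + 5 * (1 / 4) → b ≤ Real.exp a →
      b ≤ 4 * Real.exp (-(t / (2 * √M))) := fun a b ha hb => by
    refine hb.trans ?_
    have : a = 5 / 4 + -(t / (2 * √M)) := by rw [ha, hl]; ring
    rw [this, Real.exp_add]
    gcongr
  constructor
  · refine fin _ _ ?_ ((ProbabilityTheory.measure_ge_le_exp_mul_mgf _ hl0.le (hgInt l hl1)).trans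
      ((mul_le_mul_of_nonneg_left (integral_exp_le μ hM hZ hW hdep h0 h0W hle hle1 hZM hsum
        hl1 (by rw [hlM]; norm_num)) (Real.exp_pos _).le).trans_eq (Real.exp_add _ _).symm))
    rw [hlM]; ring
  · have hl1' : |-l| ≤ 1 := by rwa [abs_neg]
    refine fin _ _ ?_ ((ProbabilityTheory.measure_le_le_exp_mul_mgf _ (neg_nonpos.2 hl0.le)
      (hgInt (-l) hl1')).trans
      ((mul_le_mul_of_nonneg_left (integral_exp_le μ hM hZ hW hdep h0 h0W hle hle1 hZM hsum
        hl1' (by rw [neg_sq, hlM]; norm_num)) (Real.exp_pos _).le).trans_eq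
          (Real.exp_add _ _).symm))
    rw [neg_sq, hlM]; ring

lemma chainLength_bddAbove {d : ℕ} {A : Set (Fin d → ℝ)} (hA : A.Finite) :
    BddAbove {n : ℕ | ∃ C : Finset (Fin d → ℝ),
      ↑C ⊆ A ∧ IsChain (· ≤ ·) (C : Set (Fin d → ℝ)) ∧ C.card = n} := by
  refine ⟨A.ncard, ?_⟩
  rintro n ⟨C, hCA, -, rfl⟩
  rw [← Set.ncard_coe_finset]
  exact Set.ncard_le_ncard hCA hA

lemma card_le_chainLength {d : ℕ} {A : Set (Fin d → ℝ)} (hA : A.Finite) {C : Finset (Fin d → ℝ)}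
    (hCA : ↑C ⊆ A) (hC : IsChain (· ≤ ·) (C : Set (Fin d → ℝ))) : C.card ≤ chainLength d A :=
  le_csSup (chainLength_bddAbove hA) ⟨C, hCA, hC, rfl⟩

lemma exists_card_eq_chainLength {d : ℕ} {A : Set (Fin d → ℝ)} (hA : A.Finite) :
    ∃ C : Finset (Fin d → ℝ), ↑C ⊆ A ∧ IsChain (· ≤ ·) (C : Set (Fin d → ℝ)) ∧
      C.card = chainLength d A := by
  have hne : {n : ℕ | ∃ C : Finset (Fin d → ℝ),
      ↑C ⊆ A ∧ IsChain (· ≤ ·) (C : Set (Fin d → ℝ)) ∧ C.card = n}.Nonempty :=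
    ⟨0, ∅, by simp, by simp, rfl⟩
  exact Nat.sSup_mem hne (chainLength_bddAbove hA)

lemma chainLength_mono {d : ℕ} {A B : Set (Fin d → ℝ)} (hB : B.Finite) (hAB : A ⊆ B) :
    chainLength d A ≤ chainLength d B := by
  obtain ⟨C, hC, hch, hcard⟩ := exists_card_eq_chainLength (hB.subset hAB)
  rw [← hcard]
  exact card_le_chainLength hB (hC.trans hAB) hch

/-- Long chains in a finite family of points, expressed through indices. -/
lemma le_chainLength_image_iff {d : ℕ} {ι : Type*} [Finite ι] {X : ι → Fin d → ℝ} {S : Set ι}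
    {t : ℕ} : t ≤ chainLength d (X '' S) ↔ ∃ I : Finset ι, ↑I ⊆ S ∧ I.card = t ∧
      ∀ i ∈ I, ∀ j ∈ I, i ≠ j → X i ≠ X j ∧ (X i ≤ X j ∨ X j ≤ X i) := by
  classical
  have hfin : (X '' S).Finite := Set.toFinite _
  constructor
  · intro h
    obtain ⟨C, hC, hch, hcard⟩ := exists_card_eq_chainLength hfin
    obtain ⟨D, hDC, hD⟩ := Finset.exists_subset_card_eq (h.trans hcard.ge)
    have hex : ∀ p : D, ∃ i ∈ S, X i = p := fun p => hC (hDC p.2)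
    choose r hrS hr using hex
    have hinj : Function.Injective r := fun p q hpq => by
      apply Subtype.ext; rw [← hr p, hpq, hr q]
    refine ⟨Finset.univ.image r, ?_, ?_, ?_⟩
    · intro i hi
      simp only [Finset.coe_image, Finset.coe_univ, image_univ, mem_range] at hi
      obtain ⟨p, rfl⟩ := hi
      exact hrS p
    · rw [Finset.card_image_of_injective _ hinj, Finset.card_univ, Fintype.card_coe, hD]
    · simp only [Finset.mem_image]
      rintro _ ⟨p, hp, rfl⟩ _ ⟨q, hq, rfl⟩ hne
      have hpq : (p : Fin d → ℝ) ≠ q := fun h => hne (by rw [Subtype.ext h])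
      rw [hr p, hr q]
      exact ⟨hpq, hch (hDC p.2) (hDC q.2) hpq⟩
  · rintro ⟨I, hIS, rfl, hI⟩
    have hinj : Set.InjOn X I := fun i hi j hj hij => by
      by_contra hne
      exact (hI i hi j hj hne).1 hij
    rw [← Finset.card_image_of_injOn hinj]
    refine card_le_chainLength hfin ?_ ?_
    · rw [Finset.coe_image]; exact Set.image_mono hIS
    · rw [Finset.coe_image]
      rintro _ ⟨i, hi, rfl⟩ _ ⟨j, hj, rfl⟩ hne
      exact (hI i hi j hj (fun h => hne (by rw [h]))).2

lemma measurable_chainLength_image {d N : ℕ} (S : Set (Fin N)) :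
    Measurable fun X : Fin N → Fin d → ℝ => chainLength d (X '' S) := by
  refine measurable_of_Ici fun t => ?_
  have : (fun X : Fin N → Fin d → ℝ => chainLength d (X '' S)) ⁻¹' Ici t =
      ⋃ I : Finset (Fin N), {X | ↑I ⊆ S ∧ I.card = t ∧
        ∀ i ∈ I, ∀ j ∈ I, i ≠ j → X i ≠ X j ∧ (X i ≤ X j ∨ X j ≤ X i)} := by
    ext X
    simp only [mem_preimage, mem_Ici, le_chainLength_image_iff, mem_iUnion, mem_ofPred_eq]
  rw [this]
  refine MeasurableSet.iUnion fun I => ?_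
  have hm : ∀ i, Measurable fun X : Fin N → Fin d → ℝ => X i := fun i => measurable_pi_apply i
  suffices hI : MeasurableSet {X : Fin N → Fin d → ℝ | ∀ i ∈ I, ∀ j ∈ I, i ≠ j →
      X i ≠ X j ∧ (X i ≤ X j ∨ X j ≤ X i)} from
    (MeasurableSet.const _).inter ((MeasurableSet.const _).inter hI)
  simp only [ofPred_forall]
  refine MeasurableSet.iInter fun i => MeasurableSet.iInter fun _ => MeasurableSet.iInter fun j =>
    MeasurableSet.iInter fun _ => MeasurableSet.iInter fun _ => ?_
  exact (measurableSet_eq_fun (hm i) (hm j)).compl.inter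
    ((measurableSet_le (hm i) (hm j)).union (measurableSet_le (hm j) (hm i)))

lemma measurable_chainLength_range {d N : ℕ} :
    Measurable fun X : Fin N → Fin d → ℝ => chainLength d (range X) := by
  simpa only [image_univ] using measurable_chainLength_image (d := d) (N := N) univ

lemma chainLength_range_le {d N : ℕ} (X : Fin N → Fin d → ℝ) : chainLength d (range X) ≤ N := by
  rw [← image_univ]
  obtain ⟨I, -, hI, -⟩ := le_chainLength_image_iff.1 (le_refl (chainLength d (X '' univ)))
  rw [← hI]
  simpa using I.card_le_univ

lemma chainLength_image_ne_le {d N : ℕ} (X : Fin N → Fin d → ℝ) (i : Fin N) :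
    chainLength d (X '' {j | j ≠ i}) ≤ chainLength d (range X) :=
  chainLength_mono (Set.toFinite _) (image_subset_range _ _)

lemma chainLength_range_le_add_one {d N : ℕ} (X : Fin N → Fin d → ℝ) (i : Fin N) :
    chainLength d (range X) ≤ chainLength d (X '' {j | j ≠ i}) + 1 := by
  rw [← image_univ]
  obtain ⟨I, -, hI, hI'⟩ := le_chainLength_image_iff.1 (le_refl (chainLength d (X '' univ)))
  rw [← hI]
  have : (I.erase i).card ≤ chainLength d (X '' {j | j ≠ i}) :=
    le_chainLength_image_iff.2 ⟨I.erase i, fun j hj => (Finset.mem_erase.1 hj).1, rfl,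
      fun a ha b hb => hI' a (Finset.mem_of_mem_erase ha) b (Finset.mem_of_mem_erase hb)⟩
  have := Finset.pred_card_le_card_erase (s := I) (a := i)
  omega

/-- At most `ℓ` points are essential for the length `ℓ` of a longest chain. -/
lemma card_essential_le {d N : ℕ} (X : Fin N → Fin d → ℝ) :
    (Finset.univ.filter fun i => chainLength d (X '' {j | j ≠ i}) < chainLength d (range X)).card
      ≤ chainLength d (range X) := by
  obtain ⟨I, -, hI, hI'⟩ := le_chainLength_image_iff.1 (le_refl (chainLength d (X '' univ)))
  rw [image_univ] at hI
  rw [← hI]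
  refine Finset.card_le_card fun i hi => ?_
  by_contra hiI
  rw [Finset.mem_filter] at hi
  refine absurd (le_chainLength_image_iff.2 ⟨I, fun j hj => ?_, rfl, hI'⟩) (not_le.2 hi.2)
  rintro rfl
  exact hiI hj

instance isProbabilityMeasure_cube {d : ℕ} :
    IsProbabilityMeasure (volume.restrict (Icc (0 : Fin d → ℝ) 1)) := by
  constructor
  simp [Real.volume_Icc_pi]

/-- Concentration of the truncated longest chain length of `N` uniform points. -/
lemma concentration_min_chainLength {d N m : ℕ} (hm : 1 ≤ m) (t : ℝ) :
    let ν := (Measure.pi fun _ : Fin N => volume.restrict (Icc (0 : Fin d → ℝ) 1))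
    let Z : (Fin N → Fin d → ℝ) → ℝ := fun X => ((min (chainLength d (range X)) m : ℕ) : ℝ)
    ν.real {X | ∫ X, Z X ∂ν + t ≤ Z X} ≤ 4 * Real.exp (-(t / (2 * √m))) ∧
    ν.real {X | Z X ≤ ∫ X, Z X ∂ν - t} ≤ 4 * Real.exp (-(t / (2 * √m))) := by
  intro ν Z
  refine concentration (volume.restrict (Icc (0 : Fin d → ℝ) 1)) (Z := Z)
    (W := fun i X => ((min (chainLength d (X '' {j | j ≠ i})) m : ℕ) : ℝ)) (M := m)
    (by exact_mod_cast hm) ?_ ?_ ?_ ?_ ?_ ?_ ?_ ?_ ?_ t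
  · exact measurable_from_top.comp (measurable_chainLength_range.min measurable_const)
  · exact fun i => measurable_from_top.comp
      ((measurable_chainLength_image _).min measurable_const)
  · intro i X y
    have : Function.update X i y '' {j | j ≠ i} = X '' {j | j ≠ i} :=
      image_congr fun j hj => Function.update_of_ne hj _ _
    simp only [this]
  · intro X; positivity
  · intro i X; positivity
  · intro i X
    exact Nat.cast_le.2 (min_le_min_right m (chainLength_image_ne_le X i))
  · intro i X
    have := chainLength_range_le_add_one X i
    have h : min (chainLength d (range X)) m ≤ min (chainLength d (X '' {j | j ≠ i})) m + 1 := by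
      omega
    exact (Nat.cast_le.2 h).trans_eq (by push_cast; rfl)
  · intro X
    exact Nat.cast_le.2 (min_le_right _ _)
  · intro X
    calc ∑ i, (Z X - ((min (chainLength d (X '' {j | j ≠ i})) m : ℕ) : ℝ))
        ≤ ∑ i, (if chainLength d (X '' {j | j ≠ i}) < chainLength d (range X) ∧
            chainLength d (range X) ≤ m then (1 : ℝ) else 0) := by
          refine Finset.sum_le_sum fun i _ => ?_
          have h1 := chainLength_range_le_add_one X i
          have h2 := chainLength_image_ne_le X i
          rw [sub_le_iff_le_add]
          split_ifs with h
          · have h3 : min (chainLength d (range X)) m ≤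
                1 + min (chainLength d (X '' {j | j ≠ i})) m := by omega
            exact (Nat.cast_le.2 h3).trans_eq (by push_cast; rfl)
          · rw [zero_add]
            have h3 : min (chainLength d (range X)) m ≤
                min (chainLength d (X '' {j | j ≠ i})) m := by omega
            exact Nat.cast_le.2 h3
      _ ≤ m := by
          rw [Finset.sum_boole]
          norm_cast
          by_cases hZ : chainLength d (range X) ≤ m
          · simp only [hZ, and_true]
            exact (card_essential_le X).trans hZ
          · simp [hZ]

/-- Quantitative law of large numbers for the longest chain among `N` uniform points. -/
lemma chainLength_range_tail {d : ℕ} (hd : 0 < d) {c : ℝ} (hc : IsBWConstant d c) {δ : ℝ}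
    (hδ : 0 < δ) : ∃ C : ℝ, 0 ≤ C ∧ ∀ N : ℕ, 1 ≤ N →
    (Measure.pi fun _ : Fin N => volume.restrict (Icc (0 : Fin d → ℝ) 1)).real
      {X | (c + δ) * (N : ℝ) ^ ((1 : ℝ) / d) ≤ chainLength d (range X)} ≤ C / (N : ℝ) ^ 2 ∧
    (Measure.pi fun _ : Fin N => volume.restrict (Icc (0 : Fin d → ℝ) 1)).real
      {X | (chainLength d (range X) : ℝ) ≤ (c - δ) * (N : ℝ) ^ ((1 : ℝ) / d)} ≤ C / (N : ℝ) ^ 2 := by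
  obtain ⟨hc0, hlim⟩ := hc
  obtain ⟨η, hη, rfl⟩ : ∃ η, 0 < η ∧ δ = 3 * η := ⟨δ / 3, by positivity, by ring⟩
  set A := c + 3 * η + 1 with hA
  have hA0 : 0 < A := by positivity
  set κ := η / (2 * √A) with hκ
  have hκ0 : 0 < κ := by positivity
  set C₀ : ℝ := 4 * ((4 * d).factorial / κ ^ (4 * d)) with hC₀
  have hC₀0 : 0 < C₀ := by positivity
  have hmean : ∀ᶠ N : ℕ in atTop, (c - η) * (N : ℝ) ^ ((1 : ℝ) / d) ≤ BWexpect d N ∧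
      BWexpect d N ≤ (c + η) * (N : ℝ) ^ ((1 : ℝ) / d) := by
    have h1 := hlim.eventually (Icc_mem_nhds (show c - η < c by linarith)
      (show c < c + η by linarith))
    filter_upwards [h1, eventually_ge_atTop 1] with N hN hN1
    have hNpos : (0 : ℝ) < N := by exact_mod_cast hN1
    have hs : (0 : ℝ) < (N : ℝ) ^ ((1 : ℝ) / d) := Real.rpow_pos_of_pos hNpos _
    rw [neg_div, Real.rpow_neg hNpos.le, inv_mul_eq_div, le_div_iff₀ hs,
      div_le_iff₀ hs] at hN
    exact hN
  have hbig : ∀ᶠ N : ℕ in atTop, C₀ / η ≤ (N : ℝ) :=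
    tendsto_natCast_atTop_atTop.eventually_ge_atTop _
  obtain ⟨N₀, hN₀⟩ := eventually_atTop.1 (hmean.and hbig)
  refine ⟨max C₀ ((N₀ : ℝ) ^ 2), by positivity, fun N hN => ?_⟩
  have hNpos : (0 : ℝ) < N := by exact_mod_cast hN
  set ν := (Measure.pi fun _ : Fin N => volume.restrict (Icc (0 : Fin d → ℝ) 1)) with hν
  by_cases hNN : N < N₀
  · have : ∀ S : Set (Fin N → Fin d → ℝ), ν.real S ≤ max C₀ ((N₀ : ℝ) ^ 2) / (N : ℝ) ^ 2 := by
      intro S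
      refine measureReal_le_one.trans ?_
      rw [one_le_div (by positivity)]
      refine le_trans ?_ (le_max_right _ _)
      gcongr
    exact ⟨this _, this _⟩
  obtain ⟨⟨hlo, hhi⟩, hNC⟩ := hN₀ N (not_lt.1 hNN)
  set s : ℝ := (N : ℝ) ^ ((1 : ℝ) / d) with hs
  have hs1 : 1 ≤ s := Real.one_le_rpow (by exact_mod_cast hN) (by positivity)
  have hsd : s ^ d = N := by
    rw [hs, ← Real.rpow_natCast, ← Real.rpow_mul hNpos.le, one_div, inv_mul_cancel₀
      (by exact_mod_cast hd.ne'), Real.rpow_one]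
  set m := ⌈(c + 3 * η) * s⌉₊ with hm
  have hm1 : (c + 3 * η) * s ≤ m := Nat.le_ceil _
  have hm2 : (m : ℝ) ≤ A * s := by
    have := (Nat.ceil_lt_add_one (show 0 ≤ (c + 3 * η) * s by positivity)).le
    rw [← hm] at this
    rw [hA]; nlinarith
  have hm0 : 1 ≤ m := Nat.ceil_pos.2 (by positivity)
  have hexp : 4 * Real.exp (-(η * s / (2 * √m))) ≤ C₀ / (N : ℝ) ^ 2 := by
    have h1 : κ * √s ≤ η * s / (2 * √m) := by
      have h2 : √(m : ℝ) ≤ √A * √s := by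
        rw [← Real.sqrt_mul hA0.le]; exact Real.sqrt_le_sqrt hm2
      have hm0' : (0 : ℝ) < √m := Real.sqrt_pos.2 (by exact_mod_cast hm0)
      rw [le_div_iff₀ (by positivity), hκ]
      have h3 : √s * √s = s := Real.mul_self_sqrt (by linarith)
      calc η / (2 * √A) * √s * (2 * √m) ≤ η / (2 * √A) * √s * (2 * (√A * √s)) := by gcongr
        _ = η * (√s * √s) := by field_simp
        _ = η * s := by rw [h3]
    have h2 := Real.pow_div_factorial_le_exp (κ * √s) (by positivity) (4 * d)
    have h3 : (κ * √s) ^ (4 * d) = κ ^ (4 * d) * (N : ℝ) ^ 2 := by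
      rw [mul_pow, ← hsd, ← pow_mul, show 4 * d = 2 * (d * 2) by ring, pow_mul (√s),
        Real.sq_sqrt (by linarith)]
    rw [h3] at h2
    have h4 : Real.exp (-(η * s / (2 * √m))) ≤ (Real.exp (κ * √s))⁻¹ := by
      rw [← Real.exp_neg]; exact Real.exp_le_exp.2 (neg_le_neg h1)
    have h5 := h4.trans (inv_anti₀ (by positivity) h2)
    calc _ ≤ 4 * (κ ^ (4 * d) * (N : ℝ) ^ 2 / (4 * d).factorial)⁻¹ := by gcongr
      _ = _ := by rw [hC₀]; field_simp
  have hC : C₀ / (N : ℝ) ^ 2 ≤ max C₀ ((N₀ : ℝ) ^ 2) / (N : ℝ) ^ 2 := by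
    gcongr; exact le_max_left _ _
  obtain ⟨hup, hdown⟩ := concentration_min_chainLength (d := d) (N := N) hm0 (η * s)
  simp only [← hν] at hup hdown
  set Z : (Fin N → Fin d → ℝ) → ℝ := fun X => ((min (chainLength d (range X)) m : ℕ) : ℝ) with hZ
  set L : (Fin N → Fin d → ℝ) → ℝ := fun X => (chainLength d (range X) : ℝ) with hL
  have hLm : Measurable L := measurable_from_top.comp measurable_chainLength_range
  have hZm : Measurable Z :=
    measurable_from_top.comp (measurable_chainLength_range.min measurable_const)
  have hL0 : ∀ X, 0 ≤ L X := fun X => Nat.cast_nonneg _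
  have hLN : ∀ X, L X ≤ N := fun X => Nat.cast_le.2 (chainLength_range_le X)
  have hZL : ∀ X, Z X ≤ L X := fun X => by exact Nat.cast_le.2 (min_le_left _ _)
  have hLint : Integrable L ν := Integrable.of_bound hLm.aestronglyMeasurable N
    (ae_of_all _ fun X => by rw [Real.norm_eq_abs, abs_of_nonneg (hL0 X)]; exact hLN X)
  have hZint : Integrable Z ν := Integrable.of_bound hZm.aestronglyMeasurable N
    (ae_of_all _ fun X => by
      rw [Real.norm_eq_abs, abs_of_nonneg (Nat.cast_nonneg _)]; exact (hZL X).trans (hLN X))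
  have hEL : BWexpect d N = ∫ X, L X ∂ν := rfl
  have hEZ : ∫ X, Z X ∂ν ≤ ∫ X, L X ∂ν := integral_mono hZint hLint hZL
  have hup' : ν.real {X | (c + 2 * η) * s ≤ L X} ≤ C₀ / (N : ℝ) ^ 2 := by
    refine (measureReal_mono ?_).trans (hup.trans hexp)
    intro X hX
    simp only [mem_ofPred_eq] at hX ⊢
    have h1 : (c + 2 * η) * s ≤ Z X := by
      simp only [Z, Nat.cast_min]
      refine le_min hX (le_trans ?_ hm1)
      gcongr; linarith
    linarith
  refine ⟨?_, ?_⟩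
  · refine ((measureReal_mono ?_).trans hup').trans hC
    intro X hX
    have hX' : (c + 3 * η) * s ≤ L X := hX
    refine le_trans ?_ hX'
    gcongr; linarith
  · refine (measureReal_mono ?_).trans (hdown.trans (hexp.trans hC))
    have hgap : ∫ X, L X ∂ν - ∫ X, Z X ∂ν ≤ η * s := by
      set S := {X | (c + 2 * η) * s ≤ L X} with hS
      have hSm : MeasurableSet S := measurableSet_le measurable_const hLm
      have h1 : ∫ X, L X ∂ν - ∫ X, Z X ∂ν ≤ N * ν.real S := by
        rw [← integral_sub hLint hZint]
        calc ∫ X, (L X - Z X) ∂ν ≤ ∫ X, S.indicator (fun _ => (N : ℝ)) X ∂ν := by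
              refine integral_mono (hLint.sub hZint) ((integrable_const _).indicator hSm) ?_
              intro X
              by_cases hX : X ∈ S
              · simp only [indicator_of_mem hX]
                have : 0 ≤ Z X := Nat.cast_nonneg _
                linarith [hLN X]
              · simp only [indicator_of_notMem hX]
                have h2 : L X < (c + 2 * η) * s := not_le.1 hX
                have h3 : (chainLength d (range X) : ℝ) ≤ m := by
                  refine h2.le.trans (le_trans ?_ hm1)
                  gcongr; linarith
                have h4 : chainLength d (range X) ≤ m := by exact_mod_cast h3
                simp [Z, L, h4]
          _ = N * ν.real S := by
              rw [integral_indicator_const _ hSm, smul_eq_mul, mul_comm]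
      have h2 : N * ν.real S ≤ N * (C₀ / (N : ℝ) ^ 2) := by gcongr
      have h3 : N * (C₀ / (N : ℝ) ^ 2) = C₀ / N := by field_simp
      have h4 : C₀ / N ≤ η := by
        rw [div_le_iff₀ hη] at hNC
        rw [div_le_iff₀ hNpos]; linarith
      nlinarith
    intro X hX
    simp only [mem_ofPred_eq] at hX ⊢
    have := hZL X
    rw [hEL] at hlo
    change L X ≤ _ at hX
    linarith

open ProbabilityTheory in
/-- Products of Poisson laws are stochastically increasing in the rates. -/
lemma poissonPi_mono {G : Type*} [Fintype G] {μ μ' : G → NNReal} (h : μ ≤ μ')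
    {A : Set (G → ℕ)} (hA : IsUpperSet A) :
    Measure.pi (fun q => poissonMeasure (μ q)) A ≤ Measure.pi (fun q => poissonMeasure (μ' q)) A := by
  set κ : G → Measure (ℕ × ℕ) :=
    fun q => (poissonMeasure (μ q)).prod (poissonMeasure (μ' q - μ q)) with hκ
  have h1 : (fun q => poissonMeasure (μ q)) = fun q => (κ q).map Prod.fst := by
    funext q
    rw [hκ, ← Measure.fst, Measure.fst_prod]
  have h2 : (fun q => poissonMeasure (μ' q)) = fun q => (κ q).map fun p => p.1 + p.2 := by
    funext q
    conv_lhs => rw [← add_tsub_cancel_of_le (h q), ← poissonMeasure_conv_poissonMeasure]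
    rfl
  have : ∀ q, IsProbabilityMeasure (κ q) := fun q => by rw [hκ]; infer_instance
  have i1 : ∀ q, IsProbabilityMeasure ((κ q).map Prod.fst) := fun q =>
    Measure.isProbabilityMeasure_map (by fun_prop)
  have i2 : ∀ q, IsProbabilityMeasure ((κ q).map fun p => p.1 + p.2) := fun q =>
    Measure.isProbabilityMeasure_map (by fun_prop)
  have e1 : (Measure.pi κ).map (fun p q => (p q).1) = Measure.pi fun q => (κ q).map Prod.fst :=
    Measure.pi_map_pi (hμ := fun q => by exact inferInstance) (fun q => measurable_fst.aemeasurable)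
  have e2 : (Measure.pi κ).map (fun p q => (p q).1 + (p q).2) =
      Measure.pi fun q => (κ q).map fun p => p.1 + p.2 :=
    Measure.pi_map_pi (hμ := fun q => by exact inferInstance)
      (f := fun _ (p : ℕ × ℕ) => p.1 + p.2) (fun q => Measurable.of_discrete.aemeasurable)
  rw [h1, h2, ← e1, ← e2,
    Measure.map_apply (by fun_prop) (MeasurableSet.of_discrete),
    Measure.map_apply (by fun_prop) (MeasurableSet.of_discrete)]
  exact measure_mono fun p hp => hA (fun q => Nat.le_add_right _ _) hp

/-- The number of occurrences of each letter in a word. -/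
def letterCount {G : Type*} [DecidableEq G] {N : ℕ} (w : Fin N → G) (q : G) : ℕ :=
  (Finset.univ.filter fun i => w i = q).card

lemma letterCount_cons {G : Type*} [DecidableEq G] {N : ℕ} (a : G) (w : Fin N → G) :
    letterCount (Fin.cons a w : Fin (N + 1) → G) = letterCount w + Pi.single a 1 := by
  ext q
  simp only [letterCount, Pi.add_apply, Finset.card_filter, Fin.sum_univ_succ, Fin.cons_zero,
    Fin.cons_succ, Pi.single_apply, eq_comm (a := a)]
  ring

/-- The number of words with prescribed letter counts is a multinomial coefficient. -/
lemma prod_factorial_mul_card_words {G : Type*} [Fintype G] [DecidableEq G] {N : ℕ} {n : G → ℕ}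
    (hn : ∑ q, n q = N) :
    (∏ q, (n q).factorial) * (Finset.univ.filter fun w : Fin N → G => letterCount w = n).card
      = N.factorial := by
  induction N generalizing n with
  | zero =>
    have hn0 : n = 0 := by
      ext q; exact (Finset.sum_eq_zero_iff.1 hn) q (Finset.mem_univ q)
    have : ∀ w : Fin 0 → G, letterCount w = n := fun w => by
      ext q; simp [letterCount, hn0]
    simp [this, hn0]
  | succ N ih =>
    have hcard : (Finset.univ.filter fun w : Fin (N + 1) → G => letterCount w = n).card =
        ∑ a : G, (Finset.univ.filter fun w : Fin N → G =>
          letterCount w + Pi.single a 1 = n).card := by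
      simp only [Finset.card_filter]
      rw [← (Fin.consEquiv fun _ : Fin (N + 1) => G).sum_comp, Fintype.sum_prod_type]
      refine Finset.sum_congr rfl fun a _ => Finset.sum_congr rfl fun w _ => ?_
      simp only [Fin.consEquiv, Equiv.coe_fn_mk]
      rw [← letterCount_cons]
      rfl
    rw [hcard, Finset.mul_sum]
    have key : ∀ a : G, (∏ q, (n q).factorial) * (Finset.univ.filter fun w : Fin N → G =>
          letterCount w + Pi.single a 1 = n).card = n a * N.factorial := by
      intro a
      by_cases ha : n a = 0
      · have : ∀ w : Fin N → G, ¬ (letterCount w + Pi.single a 1 = n) := fun w hw => by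
          have := congrFun hw a
          simp [ha] at this
        simp [this, ha]
      · obtain ⟨m, rfl⟩ : ∃ m : G → ℕ, n = m + Pi.single a 1 := by
          refine ⟨n - Pi.single a 1, ?_⟩
          ext q
          simp only [Pi.add_apply, Pi.sub_apply, Pi.single_apply]
          split_ifs with h
          · subst h; omega
          · simp
        have hm : ∑ q, m q = N := by
          simp only [Pi.add_apply, Finset.sum_add_distrib] at hn
          simp at hn; exact hn
        have hprod : ∏ q, ((m + Pi.single a 1 : G → ℕ) q).factorial = (m a + 1) * ∏ q, (m q).factorial := by
          rw [← Finset.mul_prod_erase _ _ (Finset.mem_univ a),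
            ← Finset.mul_prod_erase Finset.univ (fun q => (m q).factorial) (Finset.mem_univ a),
            ← mul_assoc]
          congr 1
          · simp [Nat.factorial_succ]
          · refine Finset.prod_congr rfl fun q hq => ?_
            simp [Finset.ne_of_mem_erase hq]
        simp only [add_left_inj]
        rw [hprod, mul_assoc, ih hm]
        simp
    simp only [key]
    rw [← Finset.sum_mul, hn, Nat.factorial_succ]

open ProbabilityTheory in
/-- Independent Poisson counts with equal rates are dominated by (in fact equal to) the letter
counts of a uniform random word of Poisson length. -/
lemma poissonPi_const_le {G : Type*} [Fintype G] [DecidableEq G] [MeasurableSpace G]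
    [DiscreteMeasurableSpace G] [Nonempty G] (π : Measure G) [IsProbabilityMeasure π]
    (hπ : ∀ q, π {q} = (Fintype.card G : ENNReal)⁻¹) (μ : NNReal) (A : Set (G → ℕ)) :
    Measure.pi (fun _ : G => poissonMeasure μ) A ≤
      ∫⁻ N, (Measure.pi fun _ : Fin N => π) {w | letterCount w ∈ A}
        ∂(poissonMeasure (Fintype.card G * μ)) := by
  set g : ℝ := (Fintype.card G : ℝ) with hg
  have hg0 : 0 < g := by rw [hg]; exact_mod_cast Fintype.card_pos
  have hsing : ∀ n : G → ℕ, Measure.pi (fun _ : G => poissonMeasure μ) {n} =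
      (Measure.pi fun _ : Fin (∑ q, n q) => π) {w | letterCount w = n} *
        poissonMeasure (Fintype.card G * μ) {∑ q, n q} := by
    intro n
    set N := ∑ q, n q with hN
    have hw : (Measure.pi fun _ : Fin N => π) {w | letterCount w = n} =
        ENNReal.ofReal ((Finset.univ.filter fun w : Fin N → G => letterCount w = n).card *
          (g⁻¹) ^ N) := by
      have e : {w : Fin N → G | letterCount w = n} =
        ((Finset.univ.filter fun w : Fin N → G => letterCount w = n : Finset _) : Set _) := by
        ext w; simp
      rw [e, ← sum_measure_singleton]
      have : ∀ w : Fin N → G, (Measure.pi fun _ : Fin N => π) {w} = ENNReal.ofReal (g⁻¹ ^ N) := by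
        intro w
        rw [Measure.pi_singleton]
        simp only [hπ, Finset.prod_const, Finset.card_univ, Fintype.card_fin]
        rw [ENNReal.ofReal_pow (by positivity), ENNReal.ofReal_inv_of_pos hg0, hg,
          ENNReal.ofReal_natCast]
      simp only [this, Finset.sum_const, nsmul_eq_mul]
      rw [ENNReal.ofReal_mul (by positivity), ENNReal.ofReal_natCast]
    rw [hw, Measure.pi_singleton]
    simp only [poissonMeasure_singleton]
    rw [← ENNReal.ofReal_prod_of_nonneg (fun _ _ => by positivity),
      ← ENNReal.ofReal_mul (by positivity)]
    congr 1
    have hW := prod_factorial_mul_card_words hN.symm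
    set W := (Finset.univ.filter fun w : Fin N → G => letterCount w = n).card
    have hW' : (∏ q, ((n q).factorial : ℝ)) * W = N.factorial := by exact_mod_cast hW
    rw [Finset.prod_div_distrib, Finset.prod_mul_distrib, Finset.prod_pow_eq_pow_sum, ← hN,
      Finset.prod_const, ← Real.exp_nat_mul, ← hW']
    have hP : (0 : ℝ) < ∏ q, ((n q).factorial : ℝ) :=
      Finset.prod_pos fun q _ => by exact_mod_cast Nat.factorial_pos _
    have hW0 : (W : ℝ) ≠ 0 := by
      intro h
      rw [h, mul_zero] at hW'
      exact (Nat.cast_ne_zero.2 (Nat.factorial_ne_zero N)) hW'.symm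
    push_cast
    rw [← hg, Finset.card_univ, ← hg, mul_pow, inv_pow, mul_neg]
    field_simp
  rw [lintegral_countable', ← Measure.tsum_indicator_apply_singleton _ _ MeasurableSet.of_discrete]
  have hset : ∀ N, (Measure.pi fun _ : Fin N => π) {w | letterCount w ∈ A} =
      ∑' n : G → ℕ, A.indicator
        (fun n => (Measure.pi fun _ : Fin N => π) {w | letterCount w = n}) n := by
    intro N
    have := Measure.tsum_indicator_apply_singleton
      ((Measure.pi fun _ : Fin N => π).map letterCount) A MeasurableSet.of_discrete
    rw [Measure.map_apply .of_discrete .of_discrete] at this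
    rw [← preimage_ofPred_eq (f := letterCount) (p := (· ∈ A)), Set.ofPred_mem_eq, ← this]
    refine tsum_congr fun n => ?_
    congr 1
    funext n
    rw [Measure.map_apply .of_discrete .of_discrete]
    rfl
  simp only [hset]
  calc ∑' n, A.indicator (fun n => Measure.pi (fun _ : G => poissonMeasure μ) {n}) n
      ≤ ∑' n, ∑' N, A.indicator
        (fun n => (Measure.pi fun _ : Fin N => π) {w | letterCount w = n}) n *
          poissonMeasure (Fintype.card G * μ) {N} := by
        refine ENNReal.tsum_le_tsum fun n => ?_
        by_cases hn : n ∈ A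
        · simp only [indicator_of_mem hn, hsing]
          exact ENNReal.le_tsum (f := fun N => (Measure.pi fun _ : Fin N => π)
            {w | letterCount w = n} * poissonMeasure (Fintype.card G * μ) {N}) _
        · simp [indicator_of_notMem hn]
    _ = _ := by
        rw [ENNReal.tsum_comm]
        simp only [ENNReal.tsum_mul_right]

/-- Count vectors on a grid for which some chain of cells carries at least `t` points. -/
def weakLong (d k t : ℕ) : Set ((Fin d → Fin k) → ℕ) :=
  {n | ∃ C : Finset (Fin d → Fin k), IsChain (· ≤ ·) (C : Set (Fin d → Fin k)) ∧ t ≤ ∑ q ∈ C, n q}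

/-- Count vectors on a grid for which some chain of at least `t` nonempty cells is strictly
increasing in every coordinate. -/
def strictLong (d k t : ℕ) : Set ((Fin d → Fin k) → ℕ) :=
  {n | ∃ C : Finset (Fin d → Fin k),
    (∀ a ∈ C, ∀ b ∈ C, a ≠ b → (∀ i, a i < b i) ∨ ∀ i, b i < a i) ∧ (∀ q ∈ C, 1 ≤ n q) ∧ t ≤ C.card}

lemma isUpperSet_weakLong (d k t : ℕ) : IsUpperSet (weakLong d k t) := by
  rintro n m hnm ⟨C, hC, h⟩
  exact ⟨C, hC, h.trans (Finset.sum_le_sum fun q _ => hnm q)⟩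

lemma isUpperSet_strictLong (d k t : ℕ) : IsUpperSet (strictLong d k t) := by
  rintro n m hnm ⟨C, hC, h1, h⟩
  exact ⟨C, hC, fun q hq => (h1 q hq).trans (hnm q), h⟩

lemma mem_weakLong_of_le_chainLength {d k t : ℕ} {g : Fin d → ℝ → Fin k}
    (hg : ∀ i, Monotone (g i)) {S : Set (Fin d → ℝ)} (hS : S.Finite) (h : t ≤ chainLength d S) :
    (fun q => (S ∩ (fun z i => g i (z i)) ⁻¹' {q}).ncard) ∈ weakLong d k t := by
  classical
  obtain ⟨C, hCS, hC, hcard⟩ := exists_card_eq_chainLength hS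
  refine ⟨C.image fun z i => g i (z i), ?_, ?_⟩
  · rw [Finset.coe_image]
    rintro _ ⟨x, hx, rfl⟩ _ ⟨y, hy, rfl⟩ hne
    rcases hC hx hy (fun e => hne (by rw [e])) with hxy | hxy
    · exact Or.inl fun i => hg i (hxy i)
    · exact Or.inr fun i => hg i (hxy i)
  · rw [← hcard, Finset.card_eq_sum_card_image (fun z i => g i (z i)) C] at h
    refine h.trans (Finset.sum_le_sum fun q _ => ?_)
    rw [← Set.ncard_coe_finset]
    refine Set.ncard_le_ncard ?_ (hS.inter_of_left _)
    intro z hz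
    rw [Finset.mem_coe, Finset.mem_filter] at hz
    exact ⟨hCS hz.1, hz.2⟩

lemma le_chainLength_of_mem_strictLong {d k t : ℕ} {g : Fin d → ℝ → Fin k}
    (hg : ∀ i, Monotone (g i)) {S : Set (Fin d → ℝ)} (hS : S.Finite)
    (h : (fun q => (S ∩ (fun z i => g i (z i)) ⁻¹' {q}).ncard) ∈ strictLong d k t) :
    t ≤ chainLength d S := by
  classical
  obtain ⟨C, hC, hne, ht⟩ := h
  have hex : ∀ q : C, ∃ z ∈ S, (fun i => g i (z i)) = q := fun q => by
    obtain ⟨z, hz⟩ := (Set.ncard_pos (hS.inter_of_left _)).1 (hne q q.2)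
    exact ⟨z, hz.1, hz.2⟩
  choose r hrS hr using hex
  have hinj : Function.Injective r := fun a b hab => by
    apply Subtype.ext; rw [← hr a, ← hr b, hab]
  have hcard : (Finset.univ.image r).card = C.card := by
    rw [Finset.card_image_of_injective _ hinj, Finset.card_univ, Fintype.card_coe]
  rw [← hcard] at ht
  refine ht.trans (card_le_chainLength hS ?_ ?_)
  · intro z hz
    simp only [Finset.coe_image, Finset.coe_univ, image_univ, mem_range] at hz
    obtain ⟨q, rfl⟩ := hz
    exact hrS q
  · have hlt : ∀ a b : C, (∀ i, a.1 i < b.1 i) → r a ≤ r b := fun a b hab i => by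
      have h1 := hab i
      rw [← hr a, ← hr b] at h1
      exact ((hg i).reflect_lt h1).le
    rw [Finset.coe_image]
    rintro _ ⟨a, -, rfl⟩ _ ⟨b, -, rfl⟩ hab
    have hab' : a.1 ≠ b.1 := fun e => hab (by rw [Subtype.ext e])
    exact (hC a a.2 b b.2 hab').imp (hlt a b) (hlt b a)

lemma le_chainLength_range_of_mem_weakLong {d k t N : ℕ} {g : Fin d → ℝ → Fin k} (hd : 0 < d)
    (hg : ∀ i, Monotone (g i)) {X : Fin N → Fin d → ℝ}
    (hX : ∀ i j, i ≠ j → ∀ a, g a (X i a) ≠ g a (X j a))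
    (h : letterCount (fun i a => g a (X i a)) ∈ weakLong d k t) :
    t ≤ chainLength d (range X) := by
  classical
  obtain ⟨C, hC, ht⟩ := h
  rw [← image_univ]
  refine ht.trans (le_chainLength_image_iff.2
    ⟨Finset.univ.filter fun i => (fun a => g a (X i a)) ∈ C, subset_univ _, ?_, ?_⟩)
  · simp only [letterCount]
    rw [Finset.card_eq_sum_card_fiberwise (f := fun i a => g a (X i a)) (t := C)]
    · refine Finset.sum_congr rfl fun q hq => ?_
      congr 1
      ext i
      simp only [Finset.mem_filter, Finset.mem_univ, true_and]
      constructor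
      · exact fun h => h.2
      · exact fun h => ⟨by rw [h]; exact hq, h⟩
    · intro i hi
      simpa using hi
  · intro i hi j hj hij
    simp only [Finset.mem_filter, Finset.mem_univ, true_and] at hi hj
    have hlt : ∀ i j, i ≠ j → (fun a => g a (X i a)) ≤ (fun a => g a (X j a)) → X i ≤ X j :=
      fun i j hij hle a => ((hg a).reflect_lt (lt_of_le_of_ne (hle a) (hX i j hij a))).le
    refine ⟨fun e => hX i j hij ⟨0, hd⟩ (by rw [e]), ?_⟩
    exact (hC hi hj (fun e => hX i j hij ⟨0, hd⟩ (congrFun e _))).imp (hlt i j hij) (hlt j i hij.symm)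

lemma mem_strictLong_of_le_chainLength_range {d k t N : ℕ} {g : Fin d → ℝ → Fin k} (hd : 0 < d)
    (hg : ∀ i, Monotone (g i)) {X : Fin N → Fin d → ℝ}
    (hX : ∀ i j, i ≠ j → ∀ a, g a (X i a) ≠ g a (X j a)) (h : t ≤ chainLength d (range X)) :
    letterCount (fun i a => g a (X i a)) ∈ strictLong d k t := by
  classical
  rw [← image_univ] at h
  obtain ⟨I, -, hI, hch⟩ := le_chainLength_image_iff.1 h
  have hinj : Function.Injective fun (i : Fin N) a => g a (X i a) := fun i j hij => by
    by_contra hne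
    exact hX i j hne ⟨0, hd⟩ (congrFun hij _)
  refine ⟨I.image fun i a => g a (X i a), ?_, ?_, ?_⟩
  · simp only [Finset.mem_image]
    rintro _ ⟨i, hi, rfl⟩ _ ⟨j, hj, rfl⟩ hne
    have hij : i ≠ j := fun e => hne (by rw [e])
    refine (hch i hi j hj hij).2.imp (fun hle a => ?_) (fun hle a => ?_)
    · exact lt_of_le_of_ne (hg a (hle a)) (hX i j hij a)
    · exact lt_of_le_of_ne (hg a (hle a)) (hX j i hij.symm a)
  · simp only [Finset.mem_image]
    rintro _ ⟨i, hi, rfl⟩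
    exact Finset.card_pos.2 ⟨i, by simp⟩
  · rw [Finset.card_image_of_injective _ hinj, hI]

/-- Index of the cell containing `x` when `[p, q)` is divided into `k + 1` equal intervals. -/
def gridIdx (k : ℕ) (p q x : ℝ) : Fin (k + 1) :=
  ⟨min ⌊(k + 1) * ((x - p) / (q - p))⌋₊ k, by omega⟩

lemma monotone_gridIdx {k : ℕ} {p q : ℝ} (hpq : p < q) : Monotone (gridIdx k p q) := by
  intro x y hxy
  have : 0 < q - p := sub_pos.2 hpq
  refine min_le_min_right k (Nat.floor_mono ?_)
  gcongr

lemma Ico_inter_gridIdx {k : ℕ} {p q : ℝ} (hpq : p < q) (j : Fin (k + 1)) :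
    Ico p q ∩ gridIdx k p q ⁻¹' {j} =
      Ico (p + (q - p) * (j / (k + 1))) (p + (q - p) * ((j + 1) / (k + 1))) := by
  have h0 : 0 < q - p := sub_pos.2 hpq
  have hk : (0 : ℝ) < k + 1 := by positivity
  have hjk : (j : ℝ) + 1 ≤ k + 1 := by exact_mod_cast j.2
  ext x
  have e1 : p + (q - p) * (j / (k + 1)) ≤ x ↔ (j : ℝ) ≤ (k + 1) * ((x - p) / (q - p)) := by
    rw [← le_sub_iff_add_le', ← le_div_iff₀' h0, div_le_iff₀' hk]
  have e2 : x < p + (q - p) * ((j + 1) / (k + 1)) ↔ (k + 1) * ((x - p) / (q - p)) < (j : ℝ) + 1 := by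
    rw [← sub_lt_iff_lt_add', ← div_lt_iff₀' h0, lt_div_iff₀' hk]
  have e3 : p ≤ x ↔ 0 ≤ (k + 1) * ((x - p) / (q - p)) := by
    rw [← sub_nonneg, mul_nonneg_iff_of_pos_left hk, le_div_iff₀ h0, zero_mul]
  have e4 : x < q ↔ (k + 1) * ((x - p) / (q - p)) < k + 1 := by
    rw [mul_lt_iff_lt_one_right hk, div_lt_one h0, sub_lt_sub_iff_right]
  simp only [mem_inter_iff, mem_Ico, mem_preimage, mem_singleton_iff, e1, e2, e3, e4, gridIdx,
    Fin.ext_iff]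
  set y := (k + 1 : ℝ) * ((x - p) / (q - p))
  constructor
  · rintro ⟨⟨h1, h2⟩, h3⟩
    have h4 : ⌊y⌋₊ < k + 1 := (Nat.floor_lt h1).2 (by exact_mod_cast h2)
    rw [min_eq_left (by omega), Nat.floor_eq_iff h1] at h3
    exact h3
  · rintro ⟨h1, h2⟩
    have hy : 0 ≤ y := le_trans (by positivity) h1
    have h3 : ⌊y⌋₊ = j := (Nat.floor_eq_iff hy).2 ⟨h1, h2⟩
    exact ⟨⟨hy, h2.trans_le hjk⟩, by rw [h3]; omega⟩

lemma measurable_gridIdx {k : ℕ} {p q : ℝ} (hpq : p < q) : Measurable (gridIdx k p q) :=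
  (monotone_gridIdx hpq).measurable

lemma volume_Ico_inter_gridIdx {k : ℕ} {p q : ℝ} (hpq : p < q) (j : Fin (k + 1)) :
    volume (Ico p q ∩ gridIdx k p q ⁻¹' {j}) = ENNReal.ofReal ((q - p) / (k + 1)) := by
  rw [Ico_inter_gridIdx hpq, Real.volume_Ico]
  congr 1
  ring

/-- The law of the cell index of a uniform point. -/
def gridLaw (k : ℕ) : Measure (Fin (k + 1)) :=
  (volume.restrict (Icc (0 : ℝ) 1)).map (gridIdx k 0 1)

instance isProbabilityMeasure_Icc : IsProbabilityMeasure (volume.restrict (Icc (0 : ℝ) 1)) :=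
  ⟨by simp⟩

instance isProbabilityMeasure_gridLaw (k : ℕ) : IsProbabilityMeasure (gridLaw k) :=
  Measure.isProbabilityMeasure_map (measurable_gridIdx zero_lt_one).aemeasurable

lemma gridLaw_singleton (k : ℕ) (j : Fin (k + 1)) : gridLaw k {j} = ((k + 1 : ℕ) : ENNReal)⁻¹ := by
  rw [gridLaw, Measure.map_apply (measurable_gridIdx zero_lt_one) (measurableSet_singleton _),
    ← Measure.restrict_congr_set Ico_ae_eq_Icc,
    Measure.restrict_apply (measurable_gridIdx zero_lt_one (measurableSet_singleton _)), inter_comm,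
    volume_Ico_inter_gridIdx zero_lt_one]
  rw [sub_zero, one_div, ENNReal.ofReal_inv_of_pos (by positivity)]
  congr 1
  rw [← Nat.cast_add_one, ENNReal.ofReal_natCast]

/-- The law of the cells of `N` independent uniform points. -/
lemma map_gridIdx_pi (d k N : ℕ) :
    (Measure.pi fun _ : Fin N => volume.restrict (Icc (0 : Fin d → ℝ) 1)).map
      (fun X i a => gridIdx k 0 1 (X i a)) =
    Measure.pi fun _ : Fin N => Measure.pi fun _ : Fin d => gridLaw k := by
  have h1 : volume.restrict (Icc (0 : Fin d → ℝ) 1) =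
      Measure.pi fun _ : Fin d => volume.restrict (Icc (0 : ℝ) 1) := by
    rw [volume_pi, ← pi_univ_Icc, Measure.restrict_pi_pi]
    rfl
  have h2 : (volume.restrict (Icc (0 : Fin d → ℝ) 1)).map (fun x a => gridIdx k 0 1 (x a)) =
      Measure.pi fun _ : Fin d => gridLaw k := by
    rw [h1]
    exact Measure.pi_map_pi (hμ := fun _ => by change SigmaFinite (gridLaw k); infer_instance)
      (fun _ => (measurable_gridIdx zero_lt_one).aemeasurable)
  have hm : Measurable fun (x : Fin d → ℝ) (a : Fin d) => gridIdx k 0 1 (x a) :=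
    measurable_pi_lambda _ fun a => (measurable_gridIdx zero_lt_one).comp (measurable_pi_apply a)
  have h3 := Measure.pi_map_pi (ι := Fin N) (X := fun _ => Fin d → ℝ)
    (Y := fun _ => Fin d → Fin (k + 1)) (μ := fun _ => volume.restrict (Icc (0 : Fin d → ℝ) 1))
    (f := fun _ x a => gridIdx k 0 1 (x a))
    (hμ := fun _ => by rw [h2]; infer_instance) (fun _ => hm.aemeasurable)
  rw [h3, h2]

/-- Collisions of coordinate slabs among `N` uniform points are unlikely on a fine grid. -/
lemma gridLaw_collision_le (d k N : ℕ) :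
    (Measure.pi fun _ : Fin N => Measure.pi fun _ : Fin d => gridLaw k)
      {w | ∃ i j, i ≠ j ∧ ∃ a, w i a = w j a} ≤ d * N ^ 2 * ((k + 1 : ℕ) : ENNReal)⁻¹ := by
  classical
  set ν := (Measure.pi fun _ : Fin N => Measure.pi fun _ : Fin d => gridLaw k) with hν
  set e := ((k + 1 : ℕ) : ENNReal)⁻¹ with he
  have hslab : ∀ (a : Fin d) (r : Fin (k + 1)),
      (Measure.pi fun _ : Fin d => gridLaw k) {q | q a = r} = e := by
    intro a r
    have := (measurePreserving_eval (fun _ : Fin d => gridLaw k) a).measure_preimage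
      (measurableSet_singleton r).nullMeasurableSet
    rw [gridLaw_singleton] at this
    exact this
  have hpair : ∀ i j : Fin N, i ≠ j → ∀ a : Fin d, ν {w | w i a = w j a} ≤ e := by
    intro i j hij a
    have hsub : {w : Fin N → Fin d → Fin (k + 1) | w i a = w j a} ⊆
        ⋃ r, pi univ fun l => if l = i ∨ l = j then {q : Fin d → Fin (k + 1) | q a = r} else univ := by
      intro w hw
      refine mem_iUnion.2 ⟨w i a, fun l _ => ?_⟩
      dsimp only
      split_ifs with h
      · rcases h with rfl | rfl
        · rfl
        · exact hw.symm
      · trivial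
    refine (measure_mono hsub).trans ((measure_iUnion_le _).trans ?_)
    have hr : ∀ r : Fin (k + 1), ν (pi univ fun l => if l = i ∨ l = j then
        {q : Fin d → Fin (k + 1) | q a = r} else univ) = e ^ 2 := by
      intro r
      rw [hν, Measure.pi_pi]
      have : ∀ l, (Measure.pi fun _ : Fin d => gridLaw k) (if l = i ∨ l = j then
        {q : Fin d → Fin (k + 1) | q a = r} else univ) = if l = i ∨ l = j then e else 1 := by
        intro l
        split_ifs
        · exact hslab a r
        · exact measure_univ
      simp only [this]
      rw [Finset.prod_ite, Finset.prod_const, Finset.prod_const_one, mul_one]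
      congr 1
      rw [Finset.filter_or, Finset.filter_eq', Finset.filter_eq']
      simp only [Finset.mem_univ, if_true]
      exact Finset.card_pair hij
    simp only [hr]
    rw [tsum_fintype, Finset.sum_const, Finset.card_univ, Fintype.card_fin, nsmul_eq_mul, he, sq,
      ← mul_assoc, ENNReal.mul_inv_cancel (by simp) (by simp), one_mul]
  have hsub : {w : Fin N → Fin d → Fin (k + 1) | ∃ i j, i ≠ j ∧ ∃ a, w i a = w j a} ⊆
      ⋃ p : Fin N × Fin N × Fin d, {w | p.1 ≠ p.2.1 ∧ w p.1 p.2.2 = w p.2.1 p.2.2} := by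
    rintro w ⟨i, j, hij, a, h⟩
    exact mem_iUnion.2 ⟨(i, j, a), hij, h⟩
  refine (measure_mono hsub).trans ((measure_iUnion_le _).trans ?_)
  rw [tsum_fintype]
  refine (Finset.sum_le_sum (g := fun _ => e) fun p _ => ?_).trans_eq ?_
  · by_cases hp : p.1 = p.2.1
    · simp [hp]
    · exact (measure_mono fun w hw => hw.2).trans (hpair _ _ hp _)
  · rw [Finset.sum_const, Finset.card_univ, nsmul_eq_mul]
    simp only [Fintype.card_prod, Fintype.card_fin]
    push_cast
    ring

lemma gridLaw_weakLong_le {d : ℕ} (hd : 0 < d) (k N t : ℕ) :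
    (Measure.pi fun _ : Fin N => Measure.pi fun _ : Fin d => gridLaw k)
      {w | letterCount w ∈ weakLong d (k + 1) t} ≤
    (Measure.pi fun _ : Fin N => volume.restrict (Icc (0 : Fin d → ℝ) 1))
      {X | t ≤ chainLength d (range X)} + d * N ^ 2 * ((k + 1 : ℕ) : ENNReal)⁻¹ := by
  refine le_trans ?_ (add_le_add_right (gridLaw_collision_le d k N) _)
  have hm : Measurable fun (X : Fin N → Fin d → ℝ) i a => gridIdx k 0 1 (X i a) := by
    have := measurable_gridIdx (k := k) zero_lt_one
    fun_prop
  rw [← map_gridIdx_pi, Measure.map_apply hm .of_discrete, Measure.map_apply hm .of_discrete]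
  refine (measure_mono ?_).trans (measure_union_le _ _)
  intro X hX
  by_cases hcol : ∃ i j, i ≠ j ∧ ∃ a, gridIdx k 0 1 (X i a) = gridIdx k 0 1 (X j a)
  · exact Or.inr hcol
  · push Not at hcol
    exact Or.inl (le_chainLength_range_of_mem_weakLong (g := fun _ => gridIdx k 0 1) hd
      (fun _ => monotone_gridIdx zero_lt_one) hcol hX)

lemma gridLaw_compl_strictLong_le {d : ℕ} (hd : 0 < d) (k N t : ℕ) :
    (Measure.pi fun _ : Fin N => Measure.pi fun _ : Fin d => gridLaw k)
      {w | letterCount w ∈ (strictLong d (k + 1) t)ᶜ} ≤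
    (Measure.pi fun _ : Fin N => volume.restrict (Icc (0 : Fin d → ℝ) 1))
      {X | chainLength d (range X) < t} + d * N ^ 2 * ((k + 1 : ℕ) : ENNReal)⁻¹ := by
  refine le_trans ?_ (add_le_add_right (gridLaw_collision_le d k N) _)
  have hm : Measurable fun (X : Fin N → Fin d → ℝ) i a => gridIdx k 0 1 (X i a) := by
    have := measurable_gridIdx (k := k) zero_lt_one
    fun_prop
  rw [← map_gridIdx_pi, Measure.map_apply hm .of_discrete, Measure.map_apply hm .of_discrete]
  refine (measure_mono ?_).trans (measure_union_le _ _)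
  intro X hX
  by_cases hcol : ∃ i j, i ≠ j ∧ ∃ a, gridIdx k 0 1 (X i a) = gridIdx k 0 1 (X j a)
  · exact Or.inr hcol
  · push Not at hcol
    refine Or.inl (mem_ofPred.2 (not_le.1 fun h => hX ?_))
    exact mem_strictLong_of_le_chainLength_range (g := fun _ => gridIdx k 0 1) hd
      (fun _ => monotone_gridIdx zero_lt_one) hcol h

open ProbabilityTheory in
lemma hasSum_poisson_exp (r : NNReal) (θ : ℝ) :
    HasSum (fun n : ℕ => Real.exp (-r) * (r : ℝ) ^ n / n.factorial * Real.exp (θ * n))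
      (Real.exp (r * (Real.exp θ - 1))) := by
  have h := (NormedSpace.expSeries_div_hasSum_exp ((r : ℝ) * Real.exp θ)).mul_left (Real.exp (-r))
  rw [← Real.exp_eq_exp_ℝ, ← Real.exp_add] at h
  convert! h using 1
  · funext n
    rw [mul_pow, ← Real.exp_nat_mul, mul_comm θ]
    ring
  · congr 1; ring

open ProbabilityTheory in
lemma integrable_exp_poissonMeasure (r : NNReal) (θ : ℝ) :
    Integrable (fun n : ℕ => Real.exp (θ * n)) (poissonMeasure r) := by
  rw [integrable_poissonMeasure_iff]
  simpa only [Real.norm_eq_abs, Real.abs_exp] using (hasSum_poisson_exp r θ).summable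

open ProbabilityTheory in
lemma mgf_poissonMeasure (r : NNReal) (θ : ℝ) :
    mgf (fun n : ℕ => (n : ℝ)) (poissonMeasure r) θ = Real.exp (r * (Real.exp θ - 1)) := by
  rw [mgf, integral_poissonMeasure]
  simpa only [smul_eq_mul] using (hasSum_poisson_exp r θ).tsum_eq

lemma exp_neg_le_two_div_sq {y : ℝ} (hy : 0 < y) : Real.exp (-y) ≤ 2 / y ^ 2 := by
  have h := Real.pow_div_factorial_le_exp y hy.le 2
  rw [Real.exp_neg, ← one_div, div_le_div_iff₀ (Real.exp_pos _) (by positivity)]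
  norm_num at h
  linarith

open ProbabilityTheory in
/-- Concentration of the Poisson law around its mean. -/
lemma poissonMeasure_tail {r : NNReal} (hr : 0 < r) {η : ℝ} (hη : 0 < η) (hη1 : η ≤ 1) :
    poissonMeasure r {n | (1 + η) * r ≤ n ∨ (n : ℝ) ≤ (1 - η) * r} ≤
      ENNReal.ofReal (64 / η ^ 4 / (r : ℝ) ^ 2) := by
  have hr' : (0 : ℝ) < r := hr
  have hquad : ∀ θ : ℝ, |θ| ≤ 1 → Real.exp θ - 1 ≤ θ + θ ^ 2 := fun θ hθ => by
    have := (abs_le.1 (Real.abs_exp_sub_one_sub_id_le hθ)).2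
    linarith
  have h1 : (poissonMeasure r).real {n | (1 + η) * r ≤ n} ≤ Real.exp (-(r * η ^ 2 / 4)) := by
    refine (measure_ge_le_exp_mul_mgf (X := fun n : ℕ => (n : ℝ)) _ (t := η / 2) (by positivity)
      (integrable_exp_poissonMeasure r _)).trans ?_
    rw [mgf_poissonMeasure, ← Real.exp_add]
    refine Real.exp_le_exp.2 ?_
    have := hquad (η / 2) (by rw [abs_of_pos (by positivity)]; linarith)
    nlinarith [mul_le_mul_of_nonneg_left this hr'.le]
  have h2 : (poissonMeasure r).real {n | (n : ℝ) ≤ (1 - η) * r} ≤ Real.exp (-(r * η ^ 2 / 4)) := by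
    refine (measure_le_le_exp_mul_mgf (X := fun n : ℕ => (n : ℝ)) _ (t := -(η / 2))
      (by linarith) (integrable_exp_poissonMeasure r _)).trans ?_
    rw [mgf_poissonMeasure, ← Real.exp_add]
    refine Real.exp_le_exp.2 ?_
    have := hquad (-(η / 2)) (by rw [abs_neg, abs_of_pos (by positivity)]; linarith)
    nlinarith [mul_le_mul_of_nonneg_left this hr'.le]
  have h3 := exp_neg_le_two_div_sq (y := r * η ^ 2 / 4) (by positivity)
  have h4 : (poissonMeasure r).real ({n : ℕ | (1 + η) * r ≤ n} ∪ {n | (n : ℝ) ≤ (1 - η) * r}) ≤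
      64 / η ^ 4 / (r : ℝ) ^ 2 := by
    refine (measureReal_union_le _ _).trans ((add_le_add (h1.trans h3) (h2.trans h3)).trans_eq ?_)
    field_simp
    norm_num
  rw [← ENNReal.ofReal_toReal (measure_ne_top (poissonMeasure r) _)]
  exact ENNReal.ofReal_le_ofReal h4

open ProbabilityTheory in
lemma lintegral_sq_poissonMeasure_lt_top (r : NNReal) :
    ∫⁻ N, (N : ENNReal) ^ 2 ∂(poissonMeasure r) < ⊤ := by
  have h := (integrable_exp_poissonMeasure r 1).lintegral_lt_top
  refine lt_of_le_of_lt ?_ (ENNReal.mul_lt_top (show (2 : ENNReal) < ⊤ by simp) h)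
  rw [← lintegral_const_mul _ .of_discrete]
  refine lintegral_mono fun N => ?_
  have h1 := Real.pow_div_factorial_le_exp (N : ℝ) (Nat.cast_nonneg _) 2
  have h2 : (N : ENNReal) ^ 2 = ENNReal.ofReal ((N : ℝ) ^ 2) := by
    rw [ENNReal.ofReal_pow (Nat.cast_nonneg _), ENNReal.ofReal_natCast]
  rw [h2, show (2 : ENNReal) = ENNReal.ofReal 2 by simp, ← ENNReal.ofReal_mul (by norm_num)]
  refine ENNReal.ofReal_le_ofReal ?_
  norm_num at h1
  rw [one_mul]
  linarith

open ProbabilityTheory in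
/-- The longest chain in a Poisson number of uniform points concentrates. -/
lemma poissonized_chainLength_tail {d : ℕ} (hd : 0 < d) {c : ℝ} (hc : IsBWConstant d c) {δ : ℝ}
    (hδ : 0 < δ) (hδc : δ ≤ c) : ∃ C : ℝ, 0 ≤ C ∧ ∀ r : NNReal, 0 < r →
    ∫⁻ N, (Measure.pi fun _ : Fin N => volume.restrict (Icc (0 : Fin d → ℝ) 1))
      {X | (c + δ) * (r : ℝ) ^ ((1 : ℝ) / d) ≤ chainLength d (range X)} ∂(poissonMeasure r) ≤
        ENNReal.ofReal (C / (r : ℝ) ^ 2) ∧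
    ∫⁻ N, (Measure.pi fun _ : Fin N => volume.restrict (Icc (0 : Fin d → ℝ) 1))
      {X | (chainLength d (range X) : ℝ) ≤ (c - δ) * (r : ℝ) ^ ((1 : ℝ) / d)} ∂(poissonMeasure r) ≤
        ENNReal.ofReal (C / (r : ℝ) ^ 2) := by
  obtain ⟨C, hC, htail⟩ := chainLength_range_tail hd hc (half_pos hδ)
  have hc0 := hc.1
  set η := min (1 / 2) (δ / (2 * (c + δ))) with hη
  have hη0 : 0 < η := lt_min (by norm_num) (by positivity)
  have hη1 : η ≤ 1 / 2 := min_le_left _ _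
  have hη2 : η * (2 * (c + δ)) ≤ δ := (le_div_iff₀ (by positivity)).1 (min_le_right _ _)
  refine ⟨4 * C + 64 / η ^ 4, by positivity, fun r hr => ?_⟩
  have hr' : (0 : ℝ) < r := hr
  set T : Set ℕ := {n | (1 + η) * r ≤ n ∨ (n : ℝ) ≤ (1 - η) * r} with hT
  have key : ∀ E : (N : ℕ) → Set (Fin N → Fin d → ℝ), (∀ N ∉ T, (Measure.pi fun _ : Fin N =>
      volume.restrict (Icc (0 : Fin d → ℝ) 1)).real (E N) ≤ C / (N : ℝ) ^ 2) →
      ∫⁻ N, (Measure.pi fun _ : Fin N => volume.restrict (Icc (0 : Fin d → ℝ) 1)) (E N)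
        ∂(poissonMeasure r) ≤ ENNReal.ofReal ((4 * C + 64 / η ^ 4) / (r : ℝ) ^ 2) := by
    intro E hE
    calc ∫⁻ N, (Measure.pi fun _ : Fin N => volume.restrict (Icc (0 : Fin d → ℝ) 1)) (E N)
          ∂(poissonMeasure r)
        ≤ ∫⁻ N, (ENNReal.ofReal (4 * C / (r : ℝ) ^ 2) + T.indicator 1 N) ∂(poissonMeasure r) := by
          refine lintegral_mono fun N => ?_
          by_cases hN : N ∈ T
          · rw [indicator_of_mem hN]
            exact prob_le_one.trans le_add_self
          · rw [indicator_of_notMem hN, add_zero, ← ENNReal.ofReal_toReal (measure_ne_top _ (E N))]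
            refine ENNReal.ofReal_le_ofReal ((hE N hN).trans ?_)
            have hN' := hN
            rw [hT, mem_ofPred, not_or, not_le, not_le] at hN'
            have : (r : ℝ) / 2 ≤ N := by nlinarith [hN'.2]
            have h5 : (r : ℝ) ^ 2 / 4 ≤ (N : ℝ) ^ 2 := by nlinarith
            calc C / (N : ℝ) ^ 2 ≤ C / ((r : ℝ) ^ 2 / 4) := by gcongr
              _ = 4 * C / (r : ℝ) ^ 2 := by field_simp
      _ = ENNReal.ofReal (4 * C / (r : ℝ) ^ 2) + poissonMeasure r T := by
          rw [lintegral_add_left .of_discrete, lintegral_const, measure_univ, mul_one,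
            lintegral_indicator_one .of_discrete]
      _ ≤ ENNReal.ofReal (4 * C / (r : ℝ) ^ 2) + ENNReal.ofReal (64 / η ^ 4 / (r : ℝ) ^ 2) := by
          gcongr
          exact poissonMeasure_tail hr hη0 (by linarith)
      _ = _ := by
          rw [← ENNReal.ofReal_add (by positivity) (by positivity), add_div]
  have hd1 : (1 : ℝ) / d ≤ 1 := by
    rw [div_le_one (by exact_mod_cast hd)]; exact_mod_cast hd
  have hd0 : (0 : ℝ) ≤ 1 / d := by positivity
  refine ⟨key _ fun N hN => ?_, key _ fun N hN => ?_⟩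
  all_goals
    rw [hT, mem_ofPred, not_or, not_le, not_le] at hN
    have hN0 : (0 : ℝ) < N := lt_of_le_of_lt (by nlinarith) hN.2
    have hN1 : 1 ≤ N := by exact_mod_cast hN0
  · refine (measureReal_mono ?_).trans (htail N hN1).1
    intro X hX
    refine le_trans ?_ (mem_ofPred.1 hX)
    have h1 : (N : ℝ) ^ ((1 : ℝ) / d) ≤ (1 + η) * (r : ℝ) ^ ((1 : ℝ) / d) := by
      calc (N : ℝ) ^ ((1 : ℝ) / d) ≤ ((1 + η) * r) ^ ((1 : ℝ) / d) :=
            Real.rpow_le_rpow hN0.le hN.1.le hd0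
        _ = (1 + η) ^ ((1 : ℝ) / d) * (r : ℝ) ^ ((1 : ℝ) / d) :=
            Real.mul_rpow (by linarith) hr'.le
        _ ≤ _ := by
            gcongr
            exact (Real.rpow_le_rpow_of_exponent_le (by linarith) hd1).trans_eq (Real.rpow_one _)
    calc (c + δ / 2) * (N : ℝ) ^ ((1 : ℝ) / d)
        ≤ (c + δ / 2) * ((1 + η) * (r : ℝ) ^ ((1 : ℝ) / d)) := by gcongr
      _ = ((c + δ / 2) * (1 + η)) * (r : ℝ) ^ ((1 : ℝ) / d) := by ring
      _ ≤ _ := by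
        gcongr
        nlinarith
  · refine (measureReal_mono ?_).trans (htail N hN1).2
    intro X hX
    refine le_trans (mem_ofPred.1 hX) ?_
    have h1 : (1 - η) * (r : ℝ) ^ ((1 : ℝ) / d) ≤ (N : ℝ) ^ ((1 : ℝ) / d) := by
      calc (N : ℝ) ^ ((1 : ℝ) / d) ≥ ((1 - η) * r) ^ ((1 : ℝ) / d) :=
            Real.rpow_le_rpow (by nlinarith) hN.2.le hd0
        _ = (1 - η) ^ ((1 : ℝ) / d) * (r : ℝ) ^ ((1 : ℝ) / d) :=
            Real.mul_rpow (by linarith) hr'.le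
        _ ≥ _ := by
            gcongr
            exact (Real.rpow_one _).symm.trans_le
              (Real.rpow_le_rpow_of_exponent_ge (by linarith) (by linarith) hd1)
    calc (c - δ) * (r : ℝ) ^ ((1 : ℝ) / d)
        ≤ ((c - δ / 2) * (1 - η)) * (r : ℝ) ^ ((1 : ℝ) / d) := by
          gcongr
          nlinarith
      _ = (c - δ / 2) * ((1 - η) * (r : ℝ) ^ ((1 : ℝ) / d)) := by ring
      _ ≤ _ := by
        have : 0 ≤ c - δ / 2 := by linarith
        gcongr

open ProbabilityTheory in
/-- The joint law of the counts of a Poisson process in disjoint cells. -/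
lemma PoissonPP.measure_counts_le {d : ℕ} {Ω : Type*} [MeasurableSpace Ω] {P : Measure Ω}
    {g : (Fin d → ℝ) → ℝ} (PP : PoissonPP d P g) (hg : ∀ x, 0 ≤ g x) {G : Type*} [Fintype G]
    {Q : G → Set (Fin d → ℝ)} (hQm : ∀ q, MeasurableSet (Q q))
    (hQb : ∀ q, Bornology.IsBounded (Q q)) (hQd : Pairwise fun q q' => Disjoint (Q q) (Q q'))
    (A : Set (G → ℕ)) :
    P {ω | ∃ n ∈ A, ∀ q, (PP.pts ω ∩ Q q).encard = n q} ≤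
      Measure.pi (fun q => poissonMeasure (∫ x in Q q, g x).toNNReal) A := by
  have hsub : {ω | ∃ n ∈ A, ∀ q, (PP.pts ω ∩ Q q).encard = n q} ⊆
      ⋃ n : G → ℕ, {ω | n ∈ A ∧ ∀ q, (PP.pts ω ∩ Q q).encard = n q} := by
    rintro ω ⟨n, hn, h⟩
    exact mem_iUnion.2 ⟨n, hn, h⟩
  refine (measure_mono hsub).trans ((measure_iUnion_le _).trans ?_)
  rw [← Measure.tsum_indicator_apply_singleton _ _ MeasurableSet.of_discrete]
  refine ENNReal.tsum_le_tsum fun n => ?_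
  by_cases hn : n ∈ A
  · rw [indicator_of_mem hn, Measure.pi_singleton]
    set e := (Fintype.equivFin G).symm
    have h := PP.indep (Fintype.card G) (fun i => Q (e i)) (fun i => hQm _) (fun i => hQb _)
      (fun i j hij => hQd (e.injective.ne hij)) (fun i => n (e i))
    have hset : {ω | n ∈ A ∧ ∀ q, (PP.pts ω ∩ Q q).encard = n q} =
        ⋂ i, {ω | (PP.pts ω ∩ Q (e i)).encard = n (e i)} := by
      ext ω
      simp only [mem_ofPred_eq, hn, true_and, mem_iInter]
      exact ⟨fun h i => h _, fun h q => by simpa using h (e.symm q)⟩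
    rw [hset, h, e.prod_comp fun q => P {ω | (PP.pts ω ∩ Q q).encard = n q}]
    refine le_of_eq (Finset.prod_congr rfl fun q _ => ?_)
    rw [PP.poisson _ (hQm q) (hQb q), poissonMeasure_singleton,
      Real.coe_toNNReal _ (integral_nonneg hg)]
  · simp [hn]

open ProbabilityTheory in
/-- A Poisson process is almost surely finite on bounded sets. -/
lemma PoissonPP.ae_finite {d : ℕ} {Ω : Type*} [MeasurableSpace Ω] {P : Measure Ω}
    [IsProbabilityMeasure P] {g : (Fin d → ℝ) → ℝ} (PP : PoissonPP d P g) (hg : ∀ x, 0 ≤ g x)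
    {B : Set (Fin d → ℝ)} (hB : MeasurableSet B) (hBb : Bornology.IsBounded B) :
    ∀ᵐ ω ∂P, (PP.pts ω ∩ B).Finite := by
  have hm : MeasurableSet (⋃ k : ℕ, {ω | (PP.pts ω ∩ B).encard = k}) :=
    MeasurableSet.iUnion fun k => PP.measur B hB hBb k
  have h1 : P (⋃ k : ℕ, {ω | (PP.pts ω ∩ B).encard = k}) = 1 := by
    rw [measure_iUnion _ (fun k => PP.measur B hB hBb k)]
    · simp only [PP.poisson B hB hBb]
      have h := hasSum_one_poissonMeasure (∫ x in B, g x).toNNReal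
      rw [Real.coe_toNNReal _ (integral_nonneg hg)] at h
      rw [← ENNReal.ofReal_tsum_of_nonneg (fun k => ?_) h.summable, h.tsum_eq, ENNReal.ofReal_one]
      have : 0 ≤ ∫ x in B, g x := integral_nonneg hg
      positivity
    · intro k l hkl
      refine Set.disjoint_left.2 fun ω hk hl => hkl ?_
      rw [mem_ofPred] at hk hl
      rw [hk] at hl
      exact_mod_cast hl
  have h2 : ∀ᵐ ω ∂P, ω ∈ ⋃ k : ℕ, {ω | (PP.pts ω ∩ B).encard = k} :=
    (mem_ae_iff_prob_eq_one hm).2 h1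
  filter_upwards [h2] with ω hω
  obtain ⟨k, hk⟩ := mem_iUnion.1 hω
  exact Set.finite_of_encard_eq_coe hk

/-- The half-open box with corners `p` and `q`. -/
def hbox {d : ℕ} (p q : Fin d → ℝ) : Set (Fin d → ℝ) := pi univ fun i => Ico (p i) (q i)

/-- The grid cells of a half-open box. -/
def boxCell {d : ℕ} (k : ℕ) (p q : Fin d → ℝ) (s : Fin d → Fin (k + 1)) : Set (Fin d → ℝ) :=
  hbox p q ∩ (fun z i => gridIdx k (p i) (q i) (z i)) ⁻¹' {s}

lemma measurableSet_hbox {d : ℕ} (p q : Fin d → ℝ) : MeasurableSet (hbox p q) :=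
  MeasurableSet.univ_pi fun _ => measurableSet_Ico

lemma isBounded_hbox {d : ℕ} (p q : Fin d → ℝ) : Bornology.IsBounded (hbox p q) :=
  Bornology.IsBounded.pi fun _ => Metric.isBounded_Ico _ _

lemma boxCell_eq {d k : ℕ} {p q : Fin d → ℝ} (s : Fin d → Fin (k + 1)) :
    boxCell k p q s = pi univ fun i => Ico (p i) (q i) ∩ gridIdx k (p i) (q i) ⁻¹' {s i} := by
  ext z
  simp only [boxCell, hbox, mem_inter_iff, Set.mem_pi, mem_univ, true_implies, mem_preimage,
    mem_singleton_iff, funext_iff]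
  exact ⟨fun h i => ⟨h.1 i, h.2 i⟩, fun h => ⟨fun i => (h i).1, fun i => (h i).2⟩⟩

lemma measurableSet_boxCell {d k : ℕ} {p q : Fin d → ℝ} (hpq : ∀ i, p i < q i)
    (s : Fin d → Fin (k + 1)) : MeasurableSet (boxCell k p q s) := by
  rw [boxCell_eq]
  exact MeasurableSet.univ_pi fun i =>
    measurableSet_Ico.inter (measurable_gridIdx (hpq i) (measurableSet_singleton _))

lemma volume_boxCell {d k : ℕ} {p q : Fin d → ℝ} (hpq : ∀ i, p i < q i)
    (s : Fin d → Fin (k + 1)) :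
    volume.real (boxCell k p q s) = (∏ i, (q i - p i)) / ((k + 1 : ℕ) : ℝ) ^ d := by
  have h0 : ∀ i, 0 ≤ (q i - p i) / (k + 1) := fun i => by
    have := sub_pos.2 (hpq i)
    positivity
  rw [measureReal_def, boxCell_eq, volume_pi_pi]
  simp only [volume_Ico_inter_gridIdx (hpq _)]
  rw [← ENNReal.ofReal_prod_of_nonneg (fun i _ => h0 i),
    ENNReal.toReal_ofReal (Finset.prod_nonneg fun i _ => h0 i), Finset.prod_div_distrib]
  simp

open ProbabilityTheory in
/-- Poissonization on a fine grid: equal rates on all cells of the grid. -/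
lemma poissonPi_grid_le {d : ℕ} (k : ℕ) (r : NNReal) (A : Set ((Fin d → Fin (k + 1)) → ℕ))
    (E : (N : ℕ) → Set (Fin N → Fin d → ℝ))
    (hE : ∀ N, (Measure.pi fun _ : Fin N => Measure.pi fun _ : Fin d => gridLaw k)
      {w | letterCount w ∈ A} ≤
      (Measure.pi fun _ : Fin N => volume.restrict (Icc (0 : Fin d → ℝ) 1)) (E N) +
        d * N ^ 2 * ((k + 1 : ℕ) : ENNReal)⁻¹) :
    Measure.pi (fun _ : Fin d → Fin (k + 1) => poissonMeasure (r / ((k + 1 : ℕ) : NNReal) ^ d)) A ≤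
      ∫⁻ N, (Measure.pi fun _ : Fin N => volume.restrict (Icc (0 : Fin d → ℝ) 1)) (E N)
        ∂(poissonMeasure r) +
      d * (∫⁻ N, (N : ENNReal) ^ 2 ∂(poissonMeasure r)) * ((k + 1 : ℕ) : ENNReal)⁻¹ := by
  have hcard : Fintype.card (Fin d → Fin (k + 1)) = (k + 1) ^ d := by simp
  refine (poissonPi_const_le (Measure.pi fun _ : Fin d => gridLaw k) (fun s => ?_) _ A).trans ?_
  · rw [Measure.pi_singleton]
    simp only [gridLaw_singleton, Finset.prod_const, hcard, Finset.card_univ, Fintype.card_fin]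
    rw [← ENNReal.inv_pow, ← Nat.cast_pow]
  · have hr : (Fintype.card (Fin d → Fin (k + 1)) : NNReal) * (r / ((k + 1 : ℕ) : NNReal) ^ d) = r := by
      rw [hcard]
      push_cast
      field_simp
    rw [hr]
    refine (lintegral_mono hE).trans_eq ?_
    rw [lintegral_add_left .of_discrete, lintegral_mul_const _ .of_discrete,
      lintegral_const_mul _ .of_discrete]

open ProbabilityTheory in
lemma tendsto_poissonized_error {d : ℕ} (R : ENNReal) (r : NNReal) :
    Tendsto (fun k : ℕ => R + d * (∫⁻ N, (N : ENNReal) ^ 2 ∂(poissonMeasure r)) *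
      ((k + 1 : ℕ) : ENNReal)⁻¹) atTop (𝓝 R) := by
  have h1 : Tendsto (fun k : ℕ => ((k + 1 : ℕ) : ENNReal)⁻¹) atTop (𝓝 0) :=
    ENNReal.tendsto_inv_nat_nhds_zero.comp (tendsto_add_atTop_nat 1)
  have h2 := ENNReal.Tendsto.const_mul
    (a := d * (∫⁻ N, (N : ENNReal) ^ 2 ∂(poissonMeasure r))) h1
    (Or.inr (ENNReal.mul_ne_top (by simp) (lintegral_sq_poissonMeasure_lt_top r).ne))
  simpa using h2.const_add R

/-- Almost surely, the chain length event is contained in the grid count event. -/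
lemma PoissonPP.exists_counts {d : ℕ} {Ω : Type*} [MeasurableSpace Ω] {P : Measure Ω}
    {g : (Fin d → ℝ) → ℝ} (PP : PoissonPP d P g) {p q : Fin d → ℝ} {k : ℕ} {ω : Ω}
    (hfin : (PP.pts ω ∩ hbox p q).Finite) {A : Set ((Fin d → Fin (k + 1)) → ℕ)}
    (hA : (fun s => ((PP.pts ω ∩ hbox p q) ∩
      (fun z i => gridIdx k (p i) (q i) (z i)) ⁻¹' {s}).ncard) ∈ A) :
    ∃ n ∈ A, ∀ s, (PP.pts ω ∩ boxCell k p q s).encard = n s := by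
  refine ⟨_, hA, fun s => ?_⟩
  rw [boxCell, ← inter_assoc, (hfin.inter_of_left _).cast_ncard_eq]

lemma disjoint_boxCell {d k : ℕ} (p q : Fin d → ℝ) :
    Pairwise fun s s' => Disjoint (boxCell k p q s) (boxCell k p q s') := by
  intro s s' hs
  refine Set.disjoint_left.2 fun z hz hz' => hs ?_
  exact hz.2.symm.trans hz'.2

open ProbabilityTheory in
/-- Upper tail of the longest chain of a Poisson process in a box, by comparison with a Poisson
number of uniform points. -/
lemma PoissonPP.measure_le_chainLength {d : ℕ} (hd : 0 < d) {Ω : Type*} [MeasurableSpace Ω]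
    {P : Measure Ω} [IsProbabilityMeasure P] {g : (Fin d → ℝ) → ℝ} (PP : PoissonPP d P g)
    (hg : ∀ x, 0 ≤ g x) {p q : Fin d → ℝ} (hpq : ∀ i, p i < q i) {r : NNReal}
    (hga : ∀ x ∈ hbox p q, g x * (∏ i, (q i - p i)) ≤ r) (t : ℕ) :
    P {ω | t ≤ chainLength d (PP.pts ω ∩ hbox p q)} ≤
      ∫⁻ N, (Measure.pi fun _ : Fin N => volume.restrict (Icc (0 : Fin d → ℝ) 1))
        {X | t ≤ chainLength d (range X)} ∂(poissonMeasure r) := by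
  have hV : 0 < ∏ i, (q i - p i) := Finset.prod_pos fun i _ => sub_pos.2 (hpq i)
  refine ge_of_tendsto' (tendsto_poissonized_error (d := d) _ r) fun k => ?_
  refine le_trans ?_ (poissonPi_grid_le k r (weakLong d (k + 1) t) _
    fun N => gridLaw_weakLong_le hd k N t)
  have hsub : P {ω | t ≤ chainLength d (PP.pts ω ∩ hbox p q)} ≤
      P {ω | ∃ n ∈ weakLong d (k + 1) t, ∀ s, (PP.pts ω ∩ boxCell k p q s).encard = n s} := by
    refine measure_mono_ae ?_
    filter_upwards [PP.ae_finite hg (measurableSet_hbox p q) (isBounded_hbox p q)] with ω hfin hω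
    exact PP.exists_counts hfin (mem_weakLong_of_le_chainLength
      (g := fun i => gridIdx k (p i) (q i)) (fun i => monotone_gridIdx (hpq i)) hfin hω)
  refine hsub.trans ((PP.measure_counts_le hg (measurableSet_boxCell hpq)
    (fun s => (isBounded_hbox p q).subset inter_subset_left) (disjoint_boxCell p q) _).trans
    (poissonPi_mono ?_ (isUpperSet_weakLong _ _ _)))
  intro s
  have h1 : ∫ x in boxCell k p q s, g x ≤ r / (∏ i, (q i - p i)) * volume.real (boxCell k p q s) := by
    refine (Real.le_norm_self _).trans (norm_setIntegral_le_of_norm_le_const ?_ ?_)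
    · exact ((isBounded_hbox p q).subset inter_subset_left).measure_lt_top
    · intro x hx
      rw [Real.norm_eq_abs, abs_of_nonneg (hg x), le_div_iff₀ hV]
      exact hga x hx.1
  rw [Real.toNNReal_le_iff_le_coe]
  refine h1.trans_eq ?_
  rw [volume_boxCell hpq]
  push_cast
  field_simp

open ProbabilityTheory in
/-- Lower tail of the longest chain of a Poisson process in a box, by comparison with a Poisson
number of uniform points. -/
lemma PoissonPP.measure_chainLength_lt {d : ℕ} (hd : 0 < d) {Ω : Type*} [MeasurableSpace Ω]
    {P : Measure Ω} [IsProbabilityMeasure P] {g : (Fin d → ℝ) → ℝ} (PP : PoissonPP d P g)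
    (hg : ∀ x, 0 ≤ g x) {p q : Fin d → ℝ} (hpq : ∀ i, p i < q i) {r : NNReal}
    (hgInt : IntegrableOn g (hbox p q))
    (hga : ∀ x ∈ hbox p q, r ≤ g x * (∏ i, (q i - p i))) (t : ℕ) :
    P {ω | chainLength d (PP.pts ω ∩ hbox p q) < t} ≤
      ∫⁻ N, (Measure.pi fun _ : Fin N => volume.restrict (Icc (0 : Fin d → ℝ) 1))
        {X | chainLength d (range X) < t} ∂(poissonMeasure r) := by
  have hV : 0 < ∏ i, (q i - p i) := Finset.prod_pos fun i _ => sub_pos.2 (hpq i)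
  refine ge_of_tendsto' (tendsto_poissonized_error (d := d) _ r) fun k => ?_
  refine le_trans ?_ (poissonPi_grid_le k r (strictLong d (k + 1) t)ᶜ _
    fun N => gridLaw_compl_strictLong_le hd k N t)
  have hsub : P {ω | chainLength d (PP.pts ω ∩ hbox p q) < t} ≤
      P {ω | ∃ n ∈ (strictLong d (k + 1) t)ᶜ, ∀ s, (PP.pts ω ∩ boxCell k p q s).encard = n s} := by
    refine measure_mono_ae ?_
    filter_upwards [PP.ae_finite hg (measurableSet_hbox p q) (isBounded_hbox p q)] with ω hfin hω
    refine PP.exists_counts hfin fun h => not_le.2 hω (le_chainLength_of_mem_strictLong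
      (g := fun i => gridIdx k (p i) (q i)) (fun i => monotone_gridIdx (hpq i)) hfin h)
  refine hsub.trans ((PP.measure_counts_le hg (measurableSet_boxCell hpq)
    (fun s => (isBounded_hbox p q).subset inter_subset_left) (disjoint_boxCell p q) _).trans ?_)
  rw [prob_compl_eq_one_sub .of_discrete, prob_compl_eq_one_sub .of_discrete]
  refine tsub_le_tsub_left (poissonPi_mono ?_ (isUpperSet_strictLong _ _ _)) _
  intro s
  have hfinite : volume (boxCell k p q s) < ⊤ :=
    ((isBounded_hbox p q).subset inter_subset_left).measure_lt_top
  have h1 : r / (∏ i, (q i - p i)) * volume.real (boxCell k p q s) ≤ ∫ x in boxCell k p q s, g x := by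
    rw [mul_comm, ← smul_eq_mul, ← setIntegral_const]
    refine setIntegral_mono_on (integrableOn_const hfinite.ne) (hgInt.mono_set inter_subset_left)
      (measurableSet_boxCell hpq s) fun x hx => ?_
    rw [div_le_iff₀ hV]
    exact hga x hx.1
  refine NNReal.le_toNNReal_of_coe_le (le_trans (le_of_eq ?_) h1)
  rw [volume_boxCell hpq]
  push_cast
  field_simp

lemma MemB.locallyIntegrable {d : ℕ} {f : (Fin d → ℝ) → ℝ} (hf : MemB d f) :
    LocallyIntegrable f := by
  intro x
  obtain ⟨U, hU, M, hM⟩ := hf.2.2 x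
  refine Measure.FiniteAtFilter.integrableAtFilter
    (hf.1.stronglyMeasurable.stronglyMeasurableAtFilter) (volume.finiteAt_nhds x) ⟨M, ?_⟩
  rw [eventually_map]
  filter_upwards [hU] with y hy
  rw [Function.comp_apply, Real.norm_eq_abs, abs_of_nonneg (hf.2.1 y)]
  exact hM (mem_image_of_mem f hy)

lemma MemB.integrableOn_hbox {d : ℕ} {f : (Fin d → ℝ) → ℝ} (hf : MemB d f) (p q : Fin d → ℝ) :
    IntegrableOn f (hbox p q) :=
  (hf.locallyIntegrable.integrableOn_isCompact (isCompact_Icc (a := p) (b := q))).mono_set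
    fun _ hx => ⟨fun i => (hx i trivial).1, fun i => (hx i trivial).2.le⟩

/-- Upper large deviation bound in a box, with polynomial rate. -/
lemma PoissonPP.measure_le_chainLength_le {d : ℕ} (hd : 0 < d) {Ω : Type*} [MeasurableSpace Ω]
    {P : Measure Ω} [IsProbabilityMeasure P] {c : ℝ} (hc : IsBWConstant d c) {δ : ℝ}
    (hδ : 0 < δ) (hδc : δ ≤ c) :
    ∃ C : ℝ, 0 ≤ C ∧ ∀ (g : (Fin d → ℝ) → ℝ) (PP : PoissonPP d P g) (_ : ∀ x, 0 ≤ g x)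
      (p q : Fin d → ℝ) (_ : ∀ i, p i < q i) (a : ℝ) (_ : 0 < a),
      ((∀ x ∈ hbox p q, g x ≤ a) →
        P {ω | (c + δ) * (a * ∏ i, (q i - p i)) ^ ((1 : ℝ) / d) ≤
          chainLength d (PP.pts ω ∩ hbox p q)} ≤
          ENNReal.ofReal (C / (a * ∏ i, (q i - p i)) ^ 2)) ∧
      (IntegrableOn g (hbox p q) → (∀ x ∈ hbox p q, a ≤ g x) →
        P {ω | (chainLength d (PP.pts ω ∩ hbox p q) : ℝ) ≤
          (c - δ) * (a * ∏ i, (q i - p i)) ^ ((1 : ℝ) / d)} ≤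
          ENNReal.ofReal (C / (a * ∏ i, (q i - p i)) ^ 2)) := by
  obtain ⟨C, hC, h⟩ := poissonized_chainLength_tail hd hc hδ hδc
  refine ⟨C, hC, fun g PP hg p q hpq a ha => ?_⟩
  have hV : 0 < ∏ i, (q i - p i) := Finset.prod_pos fun i _ => sub_pos.2 (hpq i)
  obtain ⟨r, hr⟩ : ∃ r : NNReal, (r : ℝ) = a * ∏ i, (q i - p i) :=
    ⟨_, Real.coe_toNNReal _ (mul_pos ha hV).le⟩
  obtain ⟨h1, h2⟩ := h r (by rw [← NNReal.coe_pos, hr]; exact mul_pos ha hV)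
  rw [hr] at h1 h2
  constructor
  · intro hga
    refine le_trans ?_ h1
    simp only [← Nat.ceil_le]
    exact PP.measure_le_chainLength hd hg hpq
      (fun x hx => hr ▸ mul_le_mul_of_nonneg_right (hga x hx) hV.le) _
  · intro hgInt hga
    refine le_trans ?_ h2
    have h0 : 0 ≤ (c - δ) * (a * ∏ i, (q i - p i)) ^ ((1 : ℝ) / d) :=
      mul_nonneg (sub_nonneg.2 hδc) (by positivity)
    simp only [← Nat.le_floor_iff h0, ← Nat.lt_succ_iff]
    exact PP.measure_chainLength_lt hd hg hpq hgInt
      (fun x hx => hr ▸ mul_le_mul_of_nonneg_right (hga x hx) hV.le) _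

lemma tsum_ofReal_div_sq_ne_top {C b : ℝ} (hC : 0 ≤ C) :
    ∑' n : ℕ, ENNReal.ofReal (C / (n * b) ^ 2) ≠ ⊤ := by
  have hs : Summable fun n : ℕ => C / (n * b) ^ 2 := by
    have := (Real.summable_one_div_nat_pow (p := 2)).2 one_lt_two
    refine (this.mul_left (C / b ^ 2)).congr fun n => ?_
    rw [mul_pow, mul_one_div, div_div, mul_comm]
  rw [← ENNReal.ofReal_tsum_of_nonneg (fun n => by positivity) hs]
  exact ENNReal.ofReal_ne_top

/-- Laws of large numbers in a fixed box. -/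
lemma ae_eventually_chainLength {d : ℕ} (hd : 0 < d) {c : ℝ} (hc : IsBWConstant d c)
    {f : (Fin d → ℝ) → ℝ} (hf : MemB d f) {Ω : Type*} [MeasurableSpace Ω] {P : Measure Ω}
    [IsProbabilityMeasure P] (PP : ∀ n : ℕ, PoissonPP d P fun z => (n : ℝ) * f z)
    {δ : ℝ} (hδ : 0 < δ) (hδc : δ ≤ c) {p q : Fin d → ℝ} (hpq : ∀ i, p i < q i) {a : ℝ}
    (ha : 0 < a) :
    ((∀ x ∈ hbox p q, f x ≤ a) → ∀ᵐ ω ∂P, ∀ᶠ n : ℕ in atTop,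
      (chainLength d ((PP n).pts ω ∩ hbox p q) : ℝ) ≤
        (c + δ) * (n * (a * ∏ i, (q i - p i))) ^ ((1 : ℝ) / d)) ∧
    ((∀ x ∈ hbox p q, a ≤ f x) → ∀ᵐ ω ∂P, ∀ᶠ n : ℕ in atTop,
      (c - δ) * (n * (a * ∏ i, (q i - p i))) ^ ((1 : ℝ) / d) ≤
        chainLength d ((PP n).pts ω ∩ hbox p q)) := by
  obtain ⟨C, hC, h⟩ := PoissonPP.measure_le_chainLength_le (P := P) hd hc hδ hδc
  have hgn : ∀ (n : ℕ) x, 0 ≤ (n : ℝ) * f x := fun n x => mul_nonneg n.cast_nonneg (hf.2.1 x)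
  have hbound : ∀ s : ℕ → Set Ω, (∀ n : ℕ, 0 < n → P (s n) ≤
      ENNReal.ofReal (C / (n * (a * ∏ i, (q i - p i))) ^ 2)) →
      ∀ᵐ ω ∂P, ∀ᶠ n in atTop, ω ∉ s n := by
    intro s hs
    have h0 : ∀ᵐ ω ∂P, ∀ᶠ n in atTop, ω ∉ (if n = 0 then ∅ else s n) := by
      refine ae_eventually_notMem (ne_top_of_le_ne_top
        (tsum_ofReal_div_sq_ne_top (b := a * ∏ i, (q i - p i)) hC) (ENNReal.tsum_le_tsum fun n => ?_))
      split_ifs with hn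
      · simp
      · exact hs n (Nat.pos_of_ne_zero hn)
    filter_upwards [h0] with ω hω
    filter_upwards [hω, eventually_ne_atTop 0] with n hn hn0
    simpa [hn0] using hn
  constructor
  · intro hfa
    filter_upwards [hbound (fun n => {ω | (c + δ) * (n * (a * ∏ i, (q i - p i))) ^ ((1 : ℝ) / d) ≤
        chainLength d ((PP n).pts ω ∩ hbox p q)}) fun n hn => by
          have := (h _ (PP n) (hgn n) p q hpq (n * a) (by positivity)).1
            fun x hx => mul_le_mul_of_nonneg_left (hfa x hx) n.cast_nonneg
          simpa only [mul_assoc] using this] with ω hω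
    filter_upwards [hω] with n hn
    exact (not_le.1 hn).le
  · intro hfa
    filter_upwards [hbound (fun n => {ω | (chainLength d ((PP n).pts ω ∩ hbox p q) : ℝ) ≤
        (c - δ) * (n * (a * ∏ i, (q i - p i))) ^ ((1 : ℝ) / d)}) fun n hn => by
          have := (h _ (PP n) (hgn n) p q hpq (n * a) (by positivity)).2
            ((hf.integrableOn_hbox p q).const_mul _)
            fun x hx => mul_le_mul_of_nonneg_left (hfa x hx) n.cast_nonneg
          simpa only [mul_assoc] using this] with ω hω
    filter_upwards [hω] with n hn
    exact (not_le.1 hn).le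

/-- The point of the grid of mesh `1 / (H + 1)` with integer coordinates `k`. -/
def gridPt {d : ℕ} (H : ℕ) (k : Fin d → ℤ) : Fin d → ℝ := fun i => k i / ((H : ℝ) + 1)

/-- The deterministic properties of a typical realization of the sequence of point sets. -/
structure TypicalSeq (d : ℕ) (c : ℝ) (f : (Fin d → ℝ) → ℝ) (S : ℕ → Set (Fin d → ℝ)) : Prop where
  finite : ∀ n (H : ℕ) (k l : Fin d → ℤ), (S n ∩ hbox (gridPt H k) (gridPt H l)).Finite
  upper : ∀ (H : ℕ) (k l : Fin d → ℤ) (a : ℚ) (j : ℕ), (∀ i, k i < l i) → 0 < a →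
    (∀ x ∈ hbox (gridPt H k) (gridPt H l), f x ≤ a) → ∀ᶠ n : ℕ in atTop,
      (chainLength d (S n ∩ hbox (gridPt H k) (gridPt H l)) : ℝ) ≤
        (c + c / (j + 1)) * (n * (a * ∏ i, (gridPt H l i - gridPt H k i))) ^ ((1 : ℝ) / d)
  lower : ∀ (H : ℕ) (k l : Fin d → ℤ) (a : ℚ) (j : ℕ), (∀ i, k i < l i) → 0 < a →
    (∀ x ∈ hbox (gridPt H k) (gridPt H l), a ≤ f x) → ∀ᶠ n : ℕ in atTop,
      (c - c / (j + 1)) * (n * (a * ∏ i, (gridPt H l i - gridPt H k i))) ^ ((1 : ℝ) / d) ≤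
        chainLength d (S n ∩ hbox (gridPt H k) (gridPt H l))

lemma ae_typicalSeq {d : ℕ} (hd : 0 < d) {c : ℝ} (hc : IsBWConstant d c)
    {f : (Fin d → ℝ) → ℝ} (hf : MemB d f) {Ω : Type*} [MeasurableSpace Ω] {P : Measure Ω}
    [IsProbabilityMeasure P] (PP : ∀ n : ℕ, PoissonPP d P fun z => (n : ℝ) * f z) :
    ∀ᵐ ω ∂P, TypicalSeq d c f fun n => (PP n).pts ω := by
  have hc0 := hc.1
  have hδ : ∀ j : ℕ, 0 < c / ((j : ℝ) + 1) := fun j => by positivity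
  have hδc : ∀ j : ℕ, c / ((j : ℝ) + 1) ≤ c := fun j =>
    div_le_self hc0.le (by linarith [j.cast_nonneg (α := ℝ)])
  have hgrid : ∀ (H : ℕ) (k l : Fin d → ℤ), (∀ i, k i < l i) → ∀ i, gridPt H k i < gridPt H l i := by
    intro H k l hkl i
    have : (k i : ℝ) < l i := by exact_mod_cast hkl i
    unfold gridPt
    gcongr
  have h1 : ∀ᵐ ω ∂P, ∀ n (H : ℕ) (k l : Fin d → ℤ),
      ((PP n).pts ω ∩ hbox (gridPt H k) (gridPt H l)).Finite := by
    simp only [ae_all_iff]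
    exact fun n H k l => (PP n).ae_finite (fun x => mul_nonneg n.cast_nonneg (hf.2.1 x))
      (measurableSet_hbox _ _) (isBounded_hbox _ _)
  have h2 : ∀ᵐ ω ∂P, ∀ (H : ℕ) (k l : Fin d → ℤ) (a : ℚ) (j : ℕ), (∀ i, k i < l i) → 0 < a →
      (∀ x ∈ hbox (gridPt H k) (gridPt H l), f x ≤ a) → ∀ᶠ n : ℕ in atTop,
      (chainLength d ((PP n).pts ω ∩ hbox (gridPt H k) (gridPt H l)) : ℝ) ≤
        (c + c / (j + 1)) * (n * (a * ∏ i, (gridPt H l i - gridPt H k i))) ^ ((1 : ℝ) / d) := by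
    simp only [ae_all_iff]
    exact fun H k l a j hkl ha =>
      (ae_eventually_chainLength hd hc hf PP (hδ j) (hδc j) (hgrid H k l hkl)
        (Rat.cast_pos.2 ha)).1
  have h3 : ∀ᵐ ω ∂P, ∀ (H : ℕ) (k l : Fin d → ℤ) (a : ℚ) (j : ℕ), (∀ i, k i < l i) → 0 < a →
      (∀ x ∈ hbox (gridPt H k) (gridPt H l), a ≤ f x) → ∀ᶠ n : ℕ in atTop,
      (c - c / (j + 1)) * (n * (a * ∏ i, (gridPt H l i - gridPt H k i))) ^ ((1 : ℝ) / d) ≤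
        chainLength d ((PP n).pts ω ∩ hbox (gridPt H k) (gridPt H l)) := by
    simp only [ae_all_iff]
    exact fun H k l a j hkl ha =>
      (ae_eventually_chainLength hd hc hf PP (hδ j) (hδc j) (hgrid H k l hkl)
        (Rat.cast_pos.2 ha)).2
  filter_upwards [h1, h2, h3] with ω h1 h2 h3
  exact ⟨h1, h2, h3⟩

lemma chainLength_le_of_forall {d : ℕ} {A : Set (Fin d → ℝ)} {B : ℝ} (hB : 0 ≤ B)
    (h : ∀ C : Finset (Fin d → ℝ), ↑C ⊆ A → IsChain (· ≤ ·) (C : Set (Fin d → ℝ)) →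
      (C.card : ℝ) ≤ B) : (chainLength d A : ℝ) ≤ B := by
  rw [← Nat.le_floor_iff hB]
  refine csSup_le ⟨0, ∅, by simp⟩ ?_
  rintro _ ⟨C, hCA, hC, rfl⟩
  exact Nat.le_floor (h C hCA hC)

/-- A finite nonempty chain is contained in the order interval of its extremal elements. -/
lemma IsChain.exists_subset_Icc {α : Type*} [PartialOrder α] {C : Finset α} (hne : C.Nonempty)
    (hC : IsChain (· ≤ ·) (C : Set α)) :
    ∃ p ∈ C, ∃ q ∈ C, ∀ z ∈ C, p ≤ z ∧ z ≤ q := by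
  obtain ⟨p, hp⟩ := C.exists_minimal hne
  obtain ⟨q, hq⟩ := C.exists_maximal hne
  refine ⟨p, hp.1, q, hq.1, fun z hz => ⟨?_, ?_⟩⟩
  · exact (hC.total hp.1 hz).elim id (hp.2 hz)
  · exact (hC.total hz hq.1).elim id (hq.2 hz)

/-- The arithmetic-geometric mean inequality for the volume of a box. -/
lemma rpow_box_le {d : ℕ} (hd : 0 < d) {v w : Fin d → ℝ} (hv : ∀ i, 0 < v i) (hw : ∀ i, 0 ≤ w i)
    {a b s : ℝ} (ha : 0 ≤ a) (hb : 0 ≤ b) (hs : ∑ i, v i * w i ≤ s) :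
    (b * (a * ∏ i, w i)) ^ ((1 : ℝ) / d) ≤
      b ^ ((1 : ℝ) / d) * ((a / ∏ i, v i) ^ ((1 : ℝ) / d) * (s / d)) := by
  have hV : 0 < ∏ i, v i := Finset.prod_pos fun i _ => hv i
  have hW : 0 ≤ ∏ i, w i := Finset.prod_nonneg fun i _ => hw i
  have h1 : (∏ i, v i * w i) ^ ((1 : ℝ) / d) ≤ s / d := by
    have h := Real.geom_mean_le_arith_mean (Finset.univ : Finset (Fin d)) (fun _ => 1)
      (fun i => v i * w i) (fun _ _ => zero_le_one) (by simpa using hd)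
      (fun i _ => mul_nonneg (hv i).le (hw i))
    simp only [Real.rpow_one, Finset.sum_const, Finset.card_univ, Fintype.card_fin, nsmul_eq_mul,
      mul_one, one_mul, ← one_div] at h
    exact h.trans (by gcongr)
  have h2 : b * (a * ∏ i, w i) = b * ((a / ∏ i, v i) * ∏ i, v i * w i) := by
    rw [Finset.prod_mul_distrib]
    field_simp
  have h3 : 0 ≤ ∏ i, v i * w i := Finset.prod_nonneg fun i _ => mul_nonneg (hv i).le (hw i)
  rw [h2, Real.mul_rpow hb (by positivity), Real.mul_rpow (by positivity) h3]
  gcongr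

/-- Rounding a closed box to an enclosing grid box. -/
lemma exists_grid_box {d : ℕ} (H : ℕ) {p q : Fin d → ℝ} (hpq : p ≤ q) :
    ∃ k l : Fin d → ℤ, (∀ i, k i = ⌊p i * ((H : ℝ) + 1)⌋) ∧ (∀ i, l i = ⌊q i * ((H : ℝ) + 1)⌋ + 1) ∧
      (∀ i, k i < l i) ∧ Icc p q ⊆ hbox (gridPt H k) (gridPt H l) ∧
      (∀ i, p i - 1 / ((H : ℝ) + 1) ≤ gridPt H k i) ∧
      (∀ i, gridPt H l i ≤ q i + 1 / ((H : ℝ) + 1)) := by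
  have hH : (0 : ℝ) < (H : ℝ) + 1 := by positivity
  refine ⟨fun i => ⌊p i * ((H : ℝ) + 1)⌋, fun i => ⌊q i * ((H : ℝ) + 1)⌋ + 1, fun i => rfl,
    fun i => rfl, fun i => ?_, ?_, fun i => ?_, fun i => ?_⟩
  · exact Int.lt_add_one_of_le (Int.floor_le_floor (mul_le_mul_of_nonneg_right (hpq i) hH.le))
  · rintro z ⟨hz1, hz2⟩ i -
    constructor
    · rw [gridPt, div_le_iff₀ hH]
      exact (Int.floor_le _).trans (mul_le_mul_of_nonneg_right (hz1 i) hH.le)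
    · rw [gridPt, lt_div_iff₀ hH]
      push_cast
      exact (mul_le_mul_of_nonneg_right (hz2 i) hH.le).trans_lt (Int.lt_floor_add_one _)
  · rw [gridPt, le_div_iff₀ hH, sub_mul, one_div_mul_cancel hH.ne']
    exact (Int.sub_one_lt_floor _).le
  · rw [gridPt, div_le_iff₀ hH, add_mul, one_div_mul_cancel hH.ne']
    push_cast
    gcongr
    exact Int.floor_le _

lemma TypicalSeq.finite_inter {d : ℕ} {c : ℝ} {f : (Fin d → ℝ) → ℝ} {S : ℕ → Set (Fin d → ℝ)}
    (hS : TypicalSeq d c f S) {p q : Fin d → ℝ} (hpq : p ≤ q) (n : ℕ) :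
    (S n ∩ Icc p q).Finite := by
  obtain ⟨k, l, -, -, -, h, -⟩ := exists_grid_box 0 hpq
  exact (hS.finite n 0 k l).subset (inter_subset_inter_right _ h)

/-- Eventually, all chains in boxes near `x₀` obey the upper bound. -/
lemma TypicalSeq.eventually_card_le {d : ℕ} (hd : 0 < d) {c : ℝ} (hc : 0 < c)
    {f : (Fin d → ℝ) → ℝ} {S : ℕ → Set (Fin d → ℝ)} (hS : TypicalSeq d c f S)
    {x₀ v : Fin d → ℝ} (hv : ∀ i, 0 < v i) {a : ℚ} (ha : 0 < a) {ρ : ℝ}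
    (hfa : ∀ x, (∀ i, |x i - x₀ i| ≤ ρ) → f x ≤ a) (H j : ℕ) (hH : 1 / ((H : ℝ) + 1) ≤ ρ / 2)
    {s : ℝ} :
    ∀ᶠ n : ℕ in atTop, ∀ C : Finset (Fin d → ℝ), ↑C ⊆ S n → IsChain (· ≤ ·) (C : Set (Fin d → ℝ)) →
      ∀ p q : Fin d → ℝ, p ≤ q → ↑C ⊆ Icc p q → (∀ i, x₀ i - ρ / 2 ≤ p i) → q ≤ x₀ →
      ∑ i, v i * (q i - p i) ≤ s →
      (C.card : ℝ) ≤ (c + c / (j + 1)) * ((n : ℝ) ^ ((1 : ℝ) / d) *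
        (((a : ℝ) / ∏ i, v i) ^ ((1 : ℝ) / d) * ((s + 2 * (1 / ((H : ℝ) + 1)) * ∑ i, v i) / d))) := by
  have hh : (0 : ℝ) < 1 / ((H : ℝ) + 1) := by positivity
  have hHpos : (0 : ℝ) < (H : ℝ) + 1 := by positivity
  set K : Fin d → ℤ := fun i => ⌊(x₀ i - ρ) * ((H : ℝ) + 1)⌋
  set L : Fin d → ℤ := fun i => ⌊(x₀ i + ρ) * ((H : ℝ) + 1)⌋ + 1
  have hfin : {kl : (Fin d → ℤ) × (Fin d → ℤ) | kl ∈ Icc K L ×ˢ Icc K L}.Finite :=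
    (finite_Icc K L).prod (finite_Icc K L)
  have hev := (eventually_all_finite hfin (l := atTop) (p := fun kl (n : ℕ) =>
    (∀ i, kl.1 i < kl.2 i) → (∀ x ∈ hbox (gridPt H kl.1) (gridPt H kl.2), f x ≤ a) →
    (chainLength d (S n ∩ hbox (gridPt H kl.1) (gridPt H kl.2)) : ℝ) ≤
      (c + c / (j + 1)) *
        (n * (a * ∏ i, (gridPt H kl.2 i - gridPt H kl.1 i))) ^ ((1 : ℝ) / d))).2 (by
    intro kl _
    by_cases h : (∀ i, kl.1 i < kl.2 i) ∧ ∀ x ∈ hbox (gridPt H kl.1) (gridPt H kl.2), f x ≤ a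
    · filter_upwards [hS.upper H kl.1 kl.2 a j h.1 ha h.2] with n hn _ _
      exact hn
    · exact Eventually.of_forall fun n h1 h2 => absurd ⟨h1, h2⟩ h)
  filter_upwards [hev] with n hn C hCS hC p q hpq hCpq hp hq hsum
  obtain ⟨k, l, hk, hl, hkl, hsub, hkp, hlq⟩ := exists_grid_box H hpq
  have hKk : ∀ i, K i ≤ k i := fun i => by
    rw [hk]
    refine Int.floor_le_floor (mul_le_mul_of_nonneg_right ?_ hHpos.le)
    linarith [hp i]
  have hlL : ∀ i, l i ≤ L i := fun i => by
    rw [hl]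
    refine Int.add_le_add_right (Int.floor_le_floor (mul_le_mul_of_nonneg_right ?_ hHpos.le)) 1
    linarith [hq i]
  have hlen : (C.card : ℝ) ≤ chainLength d (S n ∩ hbox (gridPt H k) (gridPt H l)) := by
    exact_mod_cast card_le_chainLength (hS.finite n H k l)
      (subset_inter hCS (hCpq.trans hsub)) hC
  refine hlen.trans ((hn (k, l) ⟨⟨hKk, fun i => (hkl i).le.trans (hlL i)⟩,
    ⟨fun i => (hKk i).trans (hkl i).le, hlL⟩⟩ hkl ?_).trans ?_)
  · intro x hx
    refine hfa x fun i => ?_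
    have h1 := (hx i trivial).1
    have h2 := (hx i trivial).2
    dsimp only at h1 h2
    rw [abs_le]
    constructor <;> linarith [hkp i, hlq i, hp i, hq i]
  · refine mul_le_mul_of_nonneg_left (rpow_box_le hd hv (fun i => ?_) (by exact_mod_cast ha.le)
      n.cast_nonneg ?_) (by positivity)
    · have : (k i : ℝ) ≤ l i := by exact_mod_cast (hkl i).le
      rw [sub_nonneg]
      unfold gridPt
      gcongr
    · refine le_trans ?_ (add_le_add_left hsum _)
      rw [Finset.mul_sum, ← Finset.sum_add_distrib]
      refine Finset.sum_le_sum fun i _ => ?_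
      have := mul_le_mul_of_nonneg_left (show gridPt H l i - gridPt H k i ≤
        (q i - p i) + 2 * (1 / ((H : ℝ) + 1)) by linarith [hkp i, hlq i]) (hv i).le
      linarith

/-- Upper bound for chains in a small simplex with vertex `x₀`. -/
lemma TypicalSeq.eventually_card_le_simplex {d : ℕ} (hd : 0 < d) {c : ℝ} (hc : 0 < c)
    {f : (Fin d → ℝ) → ℝ} {S : ℕ → Set (Fin d → ℝ)} (hS : TypicalSeq d c f S)
    {x₀ v : Fin d → ℝ} (hv : ∀ i, 0 < v i) {a : ℚ} (ha : 0 < a) {ρ : ℝ} (hρ : 0 < ρ)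
    (hfa : ∀ x, (∀ i, |x i - x₀ i| ≤ ρ) → f x ≤ a) {r : ℝ} (hr : 0 < r)
    (hrρ : ∀ i, r ≤ v i * (ρ / 2)) {θ : ℝ}
    (hθ : c / d * ((a : ℝ) / ∏ i, v i) ^ ((1 : ℝ) / d) * r < θ) :
    ∀ᶠ n : ℕ in atTop, ∀ C : Finset (Fin d → ℝ), ↑C ⊆ S n → IsChain (· ≤ ·) (C : Set (Fin d → ℝ)) →
      (∀ z ∈ C, z ≤ x₀ ∧ ∑ i, v i * (x₀ i - z i) ≤ r) →
      (C.card : ℝ) ≤ θ * (n : ℝ) ^ ((1 : ℝ) / d) := by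
  set A := ((a : ℝ) / ∏ i, v i) ^ ((1 : ℝ) / d) with hA
  set sv := ∑ i, v i with hsv
  have ht : Tendsto (fun m : ℕ => 1 / ((m : ℝ) + 1)) atTop (𝓝 0) :=
    tendsto_one_div_add_atTop_nhds_zero_nat
  have hlim : Tendsto (fun t : ℝ => (c + c * t) * (A * (((1 + t) * r + 2 * (t * (1 + t)) * sv) / d)))
      (𝓝 0) (𝓝 (c / d * A * r)) := by
    have : Continuous fun t : ℝ =>
        (c + c * t) * (A * (((1 + t) * r + 2 * (t * (1 + t)) * sv) / d)) := by fun_prop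
    refine (this.tendsto' _ _ ?_)
    ring
  have hsmall : ∀ᶠ m : ℕ in atTop, 1 / ((m : ℝ) + 1) < ρ / 2 :=
    ht.eventually_lt_const (half_pos hρ)
  obtain ⟨m, hm, hmρ⟩ := (((hlim.comp ht).eventually_lt_const hθ).and hsmall).exists
  simp only [Function.comp_apply] at hm
  set t := 1 / ((m : ℝ) + 1) with htdef
  have ht0 : 0 < t := by positivity
  have ht1 : t ≤ 1 := by
    rw [htdef, div_le_one (by positivity)]
    linarith [m.cast_nonneg (α := ℝ)]
  have htm : t * (m + 1) = 1 := one_div_mul_cancel (by positivity)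
  have hHt : 1 / (((m * (m + 2) : ℕ) : ℝ) + 1) = t * t := by
    rw [htdef]
    push_cast
    field_simp
    ring
  have hev := hS.eventually_card_le hd hc hv ha hfa (m * (m + 2)) m
    (by rw [hHt]; nlinarith) (s := t * r)
  filter_upwards [hev] with n hn C hCS hC hCx
  set level : (Fin d → ℝ) → ℕ := fun z => ⌊(∑ i, v i * (x₀ i - z i)) / (t * r)⌋₊ with hlevel
  have hw0 : ∀ z ∈ C, 0 ≤ ∑ i, v i * (x₀ i - z i) := fun z hz =>
    Finset.sum_nonneg fun i _ => mul_nonneg (hv i).le (sub_nonneg.2 ((hCx z hz).1 i))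
  have hmaps : ∀ z ∈ C, level z ∈ Finset.range (m + 2) := by
    intro z hz
    rw [Finset.mem_range, hlevel, Nat.floor_lt (div_nonneg (hw0 z hz) (by positivity)),
      div_lt_iff₀ (by positivity)]
    push_cast
    have h2 := (hCx z hz).2
    nlinarith
  rw [Finset.card_eq_sum_card_fiberwise hmaps]
  push_cast
  set B := (c + c * t) * ((n : ℝ) ^ ((1 : ℝ) / d) * (A * ((t * r + 2 * (t * t) * sv) / d))) with hB
  have hA0 : 0 ≤ A := by
    have : 0 < ∏ i, v i := Finset.prod_pos fun i _ => hv i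
    have : (0 : ℝ) < a := by exact_mod_cast ha
    positivity
  have hsv0 : 0 ≤ sv := Finset.sum_nonneg fun i _ => (hv i).le
  have hpiece : ∀ b ∈ Finset.range (m + 2), ((C.filter fun z => level z = b).card : ℝ) ≤ B := by
    intro b _
    rcases (C.filter fun z => level z = b).eq_empty_or_nonempty with he | hne
    · rw [he, Finset.card_empty, Nat.cast_zero]
      positivity
    · have hsub : (↑(C.filter fun z => level z = b) : Set (Fin d → ℝ)) ⊆ C :=
        Finset.coe_subset.2 (Finset.filter_subset _ _)
      have hC' := hC.mono hsub
      obtain ⟨p, hp, q, hq, hpq⟩ := IsChain.exists_subset_Icc hne hC'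
      rw [Finset.mem_filter] at hp hq
      have hpx := hCx p hp.1
      have hqx := hCx q hq.1
      have h := hn _ (hsub.trans hCS) hC' p q (hpq p (Finset.mem_filter.2 hp)).2
        (fun z hz => hpq z hz) (fun i => ?_) hqx.1 ?_
      · rwa [hHt, show c / ((m : ℝ) + 1) = c * t by rw [htdef, mul_one_div]] at h
      · have h1 : v i * (x₀ i - p i) ≤ r := le_trans
          (Finset.single_le_sum (f := fun i => v i * (x₀ i - p i))
            (fun i _ => mul_nonneg (hv i).le (sub_nonneg.2 (hpx.1 i))) (Finset.mem_univ i)) hpx.2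
        have h2 := le_of_mul_le_mul_left (h1.trans (hrρ i)) (hv i)
        linarith
      · have htr : 0 < t * r := by positivity
        have h1 := Nat.lt_floor_add_one ((∑ i, v i * (x₀ i - p i)) / (t * r))
        have h2 := Nat.floor_le (div_nonneg (hw0 q hq.1) htr.le)
        have h3 : ⌊(∑ i, v i * (x₀ i - p i)) / (t * r)⌋₊ = b := hp.2
        have h4 : ⌊(∑ i, v i * (x₀ i - q i)) / (t * r)⌋₊ = b := hq.2
        rw [h3, div_lt_iff₀ htr] at h1
        rw [h4, le_div_iff₀ htr] at h2
        have h5 : ∑ i, v i * (q i - p i) = ∑ i, v i * (x₀ i - p i) - ∑ i, v i * (x₀ i - q i) := by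
          rw [← Finset.sum_sub_distrib]
          exact Finset.sum_congr rfl fun i _ => by ring
        rw [h5]
        linarith
  refine (Finset.sum_le_sum hpiece).trans ?_
  rw [Finset.sum_const, Finset.card_range, nsmul_eq_mul]
  have hm2 : ((m + 2 : ℕ) : ℝ) * t = 1 + t := by
    push_cast
    linarith
  have : ((m + 2 : ℕ) : ℝ) * B = (c + c * t) * (A * (((1 + t) * r + 2 * (t * (1 + t)) * sv) / d)) *
      (n : ℝ) ^ ((1 : ℝ) / d) := by
    rw [hB, ← hm2]
    ring
  rw [this]
  gcongr

/-- Lower bound for chains in a small simplex with vertex `x₀`. -/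
lemma TypicalSeq.eventually_le_chainLength {d : ℕ} (hd : 0 < d) {c : ℝ} (hc : 0 < c)
    {f : (Fin d → ℝ) → ℝ} {S : ℕ → Set (Fin d → ℝ)} (hS : TypicalSeq d c f S)
    {x₀ v : Fin d → ℝ} (hv : ∀ i, 0 < v i) {a : ℚ} (ha : 0 < a) {ρ : ℝ}
    (hfa : ∀ x, (∀ i, |x i - x₀ i| ≤ ρ) → a ≤ f x) {r : ℝ} (hr : 0 < r)
    (hrρ : ∀ i, r ≤ v i * ρ) {θ : ℝ}
    (hθ : θ < c / d * ((a : ℝ) / ∏ i, v i) ^ ((1 : ℝ) / d) * r) {A : Set (Fin d → ℝ)}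
    (hA : ∀ z, z ≤ x₀ → ∑ i, v i * (x₀ i - z i) ≤ r → z ∈ A) (hfin : ∀ n, (S n ∩ A).Finite) :
    ∀ᶠ n : ℕ in atTop, θ * (n : ℝ) ^ ((1 : ℝ) / d) ≤ chainLength d (S n ∩ A) := by
  have hd' : (0 : ℝ) < d := by exact_mod_cast hd
  have ha' : (0 : ℝ) < a := by exact_mod_cast ha
  have hV : 0 < ∏ i, v i := Finset.prod_pos fun i _ => hv i
  have ht : Tendsto (fun m : ℕ => 1 / ((m : ℝ) + 1)) atTop (𝓝 0) :=
    tendsto_one_div_add_atTop_nhds_zero_nat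
  have hlim : Tendsto (fun t : ℝ => (c - c * t) *
      (a * ∏ i, (r / (d * v i) - 2 * t)) ^ ((1 : ℝ) / d)) (𝓝 0)
      (𝓝 (c / d * ((a : ℝ) / ∏ i, v i) ^ ((1 : ℝ) / d) * r)) := by
    have : Continuous fun t : ℝ => (c - c * t) *
        (a * ∏ i, (r / (d * v i) - 2 * t)) ^ ((1 : ℝ) / d) := by
      refine Continuous.mul (by fun_prop) (Continuous.rpow_const (by fun_prop) fun _ =>
        Or.inr (by positivity))
    refine this.tendsto' _ _ ?_
    have h1 : (a : ℝ) * ∏ i, (r / (d * v i) - 2 * 0) = (a / ∏ i, v i) * (r / d) ^ d := by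
      simp only [mul_zero, sub_zero, Finset.prod_div_distrib, Finset.prod_mul_distrib,
        Finset.prod_const, Finset.card_univ, Fintype.card_fin, div_pow]
      field_simp
    rw [h1, Real.mul_rpow (by positivity) (by positivity), one_div,
      Real.pow_rpow_inv_natCast (by positivity) hd.ne']
    ring
  have hpos : ∀ᶠ t in 𝓝 (0 : ℝ), ∀ i, 0 < r / (d * v i) - 2 * t := by
    rw [eventually_all]
    intro i
    have : Continuous fun t : ℝ => r / (d * v i) - 2 * t := by fun_prop
    refine (this.tendsto' 0 (r / (d * v i)) (by simp)).eventually_const_lt ?_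
    have := hv i
    positivity
  obtain ⟨m, hm, hmpos⟩ := (((hlim.comp ht).eventually_const_lt hθ).and (ht.eventually hpos)).exists
  simp only [Function.comp_apply] at hm
  set t := 1 / ((m : ℝ) + 1) with htdef
  have hM : (0 : ℝ) < (m : ℝ) + 1 := by positivity
  have ht0 : 0 < t := by positivity
  have ht1 : t ≤ 1 := by
    rw [htdef, div_le_one (by positivity)]
    linarith [m.cast_nonneg (α := ℝ)]
  set k : Fin d → ℤ := fun i => ⌈(x₀ i - r / (d * v i)) * ((m : ℝ) + 1)⌉ with hk
  set l : Fin d → ℤ := fun i => ⌊x₀ i * ((m : ℝ) + 1)⌋ with hl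
  have hk1 : ∀ i, x₀ i - r / (d * v i) ≤ gridPt m k i := fun i => by
    rw [gridPt, le_div_iff₀ hM]
    exact Int.le_ceil _
  have hk2 : ∀ i, gridPt m k i ≤ x₀ i - r / (d * v i) + t := fun i => by
    rw [gridPt, div_le_iff₀ hM, add_mul, htdef, one_div_mul_cancel hM.ne']
    exact (Int.ceil_lt_add_one _).le
  have hl1 : ∀ i, gridPt m l i ≤ x₀ i := fun i => by
    rw [gridPt, div_le_iff₀ hM]
    exact Int.floor_le _
  have hl2 : ∀ i, x₀ i - t ≤ gridPt m l i := fun i => by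
    rw [gridPt, le_div_iff₀ hM, sub_mul, htdef, one_div_mul_cancel hM.ne']
    exact (Int.sub_one_lt_floor _).le
  have hside : ∀ i, r / (d * v i) - 2 * t ≤ gridPt m l i - gridPt m k i := fun i => by
    linarith [hk2 i, hl2 i]
  have hkl : ∀ i, k i < l i := fun i => by
    have h1 : gridPt m k i < gridPt m l i := sub_pos.1 ((hmpos i).trans_le (hside i))
    rw [gridPt, gridPt, div_lt_div_iff_of_pos_right hM] at h1
    exact_mod_cast h1
  have hmem : ∀ z ∈ hbox (gridPt m k) (gridPt m l), z ≤ x₀ ∧ ∀ i, v i * (x₀ i - z i) ≤ r / d := by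
    intro z hz
    refine ⟨fun i => (hz i trivial).2.le.trans (hl1 i), fun i => ?_⟩
    have h1 : x₀ i - z i ≤ r / (d * v i) := by linarith [hk1 i, (hz i trivial).1]
    refine (mul_le_mul_of_nonneg_left h1 (hv i).le).trans_eq ?_
    have := hv i
    field_simp
  have hsub : hbox (gridPt m k) (gridPt m l) ⊆ A := by
    intro z hz
    refine hA z (hmem z hz).1 ((Finset.sum_le_sum fun i _ => (hmem z hz).2 i).trans_eq ?_)
    rw [Finset.sum_const, Finset.card_univ, Fintype.card_fin, nsmul_eq_mul]
    field_simp
  have hev := hS.lower m k l a m hkl ha (by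
    intro z hz
    refine hfa z fun i => ?_
    rw [abs_sub_comm, abs_of_nonneg (sub_nonneg.2 ((hmem z hz).1 i))]
    have h1 : r / d ≤ r := div_le_self hr.le (by exact_mod_cast hd)
    exact le_of_mul_le_mul_left (((hmem z hz).2 i).trans (h1.trans (hrρ i))) (hv i))
  filter_upwards [hev] with n hn
  have hmono : (chainLength d (S n ∩ hbox (gridPt m k) (gridPt m l)) : ℝ) ≤
      chainLength d (S n ∩ A) := by
    exact_mod_cast chainLength_mono (hfin n) (inter_subset_inter_right _ hsub)
  refine le_trans ?_ (hn.trans hmono)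
  have hprod : 0 ≤ ∏ i, (r / (d * v i) - 2 * t) := Finset.prod_nonneg fun i _ => (hmpos i).le
  have hct : 0 ≤ c - c * t := by nlinarith
  calc θ * (n : ℝ) ^ ((1 : ℝ) / d)
      ≤ (c - c * t) * (a * ∏ i, (r / (d * v i) - 2 * t)) ^ ((1 : ℝ) / d) *
        (n : ℝ) ^ ((1 : ℝ) / d) := by gcongr
    _ = (c - c * t) * (n * (a * ∏ i, (r / (d * v i) - 2 * t))) ^ ((1 : ℝ) / d) := by
        rw [Real.mul_rpow n.cast_nonneg (by positivity)]
        ring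
    _ ≤ (c - c * t) *
        (n * (a * ∏ i, (gridPt m l i - gridPt m k i))) ^ ((1 : ℝ) / d) := by
        have := Finset.prod_le_prod (s := Finset.univ) (fun i _ => (hmpos i).le)
          (fun i _ => hside i)
        gcongr
    _ = _ := by rw [htdef, mul_one_div]

/-- The set `A_ε(x₀)` of points below `x₀` near it at which `φ` exceeds `φ x₀ - ε`. -/
def superlevelPiece {d : ℕ} (x₀ : Fin d → ℝ) (φ : (Fin d → ℝ) → ℝ) (ε : ℝ) : Set (Fin d → ℝ) :=
  {z | euclNorm d (z - x₀) < Real.sqrt ε ∧ z ≤ x₀ ∧ φ x₀ - ε ≤ φ z}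

lemma abs_le_euclNorm {d : ℕ} (x : Fin d → ℝ) (i : Fin d) : |x i| ≤ euclNorm d x :=
  Real.abs_le_sqrt (Finset.single_le_sum (f := fun i => x i ^ 2) (fun _ _ => sq_nonneg _)
    (Finset.mem_univ i))

/-- The sets `A_ε(x₀)` are squeezed between simplices, to first order in `ε`. -/
lemma eventually_superlevelPiece {d : ℕ} {x₀ : Fin d → ℝ} {φ : (Fin d → ℝ) → ℝ}
    (hφ : DifferentiableAt ℝ φ x₀) {v : Fin d → ℝ} (hv : ∀ i, 0 < v i)
    (hφv : ∀ i, fderiv ℝ φ x₀ (Pi.single i 1) = v i) {η : ℝ} (hη : 0 < η) (hη1 : η < 1) :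
    ∀ᶠ ε in 𝓝[>] (0 : ℝ),
      (∀ z ∈ superlevelPiece x₀ φ ε, ∑ i, v i * (x₀ i - z i) ≤ (1 + η) * ε) ∧
      (∀ z, z ≤ x₀ → ∑ i, v i * (x₀ i - z i) ≤ (1 - η) * ε → z ∈ superlevelPiece x₀ φ ε) := by
  set M : ℝ := 1 + ∑ i, 1 / v i with hM
  have hM0 : 0 < M := by
    have : 0 ≤ ∑ i, 1 / v i := Finset.sum_nonneg fun i _ => (one_div_pos.2 (hv i)).le
    linarith
  have hw0 : ∀ z, z ≤ x₀ → ∀ i, 0 ≤ v i * (x₀ i - z i) := fun z hz i =>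
    mul_nonneg (hv i).le (sub_nonneg.2 (hz i))
  have hnorm : ∀ z, z ≤ x₀ → ‖z - x₀‖ ≤ M * ∑ i, v i * (x₀ i - z i) := by
    intro z hz
    have hs := Finset.sum_nonneg fun i (_ : i ∈ Finset.univ) => hw0 z hz i
    refine (pi_norm_le_iff_of_nonneg (by positivity)).2 fun i => ?_
    rw [Pi.sub_apply, Real.norm_eq_abs, abs_sub_comm, abs_of_nonneg (sub_nonneg.2 (hz i))]
    have h1 : 1 / v i ≤ M := by
      have := Finset.single_le_sum (f := fun i => 1 / v i)
        (fun i _ => (one_div_pos.2 (hv i)).le) (Finset.mem_univ i)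
      linarith
    have h2 := Finset.single_le_sum (f := fun i => v i * (x₀ i - z i))
      (fun i _ => hw0 z hz i) (Finset.mem_univ i)
    calc x₀ i - z i = 1 / v i * (v i * (x₀ i - z i)) := by
          have := (hv i).ne'
          field_simp
      _ ≤ M * ∑ i, v i * (x₀ i - z i) := mul_le_mul h1 h2 (hw0 z hz i) hM0.le
  have hlin : ∀ z, fderiv ℝ φ x₀ (z - x₀) = -∑ i, v i * (x₀ i - z i) := by
    intro z
    conv_lhs => rw [pi_eq_sum_univ' (z - x₀)]
    rw [map_sum, ← Finset.sum_neg_distrib]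
    refine Finset.sum_congr rfl fun i _ => ?_
    rw [map_smul, hφv, smul_eq_mul, Pi.sub_apply]
    ring
  have hd := hφ.hasFDerivAt.isLittleO.bound (c := η / 2 / M) (by positivity)
  obtain ⟨σ, hσ, hball⟩ := Metric.eventually_nhds_iff.1 hd
  have hkey : ∀ z, z ≤ x₀ → ‖z - x₀‖ < σ →
      |φ z - φ x₀ + ∑ i, v i * (x₀ i - z i)| ≤ η / 2 * ∑ i, v i * (x₀ i - z i) := by
    intro z hz hzσ
    have h := hball (by rwa [dist_eq_norm])
    rw [hlin, sub_neg_eq_add, Real.norm_eq_abs] at h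
    refine h.trans ((mul_le_mul_of_nonneg_left (hnorm z hz) (by positivity)).trans_eq ?_)
    field_simp
  have hε1 : ∀ᶠ ε in 𝓝[>] (0 : ℝ), Real.sqrt ε < σ :=
    (Real.continuous_sqrt.tendsto' 0 0 Real.sqrt_zero).mono_left nhdsWithin_le_nhds
      |>.eventually_lt_const hσ
  have hε2 : ∀ᶠ ε in 𝓝[>] (0 : ℝ), M * ε < σ := by
    have : Continuous fun ε : ℝ => M * ε := by fun_prop
    exact ((this.tendsto' 0 0 (by simp)).mono_left nhdsWithin_le_nhds).eventually_lt_const hσ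
  have hε3 : ∀ᶠ ε in 𝓝[>] (0 : ℝ), d * M ^ 2 * ε < 1 := by
    have : Continuous fun ε : ℝ => d * M ^ 2 * ε := by fun_prop
    exact ((this.tendsto' 0 0 (by simp)).mono_left nhdsWithin_le_nhds).eventually_lt_const one_pos
  filter_upwards [hε1, hε2, hε3, self_mem_nhdsWithin] with ε h1 h2 h3 (hε : 0 < ε)
  constructor
  · rintro z ⟨hz1, hz2, hz3⟩
    have hzσ : ‖z - x₀‖ < σ := by
      refine (pi_norm_lt_iff hσ).2 fun i => ?_
      exact (abs_le_euclNorm (z - x₀) i).trans_lt (hz1.trans h1)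
    have h := (abs_le.1 (hkey z hz2 hzσ)).2
    set w := ∑ i, v i * (x₀ i - z i)
    have h4 : (1 - η / 2) * w ≤ ε := by linarith
    have h5 : ε ≤ (1 - η / 2) * ((1 + η) * ε) := by nlinarith [mul_pos hη hε]
    exact le_of_mul_le_mul_left (h4.trans h5) (by linarith)
  · intro z hz hzw
    have hs := Finset.sum_nonneg fun i (_ : i ∈ Finset.univ) => hw0 z hz i
    have hn := hnorm z hz
    have hwε : ∑ i, v i * (x₀ i - z i) ≤ ε := hzw.trans (by nlinarith)
    have hnε : ‖z - x₀‖ ≤ M * ε := hn.trans (mul_le_mul_of_nonneg_left hwε hM0.le)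
    have h := (abs_le.1 (hkey z hz (hnε.trans_lt h2))).1
    refine ⟨?_, hz, ?_⟩
    · refine Real.sqrt_lt_sqrt (Finset.sum_nonneg fun i _ => sq_nonneg _) ?_
      have h4 : ∑ i, (z - x₀) i ^ 2 ≤ ∑ _i : Fin d, (M * ε) ^ 2 := by
        refine Finset.sum_le_sum fun i _ => ?_
        rw [← sq_abs]
        gcongr
        exact (norm_le_pi_norm (z - x₀) i).trans hnε
      refine h4.trans_lt ?_
      rw [Finset.sum_const, Finset.card_univ, Fintype.card_fin, nsmul_eq_mul]
      nlinarith
    · set w := ∑ i, v i * (x₀ i - z i)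
      have : (1 + η / 2) * w ≤ ε := by
        have : (1 + η / 2) * w ≤ (1 + η / 2) * ((1 - η) * ε) :=
          mul_le_mul_of_nonneg_left hzw (by linarith)
        nlinarith [mul_pos hη hε]
      linarith

/-- The rescaled length of the longest chain in `A_ε(x₀)`. -/
def scaledLength {d : ℕ} (S : ℕ → Set (Fin d → ℝ)) (x₀ : Fin d → ℝ) (φ : (Fin d → ℝ) → ℝ)
    (ε : ℝ) (n : ℕ) : ℝ :=
  ε⁻¹ * (n : ℝ) ^ (-(1 : ℝ) / d) * (chainLength d (S n ∩ superlevelPiece x₀ φ ε) : ℝ)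

lemma scaledLength_eq {d : ℕ} (S : ℕ → Set (Fin d → ℝ)) (x₀ : Fin d → ℝ) (φ : (Fin d → ℝ) → ℝ)
    (ε : ℝ) (n : ℕ) : scaledLength S x₀ φ ε n =
      chainLength d (S n ∩ superlevelPiece x₀ φ ε) / (ε * (n : ℝ) ^ ((1 : ℝ) / d)) := by
  rw [scaledLength, neg_div, Real.rpow_neg n.cast_nonneg]
  field_simp

lemma scaledLength_nonneg {d : ℕ} (S : ℕ → Set (Fin d → ℝ)) (x₀ : Fin d → ℝ)
    (φ : (Fin d → ℝ) → ℝ) {ε : ℝ} (hε : 0 < ε) (n : ℕ) : 0 ≤ scaledLength S x₀ φ ε n := by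
  unfold scaledLength
  positivity

lemma MemB.isBoundedUnder {d : ℕ} {f : (Fin d → ℝ) → ℝ} (hf : MemB d f) (x : Fin d → ℝ) :
    IsBoundedUnder (· ≤ ·) (𝓝 x) f := by
  obtain ⟨U, hU, M, hM⟩ := hf.2.2 x
  refine ⟨M, ?_⟩
  rw [eventually_map]
  filter_upwards [hU] with y hy
  exact hM (mem_image_of_mem f hy)

lemma MemB.isBoundedUnder_ge {d : ℕ} {f : (Fin d → ℝ) → ℝ} (hf : MemB d f) (x : Fin d → ℝ) :
    IsBoundedUnder (· ≥ ·) (𝓝 x) f :=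
  isBoundedUnder_of ⟨0, hf.2.1⟩

lemma exists_box_of_eventually {d : ℕ} {x₀ : Fin d → ℝ} {p : (Fin d → ℝ) → Prop}
    (h : ∀ᶠ x in 𝓝 x₀, p x) : ∃ ρ > 0, ∀ x, (∀ i, |x i - x₀ i| ≤ ρ) → p x := by
  obtain ⟨ρ, hρ, hball⟩ := Metric.eventually_nhds_iff.1 h
  refine ⟨ρ / 2, half_pos hρ, fun x hx => hball ?_⟩
  refine ((dist_pi_le_iff (half_pos hρ).le).2 fun i => ?_).trans_lt (half_lt_self hρ)
  rw [Real.dist_eq]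
  exact hx i

/-- Eventual upper bound for the rescaled lengths. -/
lemma TypicalSeq.eventually_scaledLength_le {d : ℕ} (hd : 0 < d) {c : ℝ} (hc : 0 < c)
    {f : (Fin d → ℝ) → ℝ} (hf : MemB d f) {S : ℕ → Set (Fin d → ℝ)} (hS : TypicalSeq d c f S)
    {x₀ : Fin d → ℝ} {φ : (Fin d → ℝ) → ℝ} (hφ : DifferentiableAt ℝ φ x₀) {v : Fin d → ℝ}
    (hv : ∀ i, 0 < v i) (hφv : ∀ i, fderiv ℝ φ x₀ (Pi.single i 1) = v i) {θ : ℝ}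
    (hθ : c / d * (upperEnv d f x₀ / ∏ i, v i) ^ ((1 : ℝ) / d) < θ) :
    ∀ᶠ ε in 𝓝[>] (0 : ℝ), ∀ᶠ n : ℕ in atTop, scaledLength S x₀ φ ε n ≤ θ := by
  have hd' : (0 : ℝ) < d := by exact_mod_cast hd
  have hV : 0 < ∏ i, v i := Finset.prod_pos fun i _ => hv i
  have hfU : 0 ≤ upperEnv d f x₀ :=
    le_limsup_of_frequently_le (Eventually.of_forall hf.2.1).frequently (hf.isBoundedUnder x₀)
  have hcont : Continuous fun a : ℝ => c / d * (a / ∏ i, v i) ^ ((1 : ℝ) / d) :=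
    continuous_const.mul (Continuous.rpow_const (by fun_prop) fun _ => Or.inr (by positivity))
  have hev : ∀ᶠ a in 𝓝[>] (upperEnv d f x₀), c / d * (a / ∏ i, v i) ^ ((1 : ℝ) / d) < θ :=
    (hcont.continuousAt.tendsto.mono_left nhdsWithin_le_nhds).eventually_lt_const hθ
  obtain ⟨b, hb, hab⟩ := mem_nhdsGT_iff_exists_Ioo_subset.1 hev
  obtain ⟨a, ha1, ha2⟩ := exists_rat_btwn (mem_Ioi.1 hb)
  have ha : 0 < a := by exact_mod_cast hfU.trans_lt ha1
  have haθ : c / d * ((a : ℝ) / ∏ i, v i) ^ ((1 : ℝ) / d) < θ := hab ⟨ha1, ha2⟩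
  obtain ⟨ρ, hρ, hfa⟩ := exists_box_of_eventually
    (eventually_lt_of_limsup_lt (show limsup f (𝓝 x₀) < a from ha1) (hf.isBoundedUnder x₀))
  obtain ⟨η, ⟨hη, hη1⟩, hηθ⟩ : ∃ η ∈ Ioo (0 : ℝ) 1,
      c / d * ((a : ℝ) / ∏ i, v i) ^ ((1 : ℝ) / d) * (1 + η) < θ := by
    have hcont : Continuous fun η : ℝ =>
      c / d * ((a : ℝ) / ∏ i, v i) ^ ((1 : ℝ) / d) * (1 + η) := by fun_prop
    have h1 := ((hcont.tendsto' 0 _ (by simp)).mono_left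
      (nhdsWithin_le_nhds (s := Ioi 0))).eventually_lt_const haθ
    exact ((h1.and (Ioo_mem_nhdsGT one_pos)).exists).imp fun η h => ⟨h.2, h.1⟩
  have hsmall : ∀ᶠ ε in 𝓝[>] (0 : ℝ), ∀ i, (1 + η) * ε < v i * (ρ / 2) := by
    rw [eventually_all]
    intro i
    have hcont : Continuous fun ε : ℝ => (1 + η) * ε := by fun_prop
    exact ((hcont.tendsto' 0 0 (by simp)).mono_left nhdsWithin_le_nhds).eventually_lt_const
      (mul_pos (hv i) (half_pos hρ))
  filter_upwards [eventually_superlevelPiece hφ hv hφv hη hη1, hsmall, self_mem_nhdsWithin] with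
    ε hA hερ (hε : 0 < ε)
  have hr : 0 < (1 + η) * ε := by positivity
  have hθ' : c / d * ((a : ℝ) / ∏ i, v i) ^ ((1 : ℝ) / d) * ((1 + η) * ε) < θ * ε := by
    rw [← mul_assoc]
    exact mul_lt_mul_of_pos_right hηθ hε
  have hθ0 : 0 < θ := by
    refine lt_of_le_of_lt ?_ haθ
    have : (0 : ℝ) < a := by exact_mod_cast ha
    positivity
  filter_upwards [hS.eventually_card_le_simplex hd hc hv ha hρ (fun x hx => (hfa x hx).le) hr
    (fun i => (hερ i).le) hθ', eventually_gt_atTop 0] with n hn hn0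
  have hn0' : (0 : ℝ) < n := by exact_mod_cast hn0
  rw [scaledLength_eq, div_le_iff₀ (by positivity), ← mul_assoc]
  refine chainLength_le_of_forall (by positivity) fun C hCA hC => ?_
  exact hn C (hCA.trans inter_subset_left) hC fun z hz =>
    ⟨(hCA hz).2.2.1, hA.1 z (hCA hz).2⟩

/-- Eventual lower bound for the rescaled lengths. -/
lemma TypicalSeq.eventually_le_scaledLength {d : ℕ} (hd : 0 < d) {c : ℝ} (hc : 0 < c)
    {f : (Fin d → ℝ) → ℝ} (hf : MemB d f) {S : ℕ → Set (Fin d → ℝ)} (hS : TypicalSeq d c f S)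
    {x₀ : Fin d → ℝ} {φ : (Fin d → ℝ) → ℝ} (hφ : DifferentiableAt ℝ φ x₀) {v : Fin d → ℝ}
    (hv : ∀ i, 0 < v i) (hφv : ∀ i, fderiv ℝ φ x₀ (Pi.single i 1) = v i) {θ : ℝ}
    (hθ : θ < c / d * (lowerEnv d f x₀ / ∏ i, v i) ^ ((1 : ℝ) / d)) :
    ∀ᶠ ε in 𝓝[>] (0 : ℝ), ∀ᶠ n : ℕ in atTop, θ ≤ scaledLength S x₀ φ ε n := by
  have hd' : (0 : ℝ) < d := by exact_mod_cast hd
  have hV : 0 < ∏ i, v i := Finset.prod_pos fun i _ => hv i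
  have hfL : 0 ≤ lowerEnv d f x₀ :=
    le_liminf_of_le (hf.isBoundedUnder x₀).isCoboundedUnder_ge (Eventually.of_forall hf.2.1)
  rcases hfL.eq_or_lt with h0 | h0
  · rw [← h0, zero_div, Real.zero_rpow (by positivity), mul_zero] at hθ
    filter_upwards [self_mem_nhdsWithin] with ε (hε : 0 < ε)
    exact Eventually.of_forall fun n => hθ.le.trans (scaledLength_nonneg S x₀ φ hε n)
  have hcont : Continuous fun a : ℝ => c / d * (a / ∏ i, v i) ^ ((1 : ℝ) / d) :=
    continuous_const.mul (Continuous.rpow_const (by fun_prop) fun _ => Or.inr (by positivity))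
  have hev : ∀ᶠ a in 𝓝[<] (lowerEnv d f x₀), θ < c / d * (a / ∏ i, v i) ^ ((1 : ℝ) / d) :=
    (hcont.continuousAt.tendsto.mono_left nhdsWithin_le_nhds).eventually_const_lt hθ
  obtain ⟨b, hb, hab⟩ := mem_nhdsLT_iff_exists_Ioo_subset.1 hev
  obtain ⟨a, ha1, ha2⟩ := exists_rat_btwn (max_lt (mem_Iio.1 hb) h0)
  have ha : 0 < a := by exact_mod_cast (le_max_right b 0).trans_lt ha1
  have haθ : θ < c / d * ((a : ℝ) / ∏ i, v i) ^ ((1 : ℝ) / d) :=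
    hab ⟨(le_max_left b 0).trans_lt ha1, ha2⟩
  obtain ⟨ρ, hρ, hfa⟩ := exists_box_of_eventually
    (eventually_lt_of_lt_liminf (show a < liminf f (𝓝 x₀) from ha2) (hf.isBoundedUnder_ge x₀))
  obtain ⟨η, ⟨hη, hη1⟩, hηθ⟩ : ∃ η ∈ Ioo (0 : ℝ) 1,
      θ < c / d * ((a : ℝ) / ∏ i, v i) ^ ((1 : ℝ) / d) * (1 - η) := by
    have hcont : Continuous fun η : ℝ =>
      c / d * ((a : ℝ) / ∏ i, v i) ^ ((1 : ℝ) / d) * (1 - η) := by fun_prop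
    have h1 := ((hcont.tendsto' 0 _ (by simp)).mono_left
      (nhdsWithin_le_nhds (s := Ioi 0))).eventually_const_lt haθ
    exact ((h1.and (Ioo_mem_nhdsGT one_pos)).exists).imp fun η h => ⟨h.2, h.1⟩
  have hsmall : ∀ᶠ ε in 𝓝[>] (0 : ℝ), ∀ i, (1 - η) * ε < v i * ρ := by
    rw [eventually_all]
    intro i
    have hcont : Continuous fun ε : ℝ => (1 - η) * ε := by fun_prop
    exact ((hcont.tendsto' 0 0 (by simp)).mono_left nhdsWithin_le_nhds).eventually_lt_const
      (mul_pos (hv i) hρ)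
  filter_upwards [eventually_superlevelPiece hφ hv hφv hη hη1, hsmall, self_mem_nhdsWithin] with
    ε hA hερ (hε : 0 < ε)
  have hr : 0 < (1 - η) * ε := mul_pos (sub_pos.2 hη1) hε
  have hθ' : θ * ε < c / d * ((a : ℝ) / ∏ i, v i) ^ ((1 : ℝ) / d) * ((1 - η) * ε) := by
    rw [← mul_assoc]
    exact mul_lt_mul_of_pos_right hηθ hε
  have hfin : ∀ n, (S n ∩ superlevelPiece x₀ φ ε).Finite := by
    intro n
    refine (hS.finite_inter (p := fun i => x₀ i - Real.sqrt ε) (q := x₀)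
      (fun i => sub_le_self _ (Real.sqrt_nonneg _)) n).subset (inter_subset_inter_right _ ?_)
    rintro z ⟨hz1, hz2, -⟩
    refine ⟨fun i => ?_, hz2⟩
    have := (abs_le.1 ((abs_le_euclNorm (z - x₀) i).trans hz1.le)).1
    rw [Pi.sub_apply] at this
    linarith
  filter_upwards [hS.eventually_le_chainLength hd hc hv ha (fun x hx => (hfa x hx).le) hr
    (fun i => (hερ i).le) hθ' hA.2 hfin, eventually_gt_atTop 0] with n hn hn0
  have hn0' : (0 : ℝ) < n := by exact_mod_cast hn0
  rwa [scaledLength_eq, le_div_iff₀ (by positivity), ← mul_assoc]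

/-- Consistency along a typical realization. -/
lemma TypicalSeq.consistency {d : ℕ} (hd : 0 < d) {c : ℝ} (hc : 0 < c)
    {f : (Fin d → ℝ) → ℝ} (hf : MemB d f) {S : ℕ → Set (Fin d → ℝ)} (hS : TypicalSeq d c f S)
    {x₀ : Fin d → ℝ} {φ : (Fin d → ℝ) → ℝ} (hφ : DifferentiableAt ℝ φ x₀)
    (hv : ∀ i, 0 < fderiv ℝ φ x₀ (Pi.single i 1)) :
    limsup (fun ε => limsup (scaledLength S x₀ φ ε) atTop) (𝓝[>] (0 : ℝ)) ≤
      c / d * (upperEnv d f x₀ / ∏ i, fderiv ℝ φ x₀ (Pi.single i 1)) ^ ((1 : ℝ) / d) ∧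
    c / d * (lowerEnv d f x₀ / ∏ i, fderiv ℝ φ x₀ (Pi.single i 1)) ^ ((1 : ℝ) / d) ≤
      liminf (fun ε => liminf (scaledLength S x₀ φ ε) atTop) (𝓝[>] (0 : ℝ)) := by
  have hbelow : ∀ ε > 0, IsBoundedUnder (· ≥ ·) atTop (scaledLength S x₀ φ ε) := fun ε hε =>
    isBoundedUnder_of ⟨0, scaledLength_nonneg S x₀ φ hε⟩
  have hub := fun {θ : ℝ} => hS.eventually_scaledLength_le hd hc hf hφ hv (fun _ => rfl) (θ := θ)
  have hlb := fun {θ : ℝ} => hS.eventually_le_scaledLength hd hc hf hφ hv (fun _ => rfl) (θ := θ)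
  constructor
  · refine le_of_forall_gt_imp_ge_of_dense fun θ hθ => ?_
    refine limsup_le_of_le (IsBoundedUnder.isCoboundedUnder_le ⟨0, ?_⟩) ?_
    · rw [eventually_map]
      filter_upwards [hub hθ, self_mem_nhdsWithin] with ε h (hε : 0 < ε)
      exact le_limsup_of_frequently_le
        (Eventually.of_forall (scaledLength_nonneg S x₀ φ hε)).frequently ⟨θ, h⟩
    · filter_upwards [hub hθ, self_mem_nhdsWithin] with ε h (hε : 0 < ε)
      exact limsup_le_of_le (hbelow ε hε).isCoboundedUnder_le h
  · obtain ⟨Θ, hΘ⟩ := exists_gt (c / d *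
      (upperEnv d f x₀ / ∏ i, fderiv ℝ φ x₀ (Pi.single i 1)) ^ ((1 : ℝ) / d))
    refine le_of_forall_lt_imp_le_of_dense fun θ hθ => ?_
    refine le_liminf_of_le (IsBoundedUnder.isCoboundedUnder_ge ⟨Θ, ?_⟩) ?_
    · rw [eventually_map]
      filter_upwards [hub hΘ, self_mem_nhdsWithin] with ε h (hε : 0 < ε)
      exact liminf_le_of_frequently_le h.frequently (hbelow ε hε)
    · filter_upwards [hub hΘ, hlb hθ] with ε h1 h2
      exact le_liminf_of_le (IsBoundedUnder.isCoboundedUnder_ge ⟨Θ, h1⟩) h2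

/-- Consistency: With probability one, simultaneously for all `x₀ ∈ (0,∞)^d` and
all `C²` functions `φ` with `∂φ/∂x_i(x₀) > 0` for every `i`, writing
`A_ε(x₀) = {x ∈ B(x₀,√ε) : x ≤ x₀, φ(x) ≥ φ(x₀) - ε}`,
`limsup_{ε→0⁺} limsup_n ε⁻¹ n^{-1/d} ℓ(𝒫_{nf} ∩ A_ε(x₀))
  ≤ (c_d/d) (f*(x₀) / ∏ᵢ ∂φ/∂x_i(x₀))^{1/d}` and the corresponding `liminf` lower bound
with `f_*`. -/
theorem longest_chain_consistency
    {d : ℕ} (hd : 0 < d) (c : ℝ) (hc : IsBWConstant d c)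
    (f : (Fin d → ℝ) → ℝ) (hf : MemB d f)
    {Ω : Type*} [MeasurableSpace Ω] (P : Measure Ω) [IsProbabilityMeasure P]
    (PP : ∀ n : ℕ, PoissonPP d P fun z => (n : ℝ) * f z) :
    P {ω | ∀ x₀ : Fin d → ℝ, (∀ i, 0 < x₀ i) →
      ∀ φ : (Fin d → ℝ) → ℝ, ContDiff ℝ 2 φ →
      (∀ i, 0 < fderiv ℝ φ x₀ (Pi.single i 1)) →
      limsup (fun ε : ℝ =>
          limsup (fun n : ℕ => ε⁻¹ * (n : ℝ) ^ (-(1 : ℝ) / d) *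
            (chainLength d ((PP n).pts ω ∩
              {z | euclNorm d (z - x₀) < Real.sqrt ε ∧ z ≤ x₀ ∧ φ x₀ - ε ≤ φ z}) : ℝ)) atTop)
        (𝓝[>] (0 : ℝ))
        ≤ c / d * (upperEnv d f x₀ /
            ∏ i, fderiv ℝ φ x₀ (Pi.single i 1)) ^ ((1 : ℝ) / d) ∧
      c / d * (lowerEnv d f x₀ /
          ∏ i, fderiv ℝ φ x₀ (Pi.single i 1)) ^ ((1 : ℝ) / d)
        ≤ liminf (fun ε : ℝ =>
            liminf (fun n : ℕ => ε⁻¹ * (n : ℝ) ^ (-(1 : ℝ) / d) *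
              (chainLength d ((PP n).pts ω ∩
                {z | euclNorm d (z - x₀) < Real.sqrt ε ∧ z ≤ x₀ ∧ φ x₀ - ε ≤ φ z}) : ℝ)) atTop)
          (𝓝[>] (0 : ℝ))} = 1 := by
  refine le_antisymm prob_le_one ?_
  rw [← measure_univ (μ := P)]
  refine measure_mono_ae ?_
  filter_upwards [ae_typicalSeq hd hc hf PP] with ω hω _
  exact fun x₀ _ φ hφ hv => hω.consistency hd hc.1 hf (hφ.differentiable (by norm_num) x₀) hv

end
end

section
/- Let d ≥ 2 and let K ≥ 2 be an integer. Define the simplex S = {x ∈ [0,1]^d : x_1 + ⋯ + x_d ≥ d − 1} and the finite grid I = {x ∈ [0,1]^d : K x ∈ ℤ^d and x_1 + ⋯ + x_d = d − 1 − d/K}. Then every chain C contained in S satisfies C ⊆ [x, 𝟙] for some x ∈ I, where 𝟙 = (1, …, 1). -/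
open MeasureTheory Filter Set Topology

noncomputable section

/-- A tuple of naturals can be decreased coordinatewise to attain any smaller sum. -/
theorem exists_le_sum_eq_of_le_sum {ι : Type*} [Fintype ι] (a : ι → ℕ) {n : ℕ}
    (hn : n ≤ ∑ i, a i) : ∃ b ≤ a, ∑ i, b i = n := by
  classical
  induction n with
  | zero => exact ⟨0, fun i => Nat.zero_le _, by simp⟩
  | succ n ih =>
    obtain ⟨b, hba, hb⟩ := ih (by omega)
    obtain ⟨i, -, hi⟩ := Finset.exists_lt_of_sum_lt (s := Finset.univ) (f := b) (g := a) (by omega)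
    refine ⟨b + Pi.single i 1, fun j => ?_, by simp [Finset.sum_add_distrib, hb]⟩
    rcases eq_or_ne j i with rfl | hj
    · simpa using hi
    · simpa [hj] using hba j

/-- A chain in `s` has a lower bound in `s`, provided `s` is nonempty. -/
theorem Finset.exists_mem_forall_le_of_isChain {α : Type*} [Preorder α] {C : Finset α}
    {s : Set α} (hC : ↑C ⊆ s) (hchain : IsChain (· ≤ ·) (C : Set α)) (hs : s.Nonempty) :
    ∃ m ∈ s, ∀ y ∈ C, m ≤ y := by
  rcases C.eq_empty_or_nonempty with rfl | hne
  · exact ⟨hs.some, hs.some_mem, by simp⟩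
  · obtain ⟨m, hm⟩ := C.exists_minimal hne
    refine ⟨m, hC hm.prop, fun y hy => ?_⟩
    exact (hchain.total hm.prop hy).elim id (hm.le_of_le hy)

/-- Every chain in the simplex `{x ∈ [0,1]^d : x₁ + ⋯ + x_d ≥ d - 1}` is
contained in `[x, 𝟙]` for some point `x` of the grid
`I = {x ∈ [0,1]^d : Kx ∈ ℤ^d, x₁ + ⋯ + x_d = d - 1 - d/K}`. -/
theorem chain_in_simplex_contained_in_grid_box
    {d : ℕ} (hd : 2 ≤ d) (K : ℕ) (hK : 2 ≤ K)
    (C : Finset (Fin d → ℝ)) (hchain : IsChain (· ≤ ·) (C : Set (Fin d → ℝ)))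
    (hC : ↑C ⊆ {x : Fin d → ℝ | x ∈ Set.Icc (0 : Fin d → ℝ) 1 ∧ (d : ℝ) - 1 ≤ ∑ i, x i}) :
    ∃ x : Fin d → ℝ, x ∈ Set.Icc (0 : Fin d → ℝ) 1 ∧
      (∀ i, ∃ m : ℤ, (K : ℝ) * x i = m) ∧
      (∑ i, x i = (d : ℝ) - 1 - d / K) ∧
      ↑C ⊆ Set.Icc x (1 : Fin d → ℝ) := by
  obtain ⟨m, ⟨⟨hm0, hm1⟩, hmsum⟩, hmC⟩ := Finset.exists_mem_forall_le_of_isChain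
    hC hchain ⟨1, ⟨zero_le_one, le_rfl⟩, by simp⟩
  have hKpos : (0 : ℝ) < K := by positivity
  obtain ⟨N, hN⟩ : ∃ N : ℕ, K * (d - 1) = N + d := by
    obtain ⟨e, rfl⟩ := Nat.exists_eq_add_of_le hd
    obtain ⟨k, rfl⟩ := Nat.exists_eq_add_of_le hK
    refine ⟨e + k * (e + 1), ?_⟩
    rw [show 2 + e - 1 = e + 1 by omega]
    ring
  have hNreal : (K : ℝ) * (d - 1) = N + d := by
    have h := congrArg (Nat.cast (R := ℝ)) hN
    rwa [Nat.cast_mul, Nat.cast_sub (by omega), Nat.cast_add, Nat.cast_one] at h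
  have hNle : N ≤ ∑ i, ⌊(K : ℝ) * m i⌋₊ := by
    have hfloor : ∑ i, (K : ℝ) * m i ≤ ∑ i, ((⌊(K : ℝ) * m i⌋₊ : ℝ) + 1) :=
      Finset.sum_le_sum fun i _ => (Nat.lt_floor_add_one _).le
    rw [← Finset.mul_sum, Finset.sum_add_distrib] at hfloor
    have hmul := mul_le_mul_of_nonneg_left hmsum hKpos.le
    simp only [Finset.sum_const, Finset.card_univ, Fintype.card_fin, nsmul_eq_mul,
      mul_one] at hfloor
    have : (N : ℝ) ≤ ∑ i, (⌊(K : ℝ) * m i⌋₊ : ℝ) := by linarith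
    exact_mod_cast this
  obtain ⟨b, hba, hb⟩ := exists_le_sum_eq_of_le_sum _ hNle
  have hbm : ∀ i, (b i : ℝ) / K ≤ m i := fun i => by
    rw [div_le_iff₀' hKpos]
    exact (Nat.cast_le.mpr (hba i)).trans (Nat.floor_le (mul_nonneg hKpos.le (hm0 i)))
  refine ⟨fun i => b i / K, ⟨fun i => by simp only [Pi.zero_apply]; positivity,
    fun i => (hbm i).trans (hm1 i)⟩, fun i => ⟨b i, ?_⟩, ?_,
    fun y hy => ⟨fun i => (hbm i).trans (hmC y hy i), (hC hy).1.2⟩⟩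
  · rw [mul_div_cancel₀ _ hKpos.ne', Int.cast_natCast]
  · rw [← Finset.sum_div, ← Nat.cast_sum, hb]
    field_simp
    linarith

end
end

section
/- Let x, y, v, q ∈ (0,∞)^d with x ≤ y, and suppose that for every j ∈ {1, …, d}, 1/q_j ≥ (1 + ⟨y − x, v⟩)/v_j. Then S_{x,v} ⊆ S_{y,q}. -/
open MeasureTheory Filter Set Topology

noncomputable section

/-- If `x ≤ y` and `1/q_j ≥ (1 + ⟨y - x, v⟩)/v_j` for all `j`, then
`S_{x,v} ⊆ S_{y,q}`. -/
theorem simplexS_subset_simplexS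
    {d : ℕ} (x y v q : Fin d → ℝ)
    (hx : ∀ i, 0 < x i) (hy : ∀ i, 0 < y i) (hv : ∀ i, 0 < v i) (hq : ∀ i, 0 < q i)
    (hxy : x ≤ y)
    (hineq : ∀ j, (1 + ∑ i, (y i - x i) * v i) / v j ≤ 1 / q j) :
    simplexS d x v ⊆ simplexS d y q := by
  rintro z ⟨hzx, hz⟩
  have hzy : z ≤ y := hzx.trans hxy
  refine ⟨hzy, ?_⟩
  set K := 1 + ∑ i, (y i - x i) * v i with hK
  have hKpos : 0 < K := by
    have : 0 ≤ ∑ i, (y i - x i) * v i :=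
      Finset.sum_nonneg fun i _ => mul_nonneg (sub_nonneg.2 (hxy i)) (hv i).le
    linarith
  have hqv : ∀ j, K * q j ≤ v j := fun j => by
    simpa using (div_le_div_iff₀ (hv j) (hq j)).1 (hineq j)
  refine le_of_mul_le_mul_left ?_ hKpos
  calc K * ∑ i, (y i - z i) * q i
      = ∑ i, (y i - z i) * (K * q i) := by
        rw [Finset.mul_sum]
        exact Finset.sum_congr rfl fun i _ => mul_left_comm _ _ _
    _ ≤ ∑ i, (y i - z i) * v i :=
        Finset.sum_le_sum fun i _ => mul_le_mul_of_nonneg_left (hqv i) (sub_nonneg.2 (hzy i))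
    _ = ∑ i, (y i - x i) * v i + ∑ i, (x i - z i) * v i := by
        rw [← Finset.sum_add_distrib]
        exact Finset.sum_congr rfl fun i _ => by ring
    _ ≤ K * 1 := by linarith

end
end

section
/- Let V_n : [0,∞)^d → ℝ (n ∈ ℕ) and V : [0,∞)^d → ℝ be functions that are nondecreasing with respect to the coordinatewise partial order, suppose V is continuous, and suppose V_n(x) → V(x) as n → ∞ for every x ∈ [0,∞)^d ∩ ℚ^d. Then for every M > 0, sup_{x ∈ [0,M]^d} |V_n(x) − V(x)| → 0 as n → ∞. -/
open MeasureTheory Filter Set Topology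

noncomputable section

/-- Every point of `[0,∞)^d` has a relative neighbourhood that is an order interval with
rational endpoints arbitrarily close to the point. -/
theorem exists_rat_Icc_mem_nhdsWithin_Ici {ι : Type*} [Fintype ι] {x : ι → ℝ} (hx : 0 ≤ x)
    {δ : ℝ} (hδ : 0 < δ) :
    ∃ p q : ι → ℝ, 0 ≤ p ∧ p ≤ x ∧ x ≤ q ∧ (∀ i, ∃ r : ℚ, p i = r) ∧ (∀ i, ∃ r : ℚ, q i = r) ∧
      dist p x < δ ∧ dist q x < δ ∧ Icc p q ∈ 𝓝[Ici 0] x := by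
  choose a ha using fun i => exists_rat_btwn (sub_lt_self (x i) hδ)
  choose b hb using fun i => exists_rat_btwn (lt_add_of_pos_right (x i) hδ)
  have hpx : ∀ i, max (a i : ℝ) 0 ≤ x i := fun i => max_le (ha i).2.le (hx i)
  refine ⟨fun i => max (a i : ℝ) 0, fun i => b i, fun i => le_max_right _ _, hpx,
    fun i => (hb i).1.le, fun i => ⟨max (a i) 0, by push_cast; rfl⟩, fun i => ⟨b i, rfl⟩,
    (dist_pi_lt_iff hδ).2 fun i => ?_, (dist_pi_lt_iff hδ).2 fun i => ?_, ?_⟩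
  · rw [Real.dist_eq, abs_lt]
    constructor <;> linarith [hpx i, (ha i).1, le_max_left (a i : ℝ) 0]
  · rw [Real.dist_eq, abs_lt]
    constructor <;> linarith [(hb i).1, (hb i).2]
  · have hnhds : ∀ᶠ y in 𝓝 x, ∀ i, (a i : ℝ) < y i ∧ y i < (b i : ℝ) :=
      eventually_all.2 fun i =>
        (continuous_apply i).continuousAt.eventually (Ioo_mem_nhds (ha i).2 (hb i).1)
    filter_upwards [mem_nhdsWithin_of_mem_nhds hnhds, self_mem_nhdsWithin] with y hy hy0
    exact ⟨fun i => max_le (hy i).1.le (hy0 i), fun i => (hy i).2.le⟩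

/-- If nondecreasing functions `V_n` converge pointwise on the rational points of
`[0,∞)^d` to a continuous nondecreasing `V`, then `V_n → V` uniformly on every box `[0,M]^d`. -/
theorem monotone_pointwise_to_locally_uniform
    {d : ℕ} (hd : 0 < d)
    (V : ℕ → (Fin d → ℝ) → ℝ) (W : (Fin d → ℝ) → ℝ)
    (hVmono : ∀ n, ∀ x y : Fin d → ℝ, 0 ≤ x → x ≤ y → V n x ≤ V n y)
    (hWmono : ∀ x y : Fin d → ℝ, 0 ≤ x → x ≤ y → W x ≤ W y)
    (hWcont : ContinuousOn W (Set.Ici (0 : Fin d → ℝ)))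
    (hconv : ∀ x : Fin d → ℝ, 0 ≤ x → (∀ i, ∃ q : ℚ, x i = (q : ℝ)) →
      Tendsto (fun n => V n x) atTop (𝓝 (W x))) :
    ∀ M : ℝ, 0 < M →
      TendstoUniformlyOn V W atTop (Set.Icc (0 : Fin d → ℝ) fun _ => M) := by
  intro M _
  rw [← tendstoLocallyUniformlyOn_iff_tendstoUniformlyOn_of_compact isCompact_Icc]
  refine TendstoLocallyUniformlyOn.mono (s := Ici 0) ?_ Icc_subset_Ici_self
  rw [Metric.tendstoLocallyUniformlyOn_iff]
  intro ε hε x hx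
  obtain ⟨δ, hδ, hW⟩ := Metric.continuousOn_iff.1 hWcont x hx (ε / 4) (by positivity)
  obtain ⟨p, q, hp, hpx, hxq, hpr, hqr, hpd, hqd, hmem⟩ := exists_rat_Icc_mem_nhdsWithin_Ici hx hδ
  have hq : 0 ≤ q := le_trans hx hxq
  refine ⟨Icc p q, hmem, ?_⟩
  filter_upwards [Metric.tendsto_nhds.1 (hconv p hp hpr) (ε / 4) (by positivity),
    Metric.tendsto_nhds.1 (hconv q hq hqr) (ε / 4) (by positivity)] with n hnp hnq y hy
  have hy0 : 0 ≤ y := hp.trans hy.1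
  have hWp := hW p hp hpd
  have hWq := hW q hq hqd
  rw [Real.dist_eq, abs_lt] at hnp hnq hWp hWq ⊢
  constructor <;> linarith [hVmono n p y hp hy.1, hVmono n y q hy0 hy.2,
    hWmono p y hp hy.1, hWmono y q hy0 hy.2]

end
end
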